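/- arXiv:1901.01109 — 4 statements merged into one kernel-verified Lean document; each statement's English description precedes it below -/
import Mathlib

section
/- For every natural number $N$, as $x \to 0^+$ we have $\sum_{n=1}^{\infty} \frac{e^{-n^2 x}}{n} = \frac{\gamma - \log x}{2} - \sum_{n=1}^{N} \frac{B_{2n}}{n!\,(2n)} (-x)^n + o(x^N)$, where $\gamma$ is the Euler–Mascheroni constant and $B_{2n}$ are the Bernoulli numbers. -/
open Real Filter Asymptotics

open MeasureTheory Set intervalIntegral
open scoped Topology Nat

/-- The periodic Bernoulli function `B_k({t}) / k!`. -/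
noncomputable def periodicBernoulli (k : ℕ) (t : ℝ) : ℝ := bernoulliFun k (Int.fract t) / k !

lemma measurable_periodicBernoulli (k : ℕ) : Measurable (periodicBernoulli k) :=
  ((continuous_bernoulliFun k).measurable.comp measurable_fract).div_const _

lemma exists_bound_periodicBernoulli (k : ℕ) : ∃ C, 0 ≤ C ∧ ∀ t, ‖periodicBernoulli k t‖ ≤ C := by
  obtain ⟨C, hC⟩ := isCompact_Icc.exists_bound_of_continuousOn (s := Icc (0 : ℝ) 1)
    ((continuous_bernoulliFun k).div_const (k ! : ℝ)).continuousOn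
  exact ⟨C, (norm_nonneg _).trans (hC 0 (by simp)),
    fun t => hC _ ⟨Int.fract_nonneg t, (Int.fract_lt_one t).le⟩⟩

lemma integral_periodicBernoulli_mul_unit (k n : ℕ) (f : ℝ → ℝ) :
    ∫ t in (n : ℝ)..(n + 1 : ℕ), periodicBernoulli k t * f t =
      ∫ t in (n : ℝ)..(n + 1 : ℕ), f t * (bernoulliFun k (t - n) / k !) := by
  refine integral_congr_ae ?_
  have h : ∀ᵐ t : ℝ, t ≠ (n + 1 : ℕ) := by simp [ae_iff]
  filter_upwards [h] with t ht hmem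
  rw [uIoc_of_le (by push_cast; linarith)] at hmem
  have hlt : t < n + 1 := lt_of_le_of_ne (by simpa using hmem.2) (by simpa using ht)
  have : Int.fract t = t - n := by
    rw [Int.fract, show ⌊t⌋ = (n : ℤ) from Int.floor_eq_iff.2 ⟨by simpa using hmem.1.le,
      by simpa using hlt⟩]
    simp
  rw [periodicBernoulli, this, mul_comm]

lemma integral_periodicBernoulli_mul_unit_by_parts (k n : ℕ) {f f' : ℝ → ℝ}
    (hf : ∀ t, HasDerivAt f (f' t) t) (hf' : Continuous f') :
    ∫ t in (n : ℝ)..(n + 1 : ℕ), periodicBernoulli k t * f t =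
      bernoulli (k + 1) / (k + 1)! * (f (n + 1 : ℕ) - f n) + (if k = 0 then f (n + 1 : ℕ) else 0) -
        ∫ t in (n : ℝ)..(n + 1 : ℕ), periodicBernoulli (k + 1) t * f' t := by
  rw [integral_periodicBernoulli_mul_unit, integral_periodicBernoulli_mul_unit]
  have hB : ∀ t : ℝ, HasDerivAt (fun t => bernoulliFun (k + 1) (t - n) / (k + 1)!)
      (bernoulliFun k (t - n) / k !) t := by
    intro t
    convert! ((hasDerivAt_bernoulliFun (k + 1) (t - n)).comp t
      ((hasDerivAt_id t).sub_const (n : ℝ))).div_const _ using 1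
    rw [Nat.factorial_succ]
    push_cast
    have : (k ! : ℝ) ≠ 0 := by positivity
    have : (k + 1 : ℝ) ≠ 0 := by positivity
    simp
    field_simp
  have hc : Continuous fun t : ℝ => bernoulliFun k (t - n) / (k ! : ℝ) := by fun_prop
  rw [intervalIntegral.integral_mul_deriv_eq_deriv_mul (fun t _ => hf t) (fun t _ => hB t)
    (hf'.intervalIntegrable _ _) (hc.intervalIntegrable _ _)]
  have h1 : (((n + 1 : ℕ) : ℝ) - n) = 1 := by push_cast; ring
  rw [h1, sub_self, bernoulliFun_eval_one, bernoulliFun_eval_zero]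
  rcases eq_or_ne k 0 with rfl | hk
  · simp; ring
  · simp [hk]; ring

lemma intervalIntegrable_periodicBernoulli_mul (k : ℕ) {f : ℝ → ℝ} (hf : Continuous f) (a b : ℝ) :
    IntervalIntegrable (fun t => periodicBernoulli k t * f t) volume a b := by
  obtain ⟨C, -, hC⟩ := exists_bound_periodicBernoulli k
  have h := hf.intervalIntegrable (μ := volume) a b
  exact ⟨h.1.bdd_mul (measurable_periodicBernoulli k).aestronglyMeasurable (ae_of_all _ hC),
    h.2.bdd_mul (measurable_periodicBernoulli k).aestronglyMeasurable (ae_of_all _ hC)⟩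

lemma integral_periodicBernoulli_mul_by_parts (k N : ℕ) {f f' : ℝ → ℝ}
    (hf : ∀ t, HasDerivAt f (f' t) t) (hf' : Continuous f') :
    ∫ t in (0 : ℝ)..N, periodicBernoulli k t * f t =
      bernoulli (k + 1) / (k + 1)! * (f N - f 0) +
        (if k = 0 then ∑ n ∈ Finset.range N, f (n + 1 : ℕ) else 0) -
        ∫ t in (0 : ℝ)..N, periodicBernoulli (k + 1) t * f' t := by
  have hfc : Continuous f := continuous_iff_continuousAt.2 fun t => (hf t).continuousAt
  induction N with
  | zero => simp
  | succ N ih =>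
    rw [← integral_add_adjacent_intervals (intervalIntegrable_periodicBernoulli_mul k hfc 0 N)
        (intervalIntegrable_periodicBernoulli_mul k hfc N (N + 1 : ℕ)),
      ← integral_add_adjacent_intervals (intervalIntegrable_periodicBernoulli_mul (k + 1) hf' 0 N)
        (intervalIntegrable_periodicBernoulli_mul (k + 1) hf' N (N + 1 : ℕ)),
      ih, integral_periodicBernoulli_mul_unit_by_parts k N hf hf', Finset.sum_range_succ]
    split_ifs <;> ring

lemma integrableOn_periodicBernoulli_mul (k : ℕ) {f : ℝ → ℝ} (hf : IntegrableOn f (Ioi 0)) :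
    IntegrableOn (fun t => periodicBernoulli k t * f t) (Ioi 0) := by
  obtain ⟨C, -, hC⟩ := exists_bound_periodicBernoulli k
  exact hf.bdd_mul (measurable_periodicBernoulli k).aestronglyMeasurable (ae_of_all _ hC)

lemma integral_Ioi_periodicBernoulli_mul_by_parts (k : ℕ) {f f' : ℝ → ℝ}
    (hf : ∀ t, HasDerivAt f (f' t) t) (hf' : Continuous f')
    (hi : IntegrableOn f (Ioi 0)) (hi' : IntegrableOn f' (Ioi 0))
    (hs : k = 0 → Summable fun n : ℕ => f (n + 1 : ℕ)) :
    ∫ t in Ioi (0 : ℝ), periodicBernoulli k t * f t =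
      -(bernoulli (k + 1) / (k + 1)! * f 0) + (if k = 0 then ∑' n : ℕ, f (n + 1 : ℕ) else 0) -
        ∫ t in Ioi (0 : ℝ), periodicBernoulli (k + 1) t * f' t := by
  have h1 := intervalIntegral_tendsto_integral_Ioi 0 (integrableOn_periodicBernoulli_mul k hi)
    tendsto_natCast_atTop_atTop
  have h2 := intervalIntegral_tendsto_integral_Ioi 0 (integrableOn_periodicBernoulli_mul (k + 1) hi')
    tendsto_natCast_atTop_atTop
  have h0 : Tendsto (fun N : ℕ => f N) atTop (𝓝 0) :=
    (tendsto_zero_of_hasDerivAt_of_integrableOn_Ioi (fun t _ => hf t) hi' hi).comp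
      tendsto_natCast_atTop_atTop
  have h3 : Tendsto (fun N : ℕ => if k = 0 then ∑ n ∈ Finset.range N, f (n + 1 : ℕ) else 0) atTop
      (𝓝 (if k = 0 then ∑' n : ℕ, f (n + 1 : ℕ) else 0)) := by
    split_ifs with hk
    · exact (hs hk).hasSum.tendsto_sum_nat
    · exact tendsto_const_nhds
  refine tendsto_nhds_unique h1 ?_
  simp_rw [integral_periodicBernoulli_mul_by_parts k _ hf hf']
  convert! (((h0.sub_const (f 0)).const_mul
    ((bernoulli (k + 1) : ℝ) / (k + 1)!)).add h3).sub h2 using 2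
  ring

/-- The **Euler–Maclaurin formula** on the half-line. -/
theorem tsum_eq_eulerMaclaurin {F : ℕ → ℝ → ℝ} (hF : ∀ k t, HasDerivAt (F k) (F (k + 1) t) t)
    (hi : ∀ k, IntegrableOn (F k) (Ioi 0)) (hs : Summable fun n : ℕ => F 0 (n + 1 : ℕ))
    (K : ℕ) :
    ∑' n : ℕ, F 0 (n + 1 : ℕ) = (∫ t in Ioi (0 : ℝ), F 0 t) +
      ∑ k ∈ Finset.range (K + 1), (-1) ^ k * (bernoulli (k + 1) / (k + 1)! * F k 0) +
      (-1) ^ K * ∫ t in Ioi (0 : ℝ), periodicBernoulli (K + 1) t * F (K + 1) t := by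
  have hc : ∀ k, Continuous (F k) :=
    fun k => continuous_iff_continuousAt.2 fun t => (hF k t).continuousAt
  have step := fun k => integral_Ioi_periodicBernoulli_mul_by_parts k (hF k) (hc (k + 1)) (hi k)
    (hi (k + 1)) fun hk => hk ▸ hs
  induction K with
  | zero =>
    have h := step 0
    simp [periodicBernoulli] at h ⊢
    linarith
  | succ K ih =>
    rw [ih, step (K + 1), Finset.sum_range_succ _ (K + 1)]
    simp
    ring

open Polynomial in
/-- The iterated derivatives of `u ↦ u * exp (-u² / 2)`. -/
noncomputable def hermiteGaussian (k : ℕ) (u : ℝ) : ℝ :=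
  (-1) ^ k * aeval u (hermite (k + 1)) * Real.exp (-(u ^ 2 / 2))

open Polynomial in
lemma hasDerivAt_hermiteGaussian (k : ℕ) (u : ℝ) :
    HasDerivAt (hermiteGaussian k) (hermiteGaussian (k + 1) u) u := by
  have h1 : HasDerivAt (fun u : ℝ => Real.exp (-(u ^ 2 / 2))) (Real.exp (-(u ^ 2 / 2)) * (-u)) u := by
    convert! ((hasDerivAt_pow 2 u).div_const 2).fun_neg.exp using 2
    simp
  convert! (((hermite (k + 1)).hasDerivAt_aeval u).const_mul ((-1) ^ k)).mul h1 using 1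
  rw [hermiteGaussian, hermite_succ (k + 1)]
  simp only [map_sub, map_mul, aeval_X, pow_succ]
  ring

open Polynomial in
lemma integrable_eval_mul_gaussian (p : ℝ[X]) :
    Integrable fun u : ℝ => p.eval u * Real.exp (-(u ^ 2 / 2)) := by
  induction p using Polynomial.induction_on' with
  | add p q hp hq => simpa only [eval_add, add_mul] using! hp.add hq
  | monomial n a =>
    have h := (integrable_rpow_mul_exp_neg_mul_sq (b := 1 / 2) (by norm_num) (s := n)
      (by have : (0 : ℝ) ≤ n := n.cast_nonneg
          linarith)).const_mul a
    refine h.congr (ae_of_all _ fun u => ?_)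
    simp only [eval_monomial, rpow_natCast]
    rw [mul_assoc]
    ring_nf

lemma integrable_hermiteGaussian (k : ℕ) : Integrable (hermiteGaussian k) := by
  refine (((integrable_eval_mul_gaussian ((Polynomial.hermite (k + 1)).map
    (algebraMap ℤ ℝ))).const_mul ((-1) ^ k))).congr (ae_of_all _ fun u => ?_)
  simp only [hermiteGaussian, Polynomial.eval_map_algebraMap]
  ring

lemma hermiteGaussian_two_mul_zero (j : ℕ) : hermiteGaussian (2 * j) 0 = 0 := by
  simp only [hermiteGaussian, ← Polynomial.coeff_zero_eq_aeval_zero']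
  rw [Polynomial.coeff_hermite_of_odd_add (by simp)]
  simp

lemma bernoulli_div_factorial_mul_hermiteGaussian_zero (j : ℕ) :
    (bernoulli (2 * (j + 1)) : ℝ) / (2 * (j + 1))! * hermiteGaussian (2 * j + 1) 0 * 2 ^ (j + 1) =
      -((-1) ^ (j + 1) * (bernoulli (2 * (j + 1)) / (j + 1)!)) := by
  have h1 : ((2 * (j + 1))! : ℝ) = 2 ^ (j + 1) * (j + 1)! * (2 * j + 1)‼ := by
    rw [show 2 * (j + 1) = (2 * j + 1) + 1 by ring, Nat.factorial_eq_mul_doubleFactorial,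
      show 2 * j + 1 + 1 = 2 * (j + 1) by ring, Nat.doubleFactorial_two_mul]
    push_cast
    ring
  have h2 : hermiteGaussian (2 * j + 1) 0 = -((-1) ^ (j + 1) * (2 * j + 1)‼) := by
    simp only [hermiteGaussian, ← Polynomial.coeff_zero_eq_aeval_zero']
    have := Polynomial.coeff_hermite_explicit (j + 1) 0
    rw [show 2 * (j + 1) + 0 = 2 * j + 1 + 1 by ring,
      show 2 * (j + 1) - 1 = 2 * j + 1 by omega] at this
    rw [this]
    simp [pow_succ, pow_mul]
  have : ((2 * j + 1)‼ : ℝ) ≠ 0 := by exact_mod_cast (Nat.doubleFactorial_pos _).ne'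
  have : ((j + 1)! : ℝ) ≠ 0 := by positivity
  rw [h1, h2]
  field_simp

lemma summable_mul_exp_neg_sq_mul {x : ℝ} (hx : 0 < x) :
    Summable fun n : ℕ => ((n + 1 : ℕ) : ℝ) * Real.exp (-(((n + 1 : ℕ) : ℝ) ^ 2 * x)) := by
  have h := (summable_nat_add_iff 1).2 (Real.summable_pow_mul_exp_neg_nat_mul 1 hx)
  refine Summable.of_nonneg_of_le (fun n => by positivity) (fun n => ?_) h
  rw [pow_one]
  gcongr
  have h1 : (1 : ℝ) ≤ (n + 1 : ℕ) := by simp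
  nlinarith [mul_nonneg (mul_nonneg hx.le (sub_nonneg.2 h1)) (zero_le_one.trans h1)]

lemma integral_Ioi_mul_exp_neg_sq_mul {x : ℝ} (hx : 0 < x) :
    ∫ t in Ioi (0 : ℝ), t * Real.exp (-(t ^ 2 * x)) = 1 / (2 * x) := by
  have hd : ∀ t ∈ Ici (0 : ℝ), HasDerivAt (fun t : ℝ => -Real.exp (-(t ^ 2 * x)) / (2 * x))
      (t * Real.exp (-(t ^ 2 * x))) t := by
    intro t _
    convert! (((hasDerivAt_pow 2 t).mul_const x).fun_neg.exp.fun_neg).div_const (2 * x) using 1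
    simp
    field_simp
  have hl : Tendsto (fun t : ℝ => -Real.exp (-(t ^ 2 * x)) / (2 * x)) atTop (𝓝 (-0 / (2 * x))) :=
    ((Real.tendsto_exp_neg_atTop_nhds_zero.comp
      ((tendsto_pow_atTop two_ne_zero).atTop_mul_const hx)).neg).div_const _
  have hn : ∀ t ∈ Ioi (0 : ℝ), 0 ≤ t * Real.exp (-(t ^ 2 * x)) :=
    fun t ht => mul_nonneg (le_of_lt ht) (Real.exp_pos _).le
  rw [integral_Ioi_of_hasDerivAt_of_nonneg' hd hn hl]
  simp [neg_div]

lemma exists_abs_tsum_mul_exp_neg_sq_mul_sub_le (N : ℕ) : ∃ C : ℝ, 0 ≤ C ∧ ∀ x > 0,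
    |∑' n : ℕ, ((n + 1 : ℕ) : ℝ) * Real.exp (-(((n + 1 : ℕ) : ℝ) ^ 2 * x)) -
      (1 / (2 * x) + ∑ j ∈ Finset.range (N + 1),
        (-1) ^ (j + 1) * ((bernoulli (2 * (j + 1)) : ℝ) / (j + 1)!) * x ^ j / 2)| ≤ C * x ^ N := by
  obtain ⟨C, hC0, hC⟩ := exists_bound_periodicBernoulli (2 * N + 1 + 1)
  have hI : 0 ≤ ∫ u in Ioi (0 : ℝ), ‖hermiteGaussian (2 * N + 1 + 1) u‖ :=
    integral_nonneg fun _ => norm_nonneg _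
  refine ⟨C * (2 ^ N * ∫ u in Ioi (0 : ℝ), ‖hermiteGaussian (2 * N + 1 + 1) u‖), by positivity,
    fun x hx => ?_⟩
  set h := √(2 * x) with hh
  have hpos : 0 < h := Real.sqrt_pos.2 (by positivity)
  have hsq : h ^ 2 = 2 * x := Real.sq_sqrt (by positivity)
  set F : ℕ → ℝ → ℝ := fun k t => h ^ k / h * hermiteGaussian k (h * t) with hFdef
  have hF : ∀ k t, HasDerivAt (F k) (F (k + 1) t) t := by
    intro k t
    convert! ((hasDerivAt_hermiteGaussian k (h * t)).comp t
      ((hasDerivAt_id t).const_mul h)).const_mul (h ^ k / h) using 1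
    simp [hFdef, pow_succ]
    field_simp
  have hi : ∀ k, IntegrableOn (F k) (Ioi 0) := fun k =>
    (((integrable_hermiteGaussian k).comp_mul_left' hpos.ne').const_mul _).integrableOn
  have hF0 : ∀ t, F 0 t = t * Real.exp (-(t ^ 2 * x)) := by
    intro t
    simp only [hFdef, hermiteGaussian, mul_pow, hsq]
    simp
    field_simp
  have hs := summable_mul_exp_neg_sq_mul hx
  have key := tsum_eq_eulerMaclaurin hF hi (by simpa only [hF0] using hs) (2 * N + 1)
  have hsum : ∀ M : ℕ, ∑ k ∈ Finset.range (2 * M),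
      (-1) ^ k * ((bernoulli (k + 1) : ℝ) / (k + 1)! * F k 0) = ∑ j ∈ Finset.range M,
        (-1) ^ (j + 1) * ((bernoulli (2 * (j + 1)) : ℝ) / (j + 1)!) * x ^ j / 2 := by
    intro M
    induction M with
    | zero => simp
    | succ M ih =>
      have h1 : F (2 * M) 0 = 0 := by simp [hFdef, hermiteGaussian_two_mul_zero]
      have h2 : F (2 * M + 1) 0 = 2 ^ M * x ^ M * hermiteGaussian (2 * M + 1) 0 := by
        simp only [hFdef, mul_zero]
        rw [pow_succ, mul_div_assoc, div_self hpos.ne', mul_one, pow_mul, hsq, mul_pow]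
      have h3 := bernoulli_div_factorial_mul_hermiteGaussian_zero M
      rw [show 2 * (M + 1) = 2 * M + 1 + 1 by ring, Finset.sum_range_succ, Finset.sum_range_succ,
        ih, Finset.sum_range_succ, h1, h2]
      rw [show 2 * (M + 1) = 2 * M + 1 + 1 by ring] at h3
      rw [show 2 * (M + 1) = 2 * M + 1 + 1 by ring]
      have h4 : (-1 : ℝ) ^ (2 * M + 1) = -1 := by simp [pow_succ, pow_mul]
      rw [h4]
      linear_combination (-x ^ M / 2) * h3
  rw [show 2 * N + 1 + 1 = 2 * (N + 1) by ring, hsum] at key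
  simp only [hF0, integral_Ioi_mul_exp_neg_sq_mul hx] at key
  rw [key, add_sub_cancel_left, abs_mul, abs_pow, abs_neg, abs_one, one_pow, one_mul,
    ← Real.norm_eq_abs]
  have hn : ∫ t in Ioi (0 : ℝ), ‖F (2 * (N + 1)) t‖ =
      2 ^ N * x ^ N * ∫ u in Ioi (0 : ℝ), ‖hermiteGaussian (2 * N + 1 + 1) u‖ := by
    have e := integral_comp_mul_left_Ioi (fun u => ‖hermiteGaussian (2 * N + 1 + 1) u‖) 0 hpos
    simp only [hFdef, norm_mul, MeasureTheory.integral_const_mul]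
    rw [show 2 * (N + 1) = 2 * N + 1 + 1 by ring, e, mul_zero, smul_eq_mul, ← mul_assoc]
    congr 1
    rw [Real.norm_of_nonneg (by positivity), ← mul_pow, ← hsq, ← pow_mul, pow_succ, pow_succ]
    field_simp
  calc _ ≤ ∫ t in Ioi (0 : ℝ), C * ‖F (2 * (N + 1)) t‖ := by
        refine norm_integral_le_of_norm_le ((hi _).norm.const_mul C) (ae_of_all _ fun t => ?_)
        rw [norm_mul]
        gcongr
        exact hC t
    _ = _ := by rw [MeasureTheory.integral_const_mul, hn]; ring

lemma integral_log_mul_exp_neg :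
    ∫ v in Ioi (0 : ℝ), Real.log v * Real.exp (-v) = -eulerMascheroniConstant := by
  have h1 := Complex.hasDerivAt_GammaIntegral (s := 1) (by simp)
  have h2 : Complex.Gamma =ᶠ[𝓝 1] Complex.GammaIntegral := by
    filter_upwards [(isOpen_lt continuous_const Complex.continuous_re).mem_nhds
      (show (0 : ℝ) < (1 : ℂ).re by simp)] with s hs
    exact Complex.Gamma_eq_integral hs
  have h3 := (h1.congr_of_eventuallyEq h2).unique Complex.hasDerivAt_Gamma_one
  simp only [sub_self, Complex.cpow_zero, one_mul, ← Complex.ofReal_mul] at h3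
  rw [integral_complex_ofReal] at h3
  exact_mod_cast h3

lemma integrableOn_log_mul_exp_neg :
    IntegrableOn (fun v : ℝ => Real.log v * Real.exp (-v)) (Ioi 0) := by
  refine Integrable.of_integral_ne_zero ?_
  rw [integral_log_mul_exp_neg]
  linarith [one_half_lt_eulerMascheroniConstant]

lemma tendsto_harmonic_floor_sub_log :
    Tendsto (fun t : ℝ => (harmonic ⌊t⌋₊ : ℝ) - Real.log t) atTop (𝓝 eulerMascheroniConstant) := by
  have h1 := tendsto_harmonic_sub_log.comp (tendsto_nat_floor_atTop (α := ℝ))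
  have h2 := (tendsto_nat_floor_div_atTop (R := ℝ)).log one_ne_zero
  rw [Real.log_one] at h2
  rw [← add_zero eulerMascheroniConstant]
  refine (h1.add h2).congr' ?_
  filter_upwards [eventually_ge_atTop 1] with t ht
  have : (0 : ℝ) < ⌊t⌋₊ := by exact_mod_cast Nat.floor_pos.2 ht
  rw [Real.log_div this.ne' (by positivity)]
  simp

lemma abs_harmonic_floor_sub_log_le {t : ℝ} (ht : 0 < t) :
    |(harmonic ⌊t⌋₊ : ℝ) - Real.log t| ≤ max 1 (-Real.log t) := by
  rcases lt_or_ge t 1 with h | h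
  · rw [Nat.floor_eq_zero.2 h, harmonic_zero, Rat.cast_zero, zero_sub, abs_neg,
      abs_of_neg (Real.log_neg ht h)]
    exact le_max_right _ _
  · refine le_max_of_le_left (abs_le.2 ⟨?_, ?_⟩)
    · linarith [log_le_harmonic_floor t ht.le]
    · linarith [harmonic_floor_le_one_add_log t h]

lemma log_sqrt_div {v x : ℝ} (hv : 0 < v) (hx : 0 < x) :
    Real.log √(v / x) = (Real.log v - Real.log x) / 2 := by
  rw [Real.log_sqrt (by positivity), Real.log_div hv.ne' hx.ne']

lemma summable_exp_neg_sq_mul_div {x : ℝ} (hx : 0 < x) :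
    Summable fun n : ℕ =>
      Real.exp (-(((n + 1 : ℕ) : ℝ) ^ 2 * x)) / ((n + 1 : ℕ) : ℝ) := by
  refine .of_nonneg_of_le (fun n => by positivity) (fun n => ?_) (summable_mul_exp_neg_sq_mul hx)
  have h1 : (1 : ℝ) ≤ (n + 1 : ℕ) := by simp
  exact (div_le_self (Real.exp_pos _).le h1).trans (le_mul_of_one_le_left (Real.exp_pos _).le h1)

lemma tsum_exp_neg_sq_mul_div_eq_integral {x : ℝ} (hx : 0 < x) :
    ∑' n : ℕ, Real.exp (-(((n + 1 : ℕ) : ℝ) ^ 2 * x)) / ((n + 1 : ℕ) : ℝ) =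
      ∫ v in Ioi (0 : ℝ), (harmonic ⌊√(v / x)⌋₊ : ℝ) * Real.exp (-v) := by
  set f : ℕ → ℝ → ℝ := fun n => (Ici (((n + 1 : ℕ) : ℝ) ^ 2 * x)).indicator
    fun v => Real.exp (-v) / ((n + 1 : ℕ) : ℝ) with hf
  have hmeas : ∀ n : ℕ, MeasurableSet (Ici (((n + 1 : ℕ) : ℝ) ^ 2 * x)) := fun _ => measurableSet_Ici
  have hsub : ∀ n : ℕ, Ici (((n + 1 : ℕ) : ℝ) ^ 2 * x) ⊆ Ioi (0 : ℝ) := fun n v hv =>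
    lt_of_lt_of_le (a := (0 : ℝ)) (by positivity) hv
  have hint : ∀ n, ∫ v in Ioi 0, f n v =
      Real.exp (-(((n + 1 : ℕ) : ℝ) ^ 2 * x)) / ((n + 1 : ℕ) : ℝ) := by
    intro n
    rw [hf, setIntegral_indicator (hmeas n), inter_eq_self_of_subset_right (hsub n),
      integral_Ici_eq_integral_Ioi, MeasureTheory.integral_div, integral_exp_neg_Ioi]
  have hnn : ∀ n v, 0 ≤ f n v := by
    intro n v
    refine indicator_nonneg (fun w _ => ?_) v
    positivity
  have hi : ∀ n, IntegrableOn (f n) (Ioi 0) := fun n =>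
    ((integrableOn_exp_neg_Ioi 0).div_const _).indicator (hmeas n)
  have key := (hasSum_integral_of_summable_integral_norm hi (by
    simpa only [Real.norm_of_nonneg, hnn, hint] using summable_exp_neg_sq_mul_div hx)).tsum_eq
  simp only [hint] at key
  rw [key]
  refine setIntegral_congr_fun measurableSet_Ioi fun v hv => ?_
  have hv : 0 < v := hv
  have hiff : ∀ n : ℕ, v ∈ Ici (((n + 1 : ℕ) : ℝ) ^ 2 * x) ↔ n ∈ Finset.range ⌊√(v / x)⌋₊ := by
    intro n
    rw [Finset.mem_range, ← Nat.succ_le_iff, Nat.le_floor_iff (Real.sqrt_nonneg _),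
      Real.le_sqrt (by positivity) (by positivity), le_div_iff₀ hx, mem_Ici]
  rw [tsum_eq_sum (s := Finset.range ⌊√(v / x)⌋₊) fun n hn => by
    simp only [hf]
    rw [indicator_of_notMem (mt (hiff n).1 hn)], harmonic]
  push_cast
  rw [Finset.sum_mul]
  refine Finset.sum_congr rfl fun n hn => ?_
  simp only [hf]
  rw [indicator_of_mem ((hiff n).2 hn)]
  push_cast
  ring

lemma tendsto_tsum_exp_neg_sq_mul_div_add_log :
    Tendsto (fun x : ℝ => ∑' n : ℕ, Real.exp (-(((n + 1 : ℕ) : ℝ) ^ 2 * x)) / ((n + 1 : ℕ) : ℝ) +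
      Real.log x / 2) (𝓝[>] 0) (𝓝 (eulerMascheroniConstant / 2)) := by
  set R : ℝ → ℝ → ℝ := fun x v =>
    ((harmonic ⌊√(v / x)⌋₊ : ℝ) - Real.log √(v / x)) * Real.exp (-v) with hR
  set b : ℝ → ℝ := fun v => Real.exp (-v) + |Real.log v * Real.exp (-v)| with hb
  have hbi : IntegrableOn b (Ioi 0) :=
    (integrableOn_exp_neg_Ioi 0).add integrableOn_log_mul_exp_neg.abs
  have hmeas : ∀ x, AEStronglyMeasurable (R x) (volume.restrict (Ioi 0)) := by
    intro x
    have h1 : Measurable fun v : ℝ => √(v / x) := by fun_prop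
    have h2 : Measurable fun v : ℝ => (harmonic ⌊√(v / x)⌋₊ : ℝ) :=
      (measurable_from_top (f := fun n : ℕ => (harmonic n : ℝ))).comp (Nat.measurable_floor.comp h1)
    exact ((h2.sub h1.log).mul (by fun_prop)).aestronglyMeasurable
  have hbound : ∀ x ∈ Ioo (0 : ℝ) 1, ∀ v ∈ Ioi (0 : ℝ), ‖R x v‖ ≤ b v := by
    intro x hx v hv
    have hv : 0 < v := hv
    have h1 := abs_harmonic_floor_sub_log_le (t := √(v / x)) (Real.sqrt_pos.2 (div_pos hv hx.1))
    have h2 : max 1 (-Real.log √(v / x)) ≤ 1 + |Real.log v| := by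
      refine max_le (by linarith [abs_nonneg (Real.log v)]) ?_
      rw [log_sqrt_div hv hx.1]
      linarith [Real.log_neg hx.1 hx.2, neg_abs_le (Real.log v), abs_nonneg (Real.log v)]
    simp only [hR, hb, norm_mul, abs_mul, Real.norm_eq_abs, abs_of_pos (Real.exp_pos _)]
    nlinarith [Real.exp_pos (-v)]
  have hRi : ∀ x ∈ Ioo (0 : ℝ) 1, IntegrableOn (R x) (Ioi 0) := fun x hx =>
    Integrable.mono' hbi (hmeas x) ((ae_restrict_iff' measurableSet_Ioi).2 (ae_of_all _ (hbound x hx)))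
  have hIoo : ∀ᶠ x : ℝ in 𝓝[>] 0, x ∈ Ioo (0 : ℝ) 1 := Ioo_mem_nhdsGT one_pos
  have hlim : Tendsto (fun x => ∫ v in Ioi (0 : ℝ), R x v) (𝓝[>] 0)
      (𝓝 (∫ v in Ioi (0 : ℝ), eulerMascheroniConstant * Real.exp (-v))) := by
    refine tendsto_integral_filter_of_dominated_convergence b (.of_forall hmeas) ?_ hbi ?_
    · filter_upwards [hIoo] with x hx
      exact (ae_restrict_iff' measurableSet_Ioi).2 (ae_of_all _ (hbound x hx))
    · refine (ae_restrict_iff' measurableSet_Ioi).2 (ae_of_all _ fun v hv => ?_)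
      have hv : 0 < v := hv
      have h1 : Tendsto (fun x : ℝ => √(v / x)) (𝓝[>] 0) atTop :=
        tendsto_sqrt_atTop.comp (tendsto_inv_nhdsGT_zero.const_mul_atTop hv)
      exact (tendsto_harmonic_floor_sub_log.comp h1).mul_const _
  rw [MeasureTheory.integral_const_mul, integral_exp_neg_Ioi_zero, mul_one] at hlim
  rw [show eulerMascheroniConstant / 2 = eulerMascheroniConstant - eulerMascheroniConstant / 2 by ring]
  refine (hlim.sub_const (eulerMascheroniConstant / 2)).congr' ?_
  filter_upwards [hIoo] with x hx
  have hL : IntegrableOn (fun v : ℝ =>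
      Real.log v * Real.exp (-v) / 2 - Real.log x / 2 * Real.exp (-v)) (Ioi 0) :=
    (integrableOn_log_mul_exp_neg.div_const 2).sub
    ((integrableOn_exp_neg_Ioi 0).const_mul (Real.log x / 2))
  have hLv : ∫ v in Ioi (0 : ℝ), (Real.log v * Real.exp (-v) / 2 - Real.log x / 2 * Real.exp (-v)) =
      -eulerMascheroniConstant / 2 - Real.log x / 2 := by
    rw [MeasureTheory.integral_sub (integrableOn_log_mul_exp_neg.div_const 2)
      ((integrableOn_exp_neg_Ioi 0).const_mul _), MeasureTheory.integral_div,
      MeasureTheory.integral_const_mul, integral_log_mul_exp_neg, integral_exp_neg_Ioi_zero, mul_one]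
  have hsplit : ∫ v in Ioi (0 : ℝ), (harmonic ⌊√(v / x)⌋₊ : ℝ) * Real.exp (-v) =
      (∫ v in Ioi (0 : ℝ), R x v) +
      ∫ v in Ioi (0 : ℝ), (Real.log v * Real.exp (-v) / 2 - Real.log x / 2 * Real.exp (-v)) := by
    rw [← MeasureTheory.integral_add (hRi x hx) hL]
    refine setIntegral_congr_fun measurableSet_Ioi fun v hv => ?_
    simp only [hR]
    rw [log_sqrt_div hv hx.1]
    ring
  rw [tsum_exp_neg_sq_mul_div_eq_integral hx.1, hsplit, hLv]
  ring

lemma hasDerivAt_tsum_exp_neg_sq_mul_div {x : ℝ} (hx : 0 < x) :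
    HasDerivAt
      (fun x : ℝ => ∑' n : ℕ, Real.exp (-(((n + 1 : ℕ) : ℝ) ^ 2 * x)) / ((n + 1 : ℕ) : ℝ))
      (-∑' n : ℕ, ((n + 1 : ℕ) : ℝ) * Real.exp (-(((n + 1 : ℕ) : ℝ) ^ 2 * x))) x := by
  have hs := summable_mul_exp_neg_sq_mul (half_pos hx)
  rw [← tsum_neg]
  refine hasDerivAt_tsum_of_isPreconnected (t := Ioi (x / 2)) (y₀ := x)
    (g := fun (n : ℕ) (y : ℝ) => Real.exp (-(((n + 1 : ℕ) : ℝ) ^ 2 * y)) / ((n + 1 : ℕ) : ℝ))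
    (g' := fun (n : ℕ) (y : ℝ) =>
      -(((n + 1 : ℕ) : ℝ) * Real.exp (-(((n + 1 : ℕ) : ℝ) ^ 2 * y))))
    hs isOpen_Ioi
    isPreconnected_Ioi (fun n y _ => ?_) (fun n y hy => ?_) (half_lt_self hx) ?_ (half_lt_self hx)
  · convert! (((hasDerivAt_id y).const_mul (((n + 1 : ℕ) : ℝ) ^ 2)).fun_neg.exp).div_const
      ((n + 1 : ℕ) : ℝ) using 1
    have : ((n + 1 : ℕ) : ℝ) ≠ 0 := by positivity
    simp only [id, mul_one]
    field_simp
  · have hy : x / 2 < y := hy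
    rw [norm_neg, Real.norm_of_nonneg (by positivity)]
    gcongr
  · exact summable_exp_neg_sq_mul_div hx

/-- A function on `(0, ∞)` with derivative `O(x ^ N)` approaches its limit at `0` at rate
`O(x ^ (N + 1))`. -/
lemma abs_sub_le_of_hasDerivAt_of_tendsto {D D' : ℝ → ℝ} {C L : ℝ} {N : ℕ} (hC : 0 ≤ C)
    (hD : ∀ x > 0, HasDerivAt D (D' x) x) (hD' : ∀ x > 0, |D' x| ≤ C * x ^ N)
    (hL : Tendsto D (𝓝[>] 0) (𝓝 L)) {x : ℝ} (hx : 0 < x) : |D x - L| ≤ C * x ^ (N + 1) := by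
  refine le_of_tendsto (tendsto_const_nhds.sub hL).abs ?_
  filter_upwards [Ioo_mem_nhdsGT hx] with a ha
  have h := Convex.norm_image_sub_le_of_norm_hasDerivWithin_le (f := D) (f' := D') (s := Icc a x)
    (C := C * x ^ N) (fun y hy => (hD y (ha.1.trans_le hy.1)).hasDerivWithinAt)
    (fun y hy => (hD' y (ha.1.trans_le hy.1)).trans (by
      have := ha.1.trans_le hy.1
      have := hy.2
      gcongr)) (convex_Icc a x) (left_mem_Icc.2 ha.2.le) (right_mem_Icc.2 ha.2.le)
  rw [Real.norm_eq_abs, Real.norm_of_nonneg (sub_nonneg.2 ha.2.le)] at h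
  refine h.trans ?_
  rw [pow_succ, ← mul_assoc]
  gcongr
  linarith [ha.1]

/-- asymptotics of `∑_{n≥1} e^{-n² x}/n` as `x → 0⁺`. -/
theorem sum_exp_div_n_asymp (N : ℕ) :
    (fun x : ℝ => (∑' n : ℕ, Real.exp (-(((n + 1 : ℕ) : ℝ) ^ 2 * x)) / ((n + 1 : ℕ) : ℝ)) -
      ((Real.eulerMascheroniConstant - Real.log x) / 2 -
        ∑ n ∈ Finset.Icc 1 N, ((bernoulli (2 * n) : ℝ) / ((n.factorial : ℝ) * (2 * n))) *
          (-x) ^ n)) =o[nhdsWithin 0 (Set.Ioi 0)]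
    fun x : ℝ => x ^ N := by
  obtain ⟨C, hC, hA⟩ := exists_abs_tsum_mul_exp_neg_sq_mul_sub_le N
  set a : ℕ → ℝ := fun n => (bernoulli (2 * n) : ℝ) / ((n.factorial : ℝ) * (2 * n)) with ha
  set S : ℝ → ℝ := fun x =>
    ∑' n : ℕ, Real.exp (-(((n + 1 : ℕ) : ℝ) ^ 2 * x)) / ((n + 1 : ℕ) : ℝ) with hS
  set P : ℝ → ℝ := fun x => ∑ j ∈ Finset.range (N + 1), a (j + 1) * (-x) ^ (j + 1) with hP
  have hP' : ∀ x, HasDerivAt P (∑ j ∈ Finset.range (N + 1),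
      (-1) ^ (j + 1) * ((bernoulli (2 * (j + 1)) : ℝ) / (j + 1)!) * x ^ j / 2) x := by
    intro x
    refine HasDerivAt.fun_sum fun j _ => ?_
    convert! ((hasDerivAt_neg x).pow (j + 1)).const_mul (a (j + 1)) using 1
    have : ((j + 1)! : ℝ) ≠ 0 := by positivity
    have : (j + 1 : ℝ) ≠ 0 := by positivity
    simp only [ha, add_tsub_cancel_right, neg_pow x j]
    push_cast
    field_simp
    ring
  have hP0 : Tendsto P (𝓝[>] 0) (𝓝 0) := by
    have := (hP' 0).continuousAt.tendsto.mono_left (nhdsWithin_le_nhds (s := Ioi 0))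
    simpa [hP] using this
  have hbound : ∀ x > 0,
      |(S x + Real.log x / 2 + P x) - eulerMascheroniConstant / 2| ≤ C * x ^ (N + 1) := by
    intro x hx
    refine abs_sub_le_of_hasDerivAt_of_tendsto (D := fun x => S x + Real.log x / 2 + P x) hC
      (fun y hy => ((hasDerivAt_tsum_exp_neg_sq_mul_div hy).add
        ((Real.hasDerivAt_log hy.ne').div_const 2)).add (hP' y)) (fun y hy => ?_) ?_ hx
    · rw [← abs_neg]
      convert! hA y hy using 2
      ring
    · simpa only [add_zero] using! tendsto_tsum_exp_neg_sq_mul_div_add_log.add hP0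
  have hpow : (fun x : ℝ => x ^ (N + 1)) =o[𝓝[>] 0] fun x : ℝ => x ^ N :=
    (isLittleO_pow_pow N.lt_succ_self).mono nhdsWithin_le_nhds
  have h1 : (fun x => (S x + Real.log x / 2 + P x) - eulerMascheroniConstant / 2) =o[𝓝[>] 0]
      fun x : ℝ => x ^ N := by
    refine (IsBigO.of_bound C ?_).trans_isLittleO hpow
    filter_upwards [self_mem_nhdsWithin] with x hx
    have hx : 0 < x := hx
    rw [Real.norm_eq_abs, Real.norm_of_nonneg (by positivity)]
    exact hbound x hx
  have h2 : (fun x : ℝ => a (N + 1) * (-1) ^ (N + 1) * x ^ (N + 1)) =o[𝓝[>] 0]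
      fun x : ℝ => x ^ N := hpow.const_mul_left _
  refine (h1.sub h2).congr_left fun x => ?_
  have h3 : ∑ n ∈ Finset.Icc 1 N, a n * (-x) ^ n =
      ∑ j ∈ Finset.range N, a (j + 1) * (-x) ^ (j + 1) := by
    rw [Finset.range_eq_Ico, Finset.sum_Ico_add' (fun n => a n * (-x) ^ n) 0 N 1]
    rfl
  rw [h3]
  simp only [hP, Finset.sum_range_succ _ N, neg_pow x (N + 1)]
  ring
end

section
/- For every natural number $N$, as $x \to 0^+$ we have $\sum_{n=1}^{\infty} n\, e^{-n^2 x} = \frac{1}{2x} + \frac{1}{2x} \sum_{n=1}^{N} \frac{B_{2n}}{n!} (-x)^n + o(x^{N-1})$. -/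
open Real Filter Asymptotics

open MeasureTheory Set Topology

lemma hasDerivAt_bernoulliFun_div_factorial (k : ℕ) (x : ℝ) :
    HasDerivAt (fun y ↦ bernoulliFun (k + 1) y / (k + 1).factorial)
      (bernoulliFun k x / k.factorial) x := by
  convert! (hasDerivAt_bernoulliFun (k + 1) x).div_const ((k + 1).factorial : ℝ) using 1
  rw [Nat.factorial_succ]
  push_cast
  have : (k : ℝ) + 1 ≠ 0 := by positivity
  have : (k.factorial : ℝ) ≠ 0 := by positivity
  field_simp

lemma exists_abs_bernoulliFun_fract_le (k : ℕ) :
    ∃ C, ∀ t : ℝ, |bernoulliFun k (Int.fract t) / k.factorial| ≤ C := by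
  obtain ⟨C, hC⟩ := (isCompact_Icc (a := (0 : ℝ)) (b := 1)).exists_bound_of_continuousOn
    ((continuous_bernoulliFun k).div_const (k.factorial : ℝ)).continuousOn
  exact ⟨C, fun t ↦ hC _ ⟨Int.fract_nonneg t, (Int.fract_lt_one t).le⟩⟩

lemma integrableOn_bernoulliFun_fract_mul (k : ℕ) {f : ℝ → ℝ} {s : Set ℝ}
    (hf : IntegrableOn f s) :
    IntegrableOn (fun t ↦ bernoulliFun k (Int.fract t) / k.factorial * f t) s := by
  obtain ⟨C, hC⟩ := exists_abs_bernoulliFun_fract_le k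
  refine Integrable.bdd_mul (c := C) hf ?_ (Eventually.of_forall hC)
  exact (((continuous_bernoulliFun k).measurable.comp measurable_fract).div_const
    _).aestronglyMeasurable

/-- The integral of `f` against the `k`-th normalized periodic Bernoulli function. -/
noncomputable def bernoulliRemainder (k : ℕ) (f : ℝ → ℝ) : ℝ :=
  ∫ t in Ioi 0, bernoulliFun k (Int.fract t) / k.factorial * f t

lemma integral_bernoulliFun_fract_unit (k i : ℕ) {f f' : ℝ → ℝ}
    (hf : ∀ t, HasDerivAt f (f' t) t) (hf' : Continuous f') :
    ∫ t in (i : ℝ)..((i + 1 : ℕ) : ℝ), bernoulliFun k (Int.fract t) / k.factorial * f t =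
      bernoulliFun (k + 1) 1 / (k + 1).factorial * f ((i + 1 : ℕ) : ℝ) -
      bernoulliFun (k + 1) 0 / (k + 1).factorial * f i -
      ∫ t in (i : ℝ)..((i + 1 : ℕ) : ℝ),
        bernoulliFun (k + 1) (Int.fract t) / (k + 1).factorial * f' t := by
  have hcongr (m : ℕ) (g : ℝ → ℝ) :
      ∫ t in (i : ℝ)..((i + 1 : ℕ) : ℝ), bernoulliFun m (Int.fract t) / m.factorial * g t =
      ∫ t in (i : ℝ)..((i + 1 : ℕ) : ℝ), bernoulliFun m (t - i) / m.factorial * g t := by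
    refine intervalIntegral.integral_congr_Ioo_of_le (by simp) fun t ht ↦ ?_
    have : Int.fract t = t - i := by
      rw [Int.fract_eq_iff]
      have h1 := ht.1
      have h2 := ht.2
      push_cast at h2
      exact ⟨by linarith, by linarith, i, by simp⟩
    simp only [this]
  rw [hcongr, hcongr]
  have hu (t : ℝ) : HasDerivAt (fun y ↦ bernoulliFun (k + 1) (y - i) / (k + 1).factorial)
      (bernoulliFun k (t - i) / k.factorial) t := by
    simpa using (hasDerivAt_bernoulliFun_div_factorial k (t - i)).comp_sub_const t (i : ℝ)
  have key := intervalIntegral.integral_mul_deriv_eq_deriv_mul (a := (i : ℝ))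
    (b := ((i + 1 : ℕ) : ℝ)) (fun t _ ↦ hu t) (fun t _ ↦ hf t)
    (Continuous.intervalIntegrable (by fun_prop) _ _) (hf'.intervalIntegrable _ _)
  rw [key]
  push_cast
  simp

lemma integral_bernoulliFun_fract (k n : ℕ) {f f' : ℝ → ℝ}
    (hf : ∀ t, HasDerivAt f (f' t) t) (hf' : Continuous f')
    (hi : IntegrableOn f (Ioi 0)) (hi' : IntegrableOn f' (Ioi 0)) :
    ∫ t in (0 : ℝ)..n, bernoulliFun k (Int.fract t) / k.factorial * f t =
      ∑ i ∈ Finset.range n, (bernoulliFun (k + 1) 1 / (k + 1).factorial * f ((i + 1 : ℕ) : ℝ) -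
        bernoulliFun (k + 1) 0 / (k + 1).factorial * f i) -
      ∫ t in (0 : ℝ)..n, bernoulliFun (k + 1) (Int.fract t) / (k + 1).factorial * f' t := by
  have h_int (m : ℕ) {g : ℝ → ℝ} (hg : IntegrableOn g (Ioi 0)) (i : ℕ) :
      IntervalIntegrable (fun t ↦ bernoulliFun m (Int.fract t) / m.factorial * g t) volume
        (i : ℝ) ((i + 1 : ℕ) : ℝ) := by
    rw [intervalIntegrable_iff_integrableOn_Ioc_of_le (by simp)]
    exact (integrableOn_bernoulliFun_fract_mul m hg).mono_set
      fun t ht ↦ lt_of_le_of_lt (Nat.cast_nonneg i) ht.1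
  have h0 := intervalIntegral.sum_integral_adjacent_intervals (a := fun i : ℕ ↦ (i : ℝ)) (n := n)
    fun i _ ↦ h_int k hi i
  have h1 := intervalIntegral.sum_integral_adjacent_intervals (a := fun i : ℕ ↦ (i : ℝ)) (n := n)
    fun i _ ↦ h_int (k + 1) hi' i
  simp only [Nat.cast_zero] at h0 h1
  rw [← h0, ← h1, ← Finset.sum_sub_distrib]
  exact Finset.sum_congr rfl fun i _ ↦ integral_bernoulliFun_fract_unit k i hf hf'

lemma tendsto_bernoulliRemainder (k : ℕ) {f : ℝ → ℝ} (hi : IntegrableOn f (Ioi 0)) :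
    Tendsto (fun n : ℕ ↦ ∫ t in (0 : ℝ)..n, bernoulliFun k (Int.fract t) / k.factorial * f t)
      atTop (𝓝 (bernoulliRemainder k f)) :=
  intervalIntegral_tendsto_integral_Ioi 0 (integrableOn_bernoulliFun_fract_mul k hi)
    tendsto_natCast_atTop_atTop

lemma bernoulliRemainder_zero (f : ℝ → ℝ) : bernoulliRemainder 0 f = ∫ t in Ioi 0, f t := by
  simp [bernoulliRemainder]

lemma bernoulliRemainder_succ {k : ℕ} (hk : k ≠ 0) {f f' : ℝ → ℝ}
    (hf : ∀ t, HasDerivAt f (f' t) t) (hf' : Continuous f')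
    (hi : IntegrableOn f (Ioi 0)) (hi' : IntegrableOn f' (Ioi 0)) :
    bernoulliRemainder k f =
      -((bernoulli (k + 1) : ℝ) / (k + 1).factorial * f 0) - bernoulliRemainder (k + 1) f' := by
  refine tendsto_nhds_unique (tendsto_bernoulliRemainder k hi) ?_
  have hlim : Tendsto (fun n : ℕ ↦ f n) atTop (𝓝 0) :=
    (tendsto_zero_of_hasDerivAt_of_integrableOn_Ioi (fun t _ ↦ hf t) hi' hi).comp
      tendsto_natCast_atTop_atTop
  have h := ((hlim.sub_const (f 0)).const_mul
    ((bernoulli (k + 1) : ℝ) / (k + 1).factorial)).sub (tendsto_bernoulliRemainder (k + 1) hi')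
  rw [zero_sub, mul_neg] at h
  refine h.congr fun n ↦ ?_
  rw [integral_bernoulliFun_fract k n hf hf' hi hi',
    bernoulliFun_endpoints_eq_of_ne_one (by omega : k + 1 ≠ 1), bernoulliFun_eval_zero]
  simp_rw [← mul_sub]
  rw [← Finset.mul_sum, Finset.sum_range_sub (fun i : ℕ ↦ f i), Nat.cast_zero]

lemma hasSum_eq_integral_add_bernoulliRemainder_one {f f' : ℝ → ℝ}
    (hf : ∀ t, HasDerivAt f (f' t) t) (hf' : Continuous f')
    (hi : IntegrableOn f (Ioi 0)) (hi' : IntegrableOn f' (Ioi 0)) (hpos : ∀ t, 0 ≤ t → 0 ≤ f t) :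
    HasSum (fun n : ℕ ↦ f ((n + 1 : ℕ) : ℝ))
      ((∫ t in Ioi 0, f t) - f 0 / 2 + bernoulliRemainder 1 f') := by
  rw [hasSum_iff_tendsto_nat_of_nonneg fun n ↦ hpos _ (Nat.cast_nonneg _)]
  have hlim : Tendsto (fun n : ℕ ↦ f n) atTop (𝓝 0) :=
    (tendsto_zero_of_hasDerivAt_of_integrableOn_Ioi (fun t _ ↦ hf t) hi' hi).comp
      tendsto_natCast_atTop_atTop
  have h := ((tendsto_bernoulliRemainder 0 hi).add ((hlim.sub_const (f 0)).div_const 2)).add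
    (tendsto_bernoulliRemainder 1 hi')
  rw [bernoulliRemainder_zero, zero_sub, neg_div, ← sub_eq_add_neg] at h
  refine h.congr fun n ↦ ?_
  rw [integral_bernoulliFun_fract 0 n hf hf' hi hi', ← Nat.cast_zero (R := ℝ),
    ← Finset.sum_range_sub (fun i : ℕ ↦ f i), Finset.sum_div, Nat.cast_zero, zero_add,
    sub_add_eq_add_sub, sub_add_cancel, ← Finset.sum_add_distrib]
  refine Finset.sum_congr rfl fun i _ ↦ ?_
  simp
  ring

lemma abs_bernoulliRemainder_le (k : ℕ) :
    ∃ C, ∀ f : ℝ → ℝ, IntegrableOn f (Ioi 0) →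
      |bernoulliRemainder k f| ≤ C * ∫ t in Ioi 0, |f t| := by
  obtain ⟨C, hC⟩ := exists_abs_bernoulliFun_fract_le k
  refine ⟨C, fun f hf ↦ ?_⟩
  rw [← integral_const_mul, ← Real.norm_eq_abs, bernoulliRemainder]
  refine norm_integral_le_of_norm_le (Integrable.const_mul hf.norm C) (Eventually.of_forall fun t ↦ ?_)
  rw [Real.norm_eq_abs, abs_mul]
  exact mul_le_mul_of_nonneg_right (hC t) (abs_nonneg _)

/-- The Euler-Maclaurin formula at odd order, on the half-line. -/
lemma bernoulliRemainder_one_eq_sum {F : ℕ → ℝ → ℝ}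
    (hF : ∀ k t, HasDerivAt (F k) (F (k + 1) t) t) (hi : ∀ k, IntegrableOn (F k) (Ioi 0))
    (N : ℕ) :
    bernoulliRemainder 1 (F 1) =
      -∑ m ∈ Finset.range N,
        (bernoulli (2 * m + 2) : ℝ) / (2 * m + 2).factorial * F (2 * m + 1) 0 +
      bernoulliRemainder (2 * N + 1) (F (2 * N + 1)) := by
  have hc (k : ℕ) : Continuous (F k) :=
    continuous_iff_continuousAt.mpr fun t ↦ (hF k t).continuousAt
  have step (k : ℕ) (hk : k ≠ 0) :=
    bernoulliRemainder_succ hk (hF k) (hc (k + 1)) (hi k) (hi (k + 1))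
  induction N with
  | zero => simp
  | succ N ih =>
    rw [ih, step (2 * N + 1) (by omega), step (2 * N + 1 + 1) (by omega),
      bernoulli_eq_zero_of_odd (n := 2 * N + 1 + 1 + 1) ⟨N + 1, by ring⟩ (by omega),
      Finset.sum_range_succ]
    simp only [mul_add, mul_one, add_assoc, Nat.reduceAdd]
    push_cast
    ring

/-- The polynomial `p` such that `p * exp (-x ^ 2)` is the `k`-th derivative of `exp (-x ^ 2)`. -/
noncomputable def gaussianDerivPoly : ℕ → Polynomial ℝ
  | 0 => 1
  | k + 1 => (gaussianDerivPoly k).derivative - 2 * Polynomial.X * gaussianDerivPoly k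

lemma derivative_gaussianDerivPoly_succ (k : ℕ) :
    (gaussianDerivPoly (k + 1)).derivative =
      -(2 * ((k : Polynomial ℝ) + 1)) * gaussianDerivPoly k := by
  induction k with
  | zero => simp [gaussianDerivPoly]
  | succ k ih =>
    rw [gaussianDerivPoly, ih]
    simp only [Polynomial.derivative_sub, Polynomial.derivative_mul, ih, Polynomial.derivative_neg,
      Polynomial.derivative_add, Polynomial.derivative_natCast, Polynomial.derivative_one,
      Polynomial.derivative_ofNat, Polynomial.derivative_X]
    rw [gaussianDerivPoly]
    push_cast
    ring

lemma gaussianDerivPoly_eval_zero (m : ℕ) :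
    (gaussianDerivPoly (2 * m)).eval 0 = (-1) ^ m * (2 * m).factorial / m.factorial := by
  induction m with
  | zero => simp [gaussianDerivPoly]
  | succ m ih =>
    have h : (gaussianDerivPoly (2 * (m + 1))).eval 0 =
        -(2 * (2 * m + 1)) * (gaussianDerivPoly (2 * m)).eval 0 := by
      rw [show 2 * (m + 1) = 2 * m + 1 + 1 by ring, gaussianDerivPoly,
        derivative_gaussianDerivPoly_succ]
      simp
    rw [h, ih, show 2 * (m + 1) = 2 * m + 1 + 1 by ring, Nat.factorial_succ, Nat.factorial_succ,
      Nat.factorial_succ]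
    have : (m.factorial : ℝ) ≠ 0 := by positivity
    have : (m : ℝ) + 1 ≠ 0 := by positivity
    push_cast
    field_simp
    ring

lemma integrable_polynomial_mul_exp_neg_sq (p : Polynomial ℝ) :
    Integrable fun u : ℝ ↦ p.eval u * Real.exp (-u ^ 2) := by
  induction p using Polynomial.induction_on' with
  | add p q hp hq =>
    simp only [Polynomial.eval_add, add_mul]
    exact hp.add hq
  | monomial n a =>
    have h := (integrable_rpow_mul_exp_neg_mul_sq one_pos
      (s := n) (by linarith [Nat.cast_nonneg (α := ℝ) n])).const_mul a
    simpa [mul_assoc] using h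

/-- The `k`-th derivative of `u * exp (-u ^ 2)`. -/
noncomputable def mulGaussianDeriv (k : ℕ) (u : ℝ) : ℝ :=
  -(1 / 2) * ((gaussianDerivPoly (k + 1)).eval u * Real.exp (-u ^ 2))

lemma hasDerivAt_gaussianDerivPoly (k : ℕ) (u : ℝ) :
    HasDerivAt (fun u ↦ (gaussianDerivPoly k).eval u * Real.exp (-u ^ 2))
      ((gaussianDerivPoly (k + 1)).eval u * Real.exp (-u ^ 2)) u := by
  convert! ((gaussianDerivPoly k).hasDerivAt u).mul ((hasDerivAt_pow 2 u).neg.exp) using 1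
  rw [gaussianDerivPoly]
  simp
  ring

lemma hasDerivAt_mulGaussianDeriv (k : ℕ) (u : ℝ) :
    HasDerivAt (mulGaussianDeriv k) (mulGaussianDeriv (k + 1) u) u :=
  (hasDerivAt_gaussianDerivPoly (k + 1) u).const_mul _

lemma mulGaussianDeriv_zero (u : ℝ) : mulGaussianDeriv 0 u = u * Real.exp (-u ^ 2) := by
  simp [mulGaussianDeriv, gaussianDerivPoly]
  ring

lemma integrable_mulGaussianDeriv (k : ℕ) : Integrable (mulGaussianDeriv k) :=
  (integrable_polynomial_mul_exp_neg_sq _).const_mul _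

lemma integral_Ioi_mulGaussianDeriv_zero : ∫ u in Ioi 0, mulGaussianDeriv 0 u = 1 / 2 := by
  have hd := fun k u ↦ (hasDerivAt_gaussianDerivPoly k u).const_mul (-(1 / 2))
  have hi := fun k ↦ ((integrable_polynomial_mul_exp_neg_sq (gaussianDerivPoly k)).const_mul
    (-(1 / 2))).integrableOn (s := Ioi 0)
  have h := integral_Ioi_of_hasDerivAt_of_tendsto (hd 0 0).continuousAt.continuousWithinAt
    (fun u _ ↦ hd 0 u) (hi 1)
    (tendsto_zero_of_hasDerivAt_of_integrableOn_Ioi (fun u _ ↦ hd 0 u) (hi 1) (hi 0))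
  refine h.trans ?_
  simp [gaussianDerivPoly]

/-- The `k`-th derivative of `t * exp (-(h * t) ^ 2)` in `t`. -/
noncomputable def scaledMulGaussianDeriv (h : ℝ) (k : ℕ) (t : ℝ) : ℝ :=
  h ^ k / h * mulGaussianDeriv k (h * t)

lemma hasDerivAt_scaledMulGaussianDeriv (h : ℝ) (k : ℕ) (t : ℝ) :
    HasDerivAt (scaledMulGaussianDeriv h k) (scaledMulGaussianDeriv h (k + 1) t) t := by
  have hlin : HasDerivAt (fun t ↦ h * t) h t := by simpa using (hasDerivAt_id t).const_mul h
  convert! ((hasDerivAt_mulGaussianDeriv k (h * t)).comp t hlin).const_mul (h ^ k / h) using 1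
  rw [scaledMulGaussianDeriv]
  ring

lemma integrableOn_scaledMulGaussianDeriv {h : ℝ} (hh : 0 < h) (k : ℕ) :
    IntegrableOn (scaledMulGaussianDeriv h k) (Ioi 0) :=
  (((integrable_mulGaussianDeriv k).comp_mul_left' hh.ne').const_mul _).integrableOn

lemma exists_abs_bernoulliRemainder_scaledMulGaussianDeriv_le (k : ℕ) :
    ∃ C, ∀ h > 0, |bernoulliRemainder k (scaledMulGaussianDeriv h k)| ≤ C * (h ^ k / h ^ 2) := by
  obtain ⟨C, hC⟩ := abs_bernoulliRemainder_le k
  refine ⟨C * ∫ u in Ioi 0, |mulGaussianDeriv k u|, fun h hh ↦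
    (hC _ (integrableOn_scaledMulGaussianDeriv hh k)).trans_eq ?_⟩
  have h1 (t : ℝ) : |scaledMulGaussianDeriv h k t| = h ^ k / h * |mulGaussianDeriv k (h * t)| := by
    rw [scaledMulGaussianDeriv, abs_mul, abs_of_pos (by positivity)]
  simp_rw [h1]
  rw [integral_const_mul, integral_comp_mul_left_Ioi (fun u ↦ |mulGaussianDeriv k u|) 0 hh,
    mul_zero, smul_eq_mul]
  field_simp

lemma tsum_mul_exp_neg_sq_eq {h : ℝ} (hh : 0 < h) (N : ℕ) :
    ∑' n : ℕ, ((n + 1 : ℕ) : ℝ) * Real.exp (-(((n + 1 : ℕ) : ℝ) ^ 2 * h ^ 2)) =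
      1 / (2 * h ^ 2) + 1 / (2 * h ^ 2) *
        ∑ n ∈ Finset.Icc 1 N, ((bernoulli (2 * n) : ℝ) / (n.factorial : ℝ)) * (-h ^ 2) ^ n +
      bernoulliRemainder (2 * N + 1) (scaledMulGaussianDeriv h (2 * N + 1)) := by
  have hd := hasDerivAt_scaledMulGaussianDeriv h
  have hi := integrableOn_scaledMulGaussianDeriv hh
  have h0 (t : ℝ) : scaledMulGaussianDeriv h 0 t = t * Real.exp (-(t ^ 2 * h ^ 2)) := by
    rw [scaledMulGaussianDeriv, mulGaussianDeriv_zero, mul_pow, mul_comm (h ^ 2)]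
    field_simp
  have h_int : ∫ t in Ioi 0, scaledMulGaussianDeriv h 0 t = 1 / (2 * h ^ 2) := by
    simp only [scaledMulGaussianDeriv]
    rw [integral_const_mul, integral_comp_mul_left_Ioi (mulGaussianDeriv 0) 0 hh, mul_zero,
      integral_Ioi_mulGaussianDeriv_zero, smul_eq_mul]
    field_simp
  have key := (hasSum_eq_integral_add_bernoulliRemainder_one (hd 0)
    (continuous_iff_continuousAt.mpr fun t ↦ (hd 1 t).continuousAt) (hi 0) (hi 1)
    fun t ht ↦ by rw [h0]; positivity).tsum_eq
  simp only [h0] at key h_int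
  rw [key, h_int, bernoulliRemainder_one_eq_sum hd hi N, ← add_assoc]
  congr 1
  rw [zero_mul, zero_div, sub_zero, ← Finset.sum_neg_distrib, Finset.mul_sum,
    ← Finset.Ico_add_one_right_eq_Icc, Finset.sum_Ico_eq_sum_range]
  congr 1
  refine Finset.sum_congr (by simp) fun m _ ↦ ?_
  rw [scaledMulGaussianDeriv, mulGaussianDeriv, mul_zero,
    show 2 * m + 1 + 1 = 2 * (m + 1) by ring, gaussianDerivPoly_eval_zero,
    add_comm 1 m, neg_pow (h ^ 2) (m + 1)]
  have : ((m + 1).factorial : ℝ) ≠ 0 := by positivity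
  have : ((2 * (m + 1)).factorial : ℝ) ≠ 0 := by positivity
  simp
  field_simp
  ring

/-- asymptotics of `∑_{n≥1} n e^{-n² x}` as `x → 0⁺`. -/
theorem sum_n_exp_asymp (N : ℕ) :
    (fun x : ℝ => (∑' n : ℕ, ((n + 1 : ℕ) : ℝ) * Real.exp (-(((n + 1 : ℕ) : ℝ) ^ 2 * x))) -
      (1 / (2 * x) + (1 / (2 * x)) *
        ∑ n ∈ Finset.Icc 1 N, ((bernoulli (2 * n) : ℝ) / (n.factorial : ℝ)) * (-x) ^ n))
      =o[nhdsWithin 0 (Set.Ioi 0)]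
    fun x : ℝ => x ^ ((N : ℤ) - 1) := by
  obtain ⟨C, hC⟩ := exists_abs_bernoulliRemainder_scaledMulGaussianDeriv_le (2 * N + 1)
  have hsqrt : (fun x : ℝ ↦ √x) =o[𝓝[>] 0] fun _ ↦ (1 : ℝ) := by
    rw [isLittleO_one_iff]
    simpa using (Real.continuous_sqrt.tendsto 0).mono_left nhdsWithin_le_nhds
  have hlo := hsqrt.mul_isBigO (isBigO_refl (fun x : ℝ ↦ x ^ ((N : ℤ) - 1)) (𝓝[>] 0))
  simp only [one_mul] at hlo
  refine IsBigO.trans_isLittleO (IsBigO.of_bound C ?_) hlo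
  filter_upwards [self_mem_nhdsWithin] with x hx
  have hx : 0 < x := hx
  have hh : 0 < √x := Real.sqrt_pos.mpr hx
  have hsq : √x ^ 2 = x := Real.sq_sqrt hx.le
  have key := tsum_mul_exp_neg_sq_eq hh N
  rw [hsq] at key
  rw [key, add_sub_cancel_left, Real.norm_eq_abs, Real.norm_of_nonneg (by positivity)]
  refine (hC _ hh).trans_eq ?_
  rw [pow_succ, pow_mul, hsq, zpow_sub_one₀ hx.ne', zpow_natCast]
  ring
end

section
/- Let $a > 0$ and $b \in \mathbb{C}$ with $b \neq 1 + an$ for every nonnegative integer $n$. Then for every natural number $N$, as $x \to 0^+$: $\sum_{n=1}^{\infty} \frac{e^{-n^a x}}{n^b} = \frac{x^{(b-1)/a}}{a}\Gamma\left(\frac{1-b}{a}\right) + \sum_{n=0}^{N} \frac{(-x)^n}{n!} \zeta(b - an) + o(x^N)$. -/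
open Complex Real Filter Asymptotics

section PowExp

open MeasureTheory Set Topology

/-- The function `t ↦ t ^ (-b) * u ^ i * exp (-u)`, where `u = x * t ^ a`. -/
noncomputable def powExp (a : ℝ) (b : ℂ) (i : ℕ) (x t : ℝ) : ℂ :=
  (t : ℂ) ^ (-b) * (((x * t ^ a) ^ i * Real.exp (-(x * t ^ a)) : ℝ) : ℂ)

lemma pow_mul_exp_neg_le_factorial {u : ℝ} (hu : 0 ≤ u) (i : ℕ) :
    u ^ i * Real.exp (-u) ≤ i.factorial := by
  have h := Real.pow_div_factorial_le_exp u hu i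
  rw [div_le_iff₀ (by positivity)] at h
  rw [Real.exp_neg, ← div_eq_mul_inv, div_le_iff₀ (Real.exp_pos u)]
  linarith

lemma norm_powExp {a x t : ℝ} (hx : 0 ≤ x) (ht : 0 < t) (b : ℂ) (i : ℕ) :
    ‖powExp a b i x t‖ = t ^ (-b.re) * ((x * t ^ a) ^ i * Real.exp (-(x * t ^ a))) := by
  have hu : 0 ≤ x * t ^ a := by positivity
  rw [powExp, norm_mul, Complex.norm_cpow_eq_rpow_re_of_pos ht, Complex.norm_real,
    Real.norm_of_nonneg (by positivity), Complex.neg_re]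

lemma norm_powExp_le {a x t : ℝ} (hx : 0 ≤ x) (ht : 0 < t) (b : ℂ) (i : ℕ) :
    ‖powExp a b i x t‖ ≤ i.factorial * t ^ (-b.re) := by
  rw [norm_powExp hx ht, mul_comm]
  gcongr
  exact pow_mul_exp_neg_le_factorial (by positivity) i

lemma norm_powExp_le_of_pos {a x t : ℝ} (hx : 0 < x) (ht : 0 < t) (b : ℂ) (i M : ℕ) :
    ‖powExp a b i x t‖ ≤ (i + M).factorial * (x ^ M)⁻¹ * t ^ (-(b.re + a * M)) := by
  have hu : 0 < x * t ^ a := by positivity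
  have h := pow_mul_exp_neg_le_factorial hu.le (i + M)
  have h2 : t ^ (-(b.re + a * M)) = t ^ (-b.re) * ((t ^ a) ^ M)⁻¹ := by
    rw [← Real.rpow_natCast, ← Real.rpow_mul ht.le, ← Real.rpow_neg ht.le, ← Real.rpow_add ht]
    ring_nf
  rw [norm_powExp hx.le ht, h2]
  have h3 : (x * t ^ a) ^ i * Real.exp (-(x * t ^ a)) =
      (x * t ^ a) ^ (i + M) * Real.exp (-(x * t ^ a)) * (x ^ M)⁻¹ * ((t ^ a) ^ M)⁻¹ := by
    field_simp
    rw [mul_pow, mul_pow, pow_add, pow_add]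
    ring
  rw [h3]
  calc _ ≤ t ^ (-b.re) * ((i + M).factorial * (x ^ M)⁻¹ * ((t ^ a) ^ M)⁻¹) := by gcongr
    _ = _ := by ring

/-- A bound for `powExp` that is uniform for `x` bounded away from zero. -/
lemma exists_norm_powExp_le {a x₀ : ℝ} (ha : 0 < a) (hx₀ : 0 < x₀) (b : ℂ) (i : ℕ) :
    ∃ C : ℝ, ∀ x, x₀ ≤ x → ∀ t, 1 ≤ t → ‖powExp a b i x t‖ ≤ C * t ^ (-2 : ℝ) := by
  obtain ⟨M, hM⟩ := exists_nat_ge ((2 - b.re) / a)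
  rw [div_le_iff₀ ha] at hM
  refine ⟨(i + M).factorial * (x₀ ^ M)⁻¹, fun x hx t ht ↦ ?_⟩
  have hx' : 0 < x := hx₀.trans_le hx
  refine (norm_powExp_le_of_pos hx' (by positivity) b i M).trans ?_
  gcongr
  linarith

lemma hasDerivAt_powExp {a t : ℝ} (ht : 0 < t) (b : ℂ) (i : ℕ) (x : ℝ) :
    HasDerivAt (powExp a b i x)
      ((-b + i * a) * powExp a (b + 1) i x t - a * powExp a (b + 1) (i + 1) x t) t := by
  have h1 : HasDerivAt (fun y : ℝ ↦ (y : ℂ) ^ (-b)) (-b * (t : ℂ) ^ (-(b + 1))) t := by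
    rcases eq_or_ne b 0 with rfl | hb
    · simpa using hasDerivAt_const t (1 : ℂ)
    · convert hasDerivAt_ofReal_cpow_const ht.ne' (neg_ne_zero.2 hb) using 2
      ring_nf
  have hu : HasDerivAt (fun y : ℝ ↦ x * y ^ a) (a * (x * t ^ a) * t⁻¹) t := by
    refine ((Real.hasDerivAt_rpow_const (p := a) (Or.inl ht.ne')).const_mul x).congr_deriv ?_
    rw [Real.rpow_sub_one ht.ne']
    ring
  have h2 : HasDerivAt (fun y : ℝ ↦ (((x * y ^ a) ^ i * Real.exp (-(x * y ^ a)) : ℝ) : ℂ))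
      (((a * t⁻¹ * (i * ((x * t ^ a) ^ i * Real.exp (-(x * t ^ a))) -
        (x * t ^ a) ^ (i + 1) * Real.exp (-(x * t ^ a))) : ℝ)) : ℂ) t := by
    refine HasDerivAt.ofReal_comp ?_
    refine ((hu.pow i).mul hu.neg.exp).congr_deriv ?_
    rcases i with _ | i
    · simp
      ring
    · simp
      ring
  refine (h1.mul h2).congr_deriv ?_
  have ht' : (t : ℂ) ≠ 0 := by exact_mod_cast ht.ne'
  have h3 : (t : ℂ) ^ (-b) = (t : ℂ) ^ (-(b + 1)) * t := by
    rw [neg_add, Complex.cpow_add _ _ ht', Complex.cpow_neg_one]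
    field_simp
  simp only [powExp, h3]
  push_cast
  field_simp
  ring

lemma hasDerivAt_powExp_param (a t : ℝ) (ht : 0 < t) (b : ℂ) (x : ℝ) :
    HasDerivAt (fun y ↦ powExp a b 0 y t) (-powExp a (b - a) 0 x t) x := by
  have h2 : HasDerivAt (fun y : ℝ ↦ ((Real.exp (-(y * t ^ a)) : ℝ) : ℂ))
      ((-(t ^ a * Real.exp (-(x * t ^ a))) : ℝ) : ℂ) x := by
    refine HasDerivAt.ofReal_comp ?_
    refine ((hasDerivAt_id x).mul_const (t ^ a)).neg.exp.congr_deriv ?_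
    simp [mul_comm]
  have ht' : (t : ℂ) ≠ 0 := by exact_mod_cast ht.ne'
  simp only [powExp, pow_zero, one_mul]
  refine (h2.const_mul ((t : ℂ) ^ (-b))).congr_deriv ?_
  rw [neg_sub, sub_eq_neg_add, Complex.cpow_add _ _ ht', Complex.ofReal_neg, Complex.ofReal_mul,
    Complex.ofReal_cpow ht.le]
  ring

lemma continuousOn_powExp (a : ℝ) (b : ℂ) (i : ℕ) (x : ℝ) :
    ContinuousOn (powExp a b i x) (Ioi 0) :=
  fun _ ht ↦ (hasDerivAt_powExp ht b i x).continuousAt.continuousWithinAt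

lemma integrableOn_of_norm_le_rpow {g : ℝ → ℂ} {C r : ℝ} (hr : r < -1)
    (hg : AEStronglyMeasurable g (volume.restrict (Ioi 1)))
    (h : ∀ t, 1 ≤ t → ‖g t‖ ≤ C * t ^ r) : IntegrableOn g (Ioi 1) := by
  refine Integrable.mono' ((integrableOn_Ioi_rpow_of_lt hr one_pos).const_mul C) hg ?_
  filter_upwards [ae_restrict_mem measurableSet_Ioi] with t ht using h t (le_of_lt ht)

lemma summable_powExp {a x : ℝ} (ha : 0 < a) (hx : 0 < x) (b : ℂ) (i : ℕ) :
    Summable fun n : ℕ ↦ powExp a b i x (n + 1) := by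
  obtain ⟨C, hC⟩ := exists_norm_powExp_le ha hx b i
  refine Summable.of_norm_bounded (g := fun n : ℕ ↦ C * ((n : ℝ) + 1) ^ (-2 : ℝ)) ?_
    fun n ↦ hC x le_rfl _ (by simp)
  refine Summable.mul_left C ?_
  have := (summable_nat_add_iff 1).2 (Real.summable_nat_rpow.2 (by norm_num : (-2 : ℝ) < -1))
  simpa using this

lemma tendsto_powExp_atTop {a x : ℝ} (ha : 0 < a) (hx : 0 < x) (b : ℂ) (i : ℕ) :
    Tendsto (powExp a b i x) atTop (𝓝 0) := by
  obtain ⟨C, hC⟩ := exists_norm_powExp_le ha hx b i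
  refine squeeze_zero_norm' (a := fun t ↦ C * t ^ (-2 : ℝ)) ?_ ?_
  · filter_upwards [eventually_ge_atTop 1] with t ht using hC x le_rfl t ht
  · simpa using (tendsto_rpow_neg_atTop (two_pos : (0 : ℝ) < 2)).const_mul C

/-- The periodic extension of the `k`-th Bernoulli polynomial on `[0, 1)`. -/
noncomputable def perBernoulli (k : ℕ) (t : ℝ) : ℝ := bernoulliFun k (Int.fract t)

lemma measurable_perBernoulli (k : ℕ) : Measurable (perBernoulli k) :=
  (continuous_bernoulliFun (k := k)).measurable.comp measurable_fract

lemma exists_abs_perBernoulli_le (k : ℕ) : ∃ C, ∀ t, |perBernoulli k t| ≤ C := by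
  obtain ⟨C, hC⟩ := (isCompact_Icc (a := (0 : ℝ)) (b := 1)).exists_bound_of_continuousOn
    (continuous_bernoulliFun (k := k)).continuousOn
  exact ⟨C, fun t ↦ hC _ ⟨Int.fract_nonneg t, (Int.fract_lt_one t).le⟩⟩

lemma aestronglyMeasurable_perBernoulli_mul_powExp (a : ℝ) (k : ℕ) (b : ℂ) (i : ℕ) (x : ℝ) :
    AEStronglyMeasurable (fun t ↦ (perBernoulli k t : ℂ) * powExp a b i x t)
      (volume.restrict (Ioi 1)) :=
  (Complex.measurable_ofReal.comp (measurable_perBernoulli k)).aestronglyMeasurable.mul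
    (((continuousOn_powExp a b i x).mono (Ioi_subset_Ioi zero_le_one)).aestronglyMeasurable
      measurableSet_Ioi)

lemma integrableOn_perBernoulli_mul_powExp {a x : ℝ} (ha : 0 < a) (hx : 0 < x) (k : ℕ) (b : ℂ)
    (i : ℕ) : IntegrableOn (fun t ↦ (perBernoulli k t : ℂ) * powExp a b i x t) (Ioi 1) := by
  obtain ⟨C, hC⟩ := exists_norm_powExp_le ha hx b i
  obtain ⟨D, hD⟩ := exists_abs_perBernoulli_le k
  refine integrableOn_of_norm_le_rpow (C := D * C) (r := -2) (by norm_num)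
    (aestronglyMeasurable_perBernoulli_mul_powExp a k b i x) fun t ht ↦ ?_
  rw [norm_mul, Complex.norm_real, Real.norm_eq_abs, mul_assoc]
  exact mul_le_mul (hD t) (hC x le_rfl t ht) (norm_nonneg _) ((abs_nonneg _).trans (hD t))

lemma perBernoulli_eq {n : ℕ} {t : ℝ} (h1 : (n : ℝ) ≤ t) (h2 : t < n + 1) (k : ℕ) :
    perBernoulli k t = bernoulliFun k (t - n) := by
  rw [perBernoulli, Int.fract, (Int.floor_eq_iff (z := (n : ℤ))).2 ⟨by simpa using h1,
    by simpa using h2⟩]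
  simp

lemma integral_perBernoulli_mul_congr (k n : ℕ) (g : ℝ → ℂ) :
    ∫ t in (n : ℝ)..(n + 1), (perBernoulli k t : ℂ) * g t =
      ∫ t in (n : ℝ)..(n + 1), (bernoulliFun k (t - n) : ℂ) * g t := by
  refine intervalIntegral.integral_congr_Ioo_of_le (by simp) fun t ht ↦ ?_
  simp only [perBernoulli_eq ht.1.le ht.2]

/-- Integration by parts against a periodic Bernoulli function on a unit interval. -/
lemma integral_perBernoulli_mul {f f' : ℝ → ℂ} (k : ℕ) {n : ℕ} (hn : 0 < n)
    (hf : ∀ t, 0 < t → HasDerivAt f (f' t) t) (hf' : ContinuousOn f' (Ioi 0)) :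
    (k + 1) * ∫ t in (n : ℝ)..(n + 1), (perBernoulli k t : ℂ) * f t =
      bernoulliFun (k + 1) 1 * f (n + 1) - bernoulliFun (k + 1) 0 * f n -
        ∫ t in (n : ℝ)..(n + 1), (perBernoulli (k + 1) t : ℂ) * f' t := by
  have hn' : (0 : ℝ) < n := by exact_mod_cast hn
  have hpos : ∀ t ∈ uIcc (n : ℝ) (n + 1), 0 < t := fun t ht ↦ by
    rw [uIcc_of_le (by simp)] at ht
    exact hn'.trans_le ht.1
  rw [integral_perBernoulli_mul_congr, integral_perBernoulli_mul_congr]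
  have key := intervalIntegral.integral_mul_deriv_eq_deriv_mul (a := (n : ℝ)) (b := n + 1)
    (u := f) (u' := f') (v := fun t ↦ (bernoulliFun (k + 1) (t - n) : ℂ))
    (v' := fun t ↦ (((k + 1 : ℕ) * bernoulliFun k (t - n) : ℝ) : ℂ))
    (fun t ht ↦ hf t (hpos t ht))
    (fun t _ ↦ by
      have := (hasDerivAt_bernoulliFun (k + 1) (t - n)).comp_sub_const t n
      exact this.ofReal_comp)
    (hf'.mono fun t ht ↦ hpos t ht).intervalIntegrable
    (Continuous.intervalIntegrable (by
      have := continuous_bernoulliFun (k := k)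
      fun_prop) _ _)
  rw [← intervalIntegral.integral_const_mul]
  simp only [add_sub_cancel_left, sub_self] at key
  rw [mul_comm (bernoulliFun (k + 1) 1 : ℂ), mul_comm (bernoulliFun (k + 1) 0 : ℂ)]
  convert key using 2
  · ext t
    push_cast
    ring
  · congr 1
    ext t
    ring

/-- `∫ t in 1..∞, perBernoulli k t * powExp a b i x t`. -/
noncomputable def bernoulliIntegral (a : ℝ) (k : ℕ) (b : ℂ) (i : ℕ) (x : ℝ) : ℂ :=
  ∫ t in Ioi (1 : ℝ), (perBernoulli k t : ℂ) * powExp a b i x t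

/-- One step of Euler-Maclaurin summation. -/
lemma bernoulliIntegral_eq {a x : ℝ} (ha : 0 < a) (hx : 0 < x) (k : ℕ) (b : ℂ) (i : ℕ) :
    (k + 1) * bernoulliIntegral a k b i x =
      (bernoulliFun (k + 1) 1 - bernoulliFun (k + 1) 0) * ∑' n : ℕ, powExp a b i x (n + 1) -
        bernoulliFun (k + 1) 1 * powExp a b i x 1 -
        ((-b + i * a) * bernoulliIntegral a (k + 1) (b + 1) i x -
          a * bernoulliIntegral a (k + 1) (b + 1) (i + 1) x) := by
  set f := powExp a b i x with hf_def
  set f' : ℝ → ℂ := fun t ↦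
    (-b + i * a) * powExp a (b + 1) i x t - a * powExp a (b + 1) (i + 1) x t with hf'_def
  have hf : ∀ t, 0 < t → HasDerivAt f (f' t) t := fun t ht ↦ hasDerivAt_powExp ht b i x
  have hf' : ContinuousOn f' (Ioi 0) :=
    (continuousOn_const.mul (continuousOn_powExp _ _ _ _)).sub
      (continuousOn_const.mul (continuousOn_powExp _ _ _ _))
  have hI := integrableOn_perBernoulli_mul_powExp ha hx k b i
  have hJ0 := (integrableOn_perBernoulli_mul_powExp ha hx (k + 1) (b + 1) i).const_mul (-b + i * a)
  have hJ1 := (integrableOn_perBernoulli_mul_powExp ha hx (k + 1) (b + 1) (i + 1)).const_mul (a : ℂ)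
  have hJeq : (fun t ↦ (perBernoulli (k + 1) t : ℂ) * f' t) = fun t ↦
      (-b + i * a) * ((perBernoulli (k + 1) t : ℂ) * powExp a (b + 1) i x t) -
        a * ((perBernoulli (k + 1) t : ℂ) * powExp a (b + 1) (i + 1) x t) := by
    ext t
    simp only [hf'_def]
    ring
  have hJ : IntegrableOn (fun t ↦ (perBernoulli (k + 1) t : ℂ) * f' t) (Ioi 1) := by
    rw [hJeq]
    exact hJ0.sub hJ1
  have hJint : ∫ t in Ioi (1 : ℝ), (perBernoulli (k + 1) t : ℂ) * f' t =
      (-b + i * a) * bernoulliIntegral a (k + 1) (b + 1) i x -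
        a * bernoulliIntegral a (k + 1) (b + 1) (i + 1) x := by
    rw [hJeq, integral_sub hJ0 hJ1, integral_const_mul, integral_const_mul]
    rfl
  have hsplit : ∀ g : ℝ → ℂ, IntegrableOn g (Ioi 1) → Tendsto (fun N : ℕ ↦
      ∑ n ∈ Finset.range N, ∫ t in ((n + 1 : ℕ) : ℝ)..((n + 1 : ℕ) + 1), g t) atTop
      (𝓝 (∫ t in Ioi (1 : ℝ), g t)) := by
    intro g hg
    have h1 : Tendsto (fun N : ℕ ↦ ((N : ℝ) + 1)) atTop atTop :=
      tendsto_atTop_add_const_right _ _ tendsto_natCast_atTop_atTop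
    refine (intervalIntegral_tendsto_integral_Ioi 1 hg h1).congr fun N ↦ ?_
    have := intervalIntegral.sum_integral_adjacent_intervals (f := g) (μ := volume)
      (a := fun n : ℕ ↦ (n : ℝ) + 1) (n := N) (fun n _ ↦ ?_)
    · simpa using this.symm
    · rw [intervalIntegrable_iff_integrableOn_Ioc_of_le (by simp)]
      exact hg.mono_set fun t ht ↦ lt_of_le_of_lt (by simp) ht.1
  have hsum := (summable_powExp ha hx b i).hasSum.tendsto_sum_nat
  have hsum' : Tendsto (fun N : ℕ ↦ ∑ n ∈ Finset.range N, f (n + 1 + 1)) atTop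
      (𝓝 (∑' n : ℕ, f (n + 1) - f 1)) := by
    have := (tendsto_add_atTop_iff_nat 1).2 hsum
    refine (this.sub_const (f 1)).congr fun N ↦ ?_
    rw [Finset.sum_range_succ']
    simp [hf_def]
  have hL := (hsplit _ hI).const_mul ((k : ℂ) + 1)
  have hR := ((hsum'.const_mul (bernoulliFun (k + 1) 1 : ℂ)).sub
    (hsum.const_mul (bernoulliFun (k + 1) 0 : ℂ))).sub (hsplit _ hJ)
  have heq := tendsto_nhds_unique (hL.congr fun N ↦ ?_) hR
  · rw [bernoulliIntegral, heq, hJint]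
    ring
  · rw [Finset.mul_sum, Finset.mul_sum, Finset.mul_sum, ← Finset.sum_sub_distrib,
      ← Finset.sum_sub_distrib]
    refine Finset.sum_congr rfl fun n _ ↦ ?_
    rw [integral_perBernoulli_mul k n.succ_pos hf hf']
    simp [hf_def]

lemma tendsto_powExp_zero (a t : ℝ) (b : ℂ) (i : ℕ) :
    Tendsto (fun x ↦ powExp a b i x t) (𝓝[>] 0) (𝓝 (if i = 0 then (t : ℂ) ^ (-b) else 0)) := by
  have h : Continuous fun x ↦ powExp a b i x t := by
    unfold powExp
    fun_prop
  have h0 := (h.tendsto 0).mono_left (nhdsWithin_le_nhds (s := Ioi 0))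
  convert h0 using 2
  rcases i with _ | i <;> simp [powExp]

/-- The family `g b` has a limit at `0⁺` that is holomorphic in `b` for `c < b.re`. -/
def HasHolomorphicLimit (c : ℝ) (g : ℂ → ℝ → ℂ) : Prop :=
  ∃ τ : ℂ → ℂ, DifferentiableOn ℂ τ {b | c < b.re} ∧
    ∀ b, c < b.re → Tendsto (g b) (𝓝[>] 0) (𝓝 (τ b))

namespace HasHolomorphicLimit

variable {c : ℝ} {g h : ℂ → ℝ → ℂ}

lemma sub (hg : HasHolomorphicLimit c g) (hh : HasHolomorphicLimit c h) :
    HasHolomorphicLimit c fun b x ↦ g b x - h b x := by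
  obtain ⟨τ, hτ, h1⟩ := hg
  obtain ⟨σ, hσ, h2⟩ := hh
  exact ⟨fun b ↦ τ b - σ b, hτ.sub hσ, fun b hb ↦ (h1 b hb).sub (h2 b hb)⟩

lemma mul_left (hg : HasHolomorphicLimit c g) {σ : ℂ → ℂ} (hσ : Differentiable ℂ σ) :
    HasHolomorphicLimit c fun b x ↦ σ b * g b x := by
  obtain ⟨τ, hτ, h1⟩ := hg
  exact ⟨fun b ↦ σ b * τ b, hσ.differentiableOn.mul hτ, fun b hb ↦ (h1 b hb).const_mul _⟩

lemma shift (hg : HasHolomorphicLimit c g) :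
    HasHolomorphicLimit (c - 1) fun b x ↦ g (b + 1) x := by
  obtain ⟨τ, hτ, h1⟩ := hg
  have hmem : ∀ b : ℂ, c - 1 < b.re → c < (b + 1).re := fun b hb ↦ by simp; linarith
  exact ⟨fun b ↦ τ (b + 1), hτ.comp (by fun_prop) hmem, fun b hb ↦ h1 _ (hmem b hb)⟩

lemma congr (hg : HasHolomorphicLimit c g) (hgh : ∀ b, ∀ x > 0, g b x = h b x) :
    HasHolomorphicLimit c h := by
  obtain ⟨τ, hτ, h1⟩ := hg
  refine ⟨τ, hτ, fun b hb ↦ (h1 b hb).congr' ?_⟩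
  filter_upwards [self_mem_nhdsWithin] with x hx using hgh b x hx

lemma powExp_one (a c : ℝ) (i : ℕ) : HasHolomorphicLimit c fun b x ↦ powExp a b i x 1 :=
  ⟨fun _ ↦ if i = 0 then 1 else 0, differentiableOn_const _, fun b _ ↦ by
    simpa using tendsto_powExp_zero a 1 b i⟩

end HasHolomorphicLimit

lemma tendsto_bernoulliIntegral (a : ℝ) (k : ℕ) {b : ℂ} (hb : 1 < b.re) (i : ℕ) :
    Tendsto (bernoulliIntegral a k b i) (𝓝[>] 0) (𝓝 (∫ t in Ioi (1 : ℝ),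
      (perBernoulli k t : ℂ) * if i = 0 then (t : ℂ) ^ (-b) else 0)) := by
  obtain ⟨D, hD⟩ := exists_abs_perBernoulli_le k
  refine tendsto_integral_filter_of_dominated_convergence
    (fun t ↦ D * (i.factorial * t ^ (-b.re)))
    (.of_forall fun x ↦ aestronglyMeasurable_perBernoulli_mul_powExp a k b i x) ?_
    (((integrableOn_Ioi_rpow_of_lt (by linarith) one_pos).const_mul _).const_mul D) ?_
  · filter_upwards [self_mem_nhdsWithin] with x hx
    filter_upwards [ae_restrict_mem measurableSet_Ioi] with t ht
    rw [norm_mul, Complex.norm_real, Real.norm_eq_abs]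
    exact mul_le_mul (hD t) (norm_powExp_le (le_of_lt hx) (zero_lt_one.trans ht) b i)
      (norm_nonneg _) ((abs_nonneg _).trans (hD t))
  · exact .of_forall fun t ↦ (tendsto_powExp_zero a t b i).const_mul _

lemma differentiableAt_integral_perBernoulli_mul_cpow (k : ℕ) {b : ℂ} (hb : 1 < b.re) :
    DifferentiableAt ℂ (fun b : ℂ ↦ ∫ t in Ioi (1 : ℝ), (perBernoulli k t : ℂ) * (t : ℂ) ^ (-b))
      b := by
  obtain ⟨D, hD⟩ := exists_abs_perBernoulli_le k
  set P : ℝ → ℂ := (Ioi 1).indicator fun t ↦ (perBernoulli k t : ℂ) with hP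
  have hPm : Measurable P :=
    (Complex.measurable_ofReal.comp (measurable_perBernoulli k)).indicator measurableSet_Ioi
  have hPD : ∀ t, ‖P t‖ ≤ D := fun t ↦ by
    refine (norm_indicator_le_norm_self _ _).trans ?_
    rw [Complex.norm_real]
    exact hD t
  have hmellin : ∀ s : ℂ, mellin P (1 - s) =
      ∫ t in Ioi (1 : ℝ), (perBernoulli k t : ℂ) * (t : ℂ) ^ (-s) := by
    intro s
    rw [mellin, ← integral_indicator measurableSet_Ioi, ← integral_indicator measurableSet_Ioi]
    congr 1
    ext t
    by_cases h1 : 1 < t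
    · have h0 : 0 < t := zero_lt_one.trans h1
      simp [hP, h0, h1, mul_comm]
    · simp [hP, h1, indicator]
  simp only [← hmellin]
  have hloc : LocallyIntegrableOn P (Ioi 0) := by
    refine LocallyIntegrable.locallyIntegrableOn ?_ _
    exact (locallyIntegrable_const D).mono hPm.aestronglyMeasurable
      (.of_forall fun t ↦ (hPD t).trans (le_abs_self D))
  have hdiff : DifferentiableAt ℂ (fun s : ℂ ↦ 1 - s) b := by fun_prop
  refine DifferentiableAt.comp (g := mellin P) b (mellin_differentiableAt_of_isBigO_rpow (a := 0)
    (b := (1 - b).re - 1) hloc ?_ ?_ ?_ ?_) hdiff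
  · simp only [neg_zero, rpow_zero]
    exact IsBigO.of_bound D (.of_forall fun t ↦ by simpa using hPD t)
  · simp; linarith
  · refine IsBigO.of_bound 0 ?_
    filter_upwards [Ioo_mem_nhdsGT one_pos] with t ht
    simp [hP, ht.2.le]
  · simp

lemma hasHolomorphicLimit_bernoulliIntegral {a : ℝ} (ha : 0 < a) (m k : ℕ) (i : ℕ) :
    HasHolomorphicLimit (1 - m) fun b x ↦ bernoulliIntegral a (k + 1) b i x := by
  induction m generalizing k i with
  | zero =>
    refine ⟨fun b ↦ ∫ t in Ioi (1 : ℝ), (perBernoulli (k + 1) t : ℂ) *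
      if i = 0 then (t : ℂ) ^ (-b) else 0, fun b hb ↦ ?_, fun b hb ↦
        tendsto_bernoulliIntegral a (k + 1) (by simpa using hb) i⟩
    refine DifferentiableAt.differentiableWithinAt ?_
    rcases i with _ | i
    · simpa using differentiableAt_integral_perBernoulli_mul_cpow (k + 1) (by simpa using hb)
    · simp
  | succ m ih =>
    have hc : (1 : ℝ) - (m + 1 : ℕ) = 1 - m - 1 := by push_cast; ring
    rw [hc]
    have h1 := (HasHolomorphicLimit.powExp_one a (1 - m - 1) i).mul_left
      (σ := fun _ ↦ -(bernoulliFun (k + 1 + 1) 1 : ℂ)) (by fun_prop)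
    have h2 := ((ih (k + 1) i).shift).mul_left (σ := fun b ↦ -b + i * a) (by fun_prop)
    have h3 := ((ih (k + 1) (i + 1)).shift).mul_left (σ := fun b ↦ (a : ℂ)) (by fun_prop)
    refine ((h1.sub (h2.sub h3)).mul_left (σ := fun _ ↦ ((k : ℂ) + 1 + 1)⁻¹)
      (by fun_prop)).congr fun b x hx ↦ ?_
    have := bernoulliIntegral_eq ha hx (k + 1) b i
    rw [bernoulliFun_endpoints_eq_of_ne_one (by lia), sub_self, zero_mul, zero_sub,
      ← neg_mul] at this
    have hk : (k : ℂ) + 1 + 1 ≠ 0 := by exact_mod_cast (k + 1).succ_ne_zero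
    rw [inv_mul_eq_iff_eq_mul₀ hk, bernoulliFun_endpoints_eq_of_ne_one (by lia), ← this]
    push_cast
    rfl

lemma hasHolomorphicLimit_tsum_sub_integral {a : ℝ} (ha : 0 < a) (m : ℕ) :
    HasHolomorphicLimit (-m) fun b x ↦
      ∑' n : ℕ, powExp a b 0 x (n + 1) - ∫ t in Ioi (1 : ℝ), powExp a b 0 x t := by
  have hc : -(m : ℝ) = 1 - m - 1 := by ring
  rw [hc]
  have h1 := (HasHolomorphicLimit.powExp_one a (1 - m - 1) 0).mul_left
    (σ := fun _ ↦ (2⁻¹ : ℂ)) (by fun_prop)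
  have h2 := ((hasHolomorphicLimit_bernoulliIntegral ha m 0 0).shift).mul_left
    (σ := fun b ↦ b) (by fun_prop)
  have h3 := ((hasHolomorphicLimit_bernoulliIntegral ha m 0 1).shift).mul_left
    (σ := fun b ↦ -(a : ℂ)) (by fun_prop)
  refine (h1.sub (h2.sub h3)).congr fun b x hx ↦ ?_
  have := bernoulliIntegral_eq ha hx 0 b 0
  simp only [bernoulliIntegral, perBernoulli, bernoulliFun_zero] at this ⊢
  norm_num at this ⊢
  linear_combination this

lemma tendsto_integral_powExp_of_one_lt_re {a : ℝ} {b : ℂ} (hb : 1 < b.re) :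
    Tendsto (fun x ↦ ∫ t in Ioi (1 : ℝ), powExp a b 0 x t) (𝓝[>] 0) (𝓝 (b - 1)⁻¹) := by
  have h := tendsto_bernoulliIntegral a 0 hb 0
  have hint : ∫ t in Ioi (1 : ℝ), (t : ℂ) ^ (-b) = (b - 1)⁻¹ := by
    rw [integral_Ioi_cpow_of_lt (by simpa using hb) one_pos, neg_add_eq_sub, ← neg_sub b 1]
    rw [Complex.ofReal_one, Complex.one_cpow, neg_div_neg_eq, one_div]
  unfold bernoulliIntegral at h
  simpa [perBernoulli, hint] using h

lemma tendsto_tsum_powExp_of_one_lt_re {a : ℝ} {b : ℂ} (hb : 1 < b.re) :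
    Tendsto (fun x ↦ ∑' n : ℕ, powExp a b 0 x (n + 1)) (𝓝[>] 0) (𝓝 (riemannZeta b)) := by
  have hz : riemannZeta b = ∑' n : ℕ, (((n : ℝ) + 1 : ℝ) : ℂ) ^ (-b) := by
    rw [zeta_eq_tsum_one_div_nat_add_one_cpow hb]
    simp [Complex.cpow_neg]
  rw [hz]
  refine tendsto_tsum_of_dominated_convergence (bound := fun n : ℕ ↦ ((n : ℝ) + 1) ^ (-b.re)) ?_
    (fun n ↦ by simpa using tendsto_powExp_zero a (n + 1) b 0) ?_
  · have := (summable_nat_add_iff 1).2 (Real.summable_nat_rpow.2 (by linarith : -b.re < -1))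
    simpa using this
  · filter_upwards [self_mem_nhdsWithin] with x hx n
    simpa using norm_powExp_le (a := a) (le_of_lt hx) (n.cast_add_one_pos (α := ℝ)) b 0

/-- The sum minus the integral converges to the regular part of the zeta function at `1`. -/
lemma tendsto_tsum_sub_integral {a : ℝ} (ha : 0 < a) (b : ℂ) :
    Tendsto (fun x ↦ ∑' n : ℕ, powExp a b 0 x (n + 1) - ∫ t in Ioi (1 : ℝ), powExp a b 0 x t)
      (𝓝[>] 0) (𝓝 (riemannZeta₀ b)) := by
  obtain ⟨m, hm⟩ := exists_nat_gt (-b.re)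
  obtain ⟨τ, hτ, hlim⟩ := hasHolomorphicLimit_tsum_sub_integral ha m
  have hopen : ∀ c : ℝ, IsOpen {z : ℂ | c < z.re} := fun c ↦
    isOpen_lt continuous_const Complex.continuous_re
  have hpre : IsPreconnected {z : ℂ | -(m : ℝ) < z.re} :=
    (convex_halfSpace_re_gt _).isPreconnected
  have h2 : (2 : ℂ) ∈ {z : ℂ | -(m : ℝ) < z.re} := by
    have : (0 : ℝ) ≤ m := m.cast_nonneg
    simp
    linarith
  have heq : τ =ᶠ[𝓝 2] riemannZeta₀ := by
    filter_upwards [(hopen 1).mem_nhds (by simp : (2 : ℂ) ∈ {z : ℂ | 1 < z.re})] with z hz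
    have hz' : 1 < z.re := hz
    have h1 : z ≠ 1 := fun h ↦ by simp [h] at hz'
    have hzm : -(m : ℝ) < z.re := by
      have : (0 : ℝ) ≤ m := m.cast_nonneg
      linarith
    refine tendsto_nhds_unique (hlim z hzm) ?_
    rw [show riemannZeta₀ z = riemannZeta z - (z - 1)⁻¹ by simp [riemannZeta₀, h1]]
    exact (tendsto_tsum_powExp_of_one_lt_re hz').sub (tendsto_integral_powExp_of_one_lt_re hz')
  have hEq := AnalyticOnNhd.eqOn_of_preconnected_of_eventuallyEq (hτ.analyticOnNhd (hopen _))
    (differentiable_riemannZeta₀.differentiableOn.analyticOnNhd (hopen _)) hpre h2 heq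
  have hb : -(m : ℝ) < b.re := by linarith
  exact hEq hb ▸ hlim b hb

/-- The value of `∫ t in 0..∞, t ^ (-b) * exp (-t ^ a * x)`, continued meromorphically in `b`. -/
noncomputable def gammaTerm (a : ℝ) (b : ℂ) (x : ℝ) : ℂ :=
  (x : ℂ) ^ ((b - 1) / (a : ℂ)) / (a : ℂ) * Complex.Gamma ((1 - b) / (a : ℂ))

lemma integral_Ioi_zero_powExp {a x : ℝ} (ha : 0 < a) (hx : 0 < x) {b : ℂ} (hb : b.re < 1) :
    ∫ t in Ioi (0 : ℝ), powExp a b 0 x t = gammaTerm a b x := by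
  have h1 : ∫ t in Ioi (0 : ℝ), powExp a b 0 x t =
      mellin (fun t : ℝ ↦ (fun u : ℝ ↦ Complex.exp (-(x * u))) (t ^ a)) (1 - b) := by
    rw [mellin]
    refine setIntegral_congr_fun measurableSet_Ioi fun t _ ↦ ?_
    simp [powExp]
  rw [h1, mellin_comp_rpow (fun u : ℝ ↦ Complex.exp (-(x * u))), mellin]
  have hre : 0 < ((1 - b) / (a : ℂ)).re := by
    rw [Complex.div_ofReal_re]
    exact div_pos (by simpa using hb) ha
  simp only [smul_eq_mul]
  rw [Complex.integral_cpow_mul_exp_neg_mul_Ioi hre hx, abs_of_pos ha, gammaTerm]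
  have h2 : (1 / (x : ℂ)) ^ ((1 - b) / (a : ℂ)) = (x : ℂ) ^ ((b - 1) / (a : ℂ)) := by
    rw [one_div, Complex.inv_cpow _ _ (by
      rw [Complex.arg_ofReal_of_nonneg hx.le]
      exact Real.pi_ne_zero.symm), ← Complex.cpow_neg]
    congr 1
    ring
  rw [h2, Complex.real_smul]
  push_cast
  ring

lemma gammaTerm_eq {a x : ℝ} (ha : 0 < a) (hx : 0 < x) {b : ℂ} (hb : b ≠ 1) :
    (1 - b) * gammaTerm a b x = a * x * gammaTerm a (b - a) x := by
  have ha' : (a : ℂ) ≠ 0 := by exact_mod_cast ha.ne'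
  have hx' : (x : ℂ) ≠ 0 := by exact_mod_cast hx.ne'
  have h1 : (1 - (b - a)) / (a : ℂ) = (1 - b) / a + 1 := by
    field_simp
    ring
  have h2 : (b - 1) / (a : ℂ) = (b - a - 1) / a + 1 := by
    field_simp
    ring
  have h3 : (1 - b) / (a : ℂ) ≠ 0 := div_ne_zero (sub_ne_zero.2 hb.symm) ha'
  rw [gammaTerm, gammaTerm, h1, Complex.Gamma_add_one _ h3, h2, Complex.cpow_add _ _ hx',
    Complex.cpow_one]
  field_simp

lemma hasDerivAt_gammaTerm {a x : ℝ} (ha : 0 < a) (hx : 0 < x) {b : ℂ} (hb : b ≠ 1) :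
    HasDerivAt (gammaTerm a b) (-gammaTerm a (b - a) x) x := by
  have ha' : (a : ℂ) ≠ 0 := by exact_mod_cast ha.ne'
  have hx' : (x : ℂ) ≠ 0 := by exact_mod_cast hx.ne'
  have h3 : (b - 1) / (a : ℂ) ≠ 0 := div_ne_zero (sub_ne_zero.2 hb) ha'
  refine (((hasDerivAt_ofReal_cpow_const hx.ne' h3).div_const (a : ℂ)).mul_const
    (Complex.Gamma ((1 - b) / (a : ℂ)))).congr_deriv ?_
  have h := gammaTerm_eq ha hx hb
  rw [Complex.cpow_sub _ _ hx', Complex.cpow_one]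
  have h4 : gammaTerm a (b - a) x = (1 - b) * gammaTerm a b x / (a * x) := by
    rw [h]
    field_simp
  rw [h4, gammaTerm]
  field_simp
  ring

lemma integral_powExp_eq {a x : ℝ} (ha : 0 < a) (hx : 0 < x) (b : ℂ) :
    (1 - b) * ∫ t in Ioi (1 : ℝ), powExp a b 0 x t =
      a * x * (∫ t in Ioi (1 : ℝ), powExp a (b - a) 0 x t) - Real.exp (-x) := by
  have hint : ∀ c : ℂ, ∀ i, IntegrableOn (powExp a c i x) (Ioi 1) := fun c i ↦ by
    simpa [perBernoulli] using integrableOn_perBernoulli_mul_powExp ha hx 0 c i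
  have hshift : ∀ t ∈ Ioi (1 : ℝ), powExp a b 1 x t = x * powExp a (b - a) 0 x t := by
    intro t ht
    have ht0 : (0 : ℝ) < t := zero_lt_one.trans ht
    have ht' : (t : ℂ) ≠ 0 := by exact_mod_cast ht0.ne'
    simp only [powExp]
    rw [neg_sub, sub_eq_neg_add, Complex.cpow_add _ _ ht']
    push_cast [Complex.ofReal_cpow ht0.le]
    ring
  have h := integral_Ioi_of_hasDerivAt_of_tendsto (a := 1) (f := powExp a (b - 1) 0 x) (m := 0)
    (hasDerivAt_powExp one_pos _ _ _).continuousAt.continuousWithinAt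
    (fun t ht ↦ hasDerivAt_powExp (zero_lt_one.trans ht) _ _ _)
    (((hint _ _).const_mul _).sub ((hint _ _).const_mul _)) (tendsto_powExp_atTop ha hx _ _)
  rw [integral_sub ((hint _ _).const_mul _) ((hint _ _).const_mul _), integral_const_mul,
    integral_const_mul] at h
  simp only [sub_add_cancel, zero_add] at h
  rw [setIntegral_congr_fun measurableSet_Ioi hshift, integral_const_mul] at h
  have h1 : powExp a (b - 1) 0 x 1 = Real.exp (-x) := by simp [powExp]
  rw [h1] at h
  push_cast at h ⊢
  linear_combination h

lemma tendsto_integral_sub_gammaTerm_of_re_lt_one {a : ℝ} (ha : 0 < a) {b : ℂ} (hb : b.re < 1) :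
    Tendsto (fun x ↦ (∫ t in Ioi (1 : ℝ), powExp a b 0 x t) - gammaTerm a b x) (𝓝[>] 0)
      (𝓝 (b - 1)⁻¹) := by
  have hb1 : b - 1 ≠ 0 := fun h0 ↦ by
    rw [sub_eq_zero.1 h0] at hb
    simp at hb
  have hrpow : IntegrableOn (fun t : ℝ ↦ t ^ (-b.re)) (Ioc 0 1) := by
    rw [← intervalIntegrable_iff_integrableOn_Ioc_of_le zero_le_one]
    exact intervalIntegral.intervalIntegrable_rpow' (by linarith)
  have hmeas : ∀ x, AEStronglyMeasurable (powExp a b 0 x) (volume.restrict (Ioc 0 1)) := fun x ↦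
    ((continuousOn_powExp a b 0 x).mono Ioc_subset_Ioi_self).aestronglyMeasurable measurableSet_Ioc
  have hle : ∀ x, 0 < x → ∀ᵐ t ∂volume.restrict (Ioc (0 : ℝ) 1),
      ‖powExp a b 0 x t‖ ≤ t ^ (-b.re) := fun x hx ↦ by
    filter_upwards [ae_restrict_mem measurableSet_Ioc] with t ht
    simpa using norm_powExp_le (a := a) hx.le ht.1 b 0
  have hlim : Tendsto (fun x ↦ ∫ t in Ioc (0 : ℝ) 1, powExp a b 0 x t) (𝓝[>] 0)
      (𝓝 (∫ t in Ioc (0 : ℝ) 1, (t : ℂ) ^ (-b))) := by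
    refine tendsto_integral_filter_of_dominated_convergence (fun t ↦ t ^ (-b.re))
      (.of_forall hmeas) ?_ hrpow ?_
    · filter_upwards [self_mem_nhdsWithin] with x hx using hle x hx
    · exact .of_forall fun t ↦ by simpa using tendsto_powExp_zero a t b 0
  have hval : ∫ t in Ioc (0 : ℝ) 1, (t : ℂ) ^ (-b) = -(b - 1)⁻¹ := by
    rw [← intervalIntegral.integral_of_le zero_le_one, integral_cpow (Or.inl (by simpa using hb))]
    have h0 : -b + 1 ≠ 0 := by
      rw [neg_add_eq_sub, ← neg_sub]
      exact neg_ne_zero.2 hb1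
    rw [Complex.ofReal_zero, Complex.zero_cpow h0, Complex.ofReal_one, Complex.one_cpow, sub_zero,
      neg_add_eq_sub, ← neg_sub b 1, one_div, inv_neg]
  rw [hval] at hlim
  have hneg := hlim.neg
  rw [neg_neg] at hneg
  refine hneg.congr' ?_
  filter_upwards [self_mem_nhdsWithin] with x hx
  have hI1 : IntegrableOn (powExp a b 0 x) (Ioc 0 1) := Integrable.mono' hrpow (hmeas x) (hle x hx)
  have hI2 : IntegrableOn (powExp a b 0 x) (Ioi 1) := by
    simpa [perBernoulli] using integrableOn_perBernoulli_mul_powExp ha hx 0 b 0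
  rw [← integral_Ioi_zero_powExp ha hx hb, ← Ioc_union_Ioi_eq_Ioi zero_le_one,
    setIntegral_union Ioc_disjoint_Ioi_same measurableSet_Ioi hI1 hI2]
  ring

lemma tendsto_integral_sub_gammaTerm {a : ℝ} (ha : 0 < a) {b : ℂ}
    (hb : ∀ n : ℕ, b ≠ 1 + (a : ℂ) * n) :
    Tendsto (fun x ↦ (∫ t in Ioi (1 : ℝ), powExp a b 0 x t) - gammaTerm a b x) (𝓝[>] 0)
      (𝓝 (b - 1)⁻¹) := by
  obtain ⟨m, hm⟩ := exists_nat_gt ((b.re - 1) / a)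
  rw [div_lt_iff₀ ha] at hm
  induction m generalizing b with
  | zero => exact tendsto_integral_sub_gammaTerm_of_re_lt_one ha (by simpa using hm)
  | succ m ih =>
    have hb1 : b ≠ 1 := by simpa using hb 0
    have hb1' : 1 - b ≠ 0 := sub_ne_zero.2 hb1.symm
    have hprev := ih (b := b - a) (fun n h ↦ hb (n + 1) (by
      push_cast
      linear_combination h)) (by
        push_cast at hm
        simp
        linarith)
    have hx : Tendsto (fun x : ℝ ↦ (a : ℂ) * (x : ℂ)) (𝓝[>] 0) (𝓝 0) := by
      have : Continuous fun x : ℝ ↦ (a : ℂ) * (x : ℂ) := by fun_prop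
      simpa using (this.tendsto 0).mono_left (nhdsWithin_le_nhds (s := Ioi 0))
    have he : Tendsto (fun x : ℝ ↦ ((Real.exp (-x) : ℝ) : ℂ)) (𝓝[>] 0) (𝓝 1) := by
      have : Continuous fun x : ℝ ↦ ((Real.exp (-x) : ℝ) : ℂ) := by fun_prop
      simpa using (this.tendsto 0).mono_left (nhdsWithin_le_nhds (s := Ioi 0))
    have h := ((hx.mul hprev).sub he).const_mul (1 - b)⁻¹
    rw [zero_mul, zero_sub, mul_neg_one, ← inv_neg, neg_sub] at h
    refine h.congr' ?_
    filter_upwards [self_mem_nhdsWithin] with x hx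
    rw [inv_mul_eq_iff_eq_mul₀ hb1']
    linear_combination gammaTerm_eq ha hx hb1 - integral_powExp_eq ha hx b

/-- The leading asymptotics of the sum. -/
lemma tendsto_tsum_sub_gammaTerm {a : ℝ} (ha : 0 < a) {b : ℂ}
    (hb : ∀ n : ℕ, b ≠ 1 + (a : ℂ) * n) :
    Tendsto (fun x ↦ ∑' n : ℕ, powExp a b 0 x (n + 1) - gammaTerm a b x) (𝓝[>] 0)
      (𝓝 (riemannZeta b)) := by
  have h := (tendsto_tsum_sub_integral ha b).add (tendsto_integral_sub_gammaTerm ha hb)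
  rw [riemannZeta_eq_inv_sub_add (by simpa using hb 0), add_comm]
  exact h.congr fun x ↦ by ring

lemma hasDerivAt_tsum_powExp {a x : ℝ} (ha : 0 < a) (hx : 0 < x) (b : ℂ) :
    HasDerivAt (fun y ↦ ∑' n : ℕ, powExp a b 0 y (n + 1))
      (-∑' n : ℕ, powExp a (b - a) 0 x (n + 1)) x := by
  obtain ⟨C, hC⟩ := exists_norm_powExp_le ha (half_pos hx) (b - a) 0
  have hu : Summable fun n : ℕ ↦ C * ((n : ℝ) + 1) ^ (-2 : ℝ) := by
    have := (summable_nat_add_iff 1).2 (Real.summable_nat_rpow.2 (by norm_num : (-2 : ℝ) < -1))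
    exact Summable.mul_left C (by simpa using this)
  rw [← tsum_neg]
  refine hasDerivAt_tsum_of_isPreconnected hu (isOpen_Ioi (a := x / 2)) isPreconnected_Ioi
    (fun n y _ ↦ hasDerivAt_powExp_param a _ n.cast_add_one_pos b y) (fun n y hy ↦ ?_)
    (half_lt_self hx) (summable_powExp ha hx b 0) (half_lt_self hx)
  rw [norm_neg]
  exact hC y (le_of_lt hy) _ (by simp)

/-- A function vanishing at `0⁺` whose derivative is `o(x ^ N)` is `o(x ^ (N + 1))`. -/
lemma isLittleO_pow_succ_of_hasDerivAt {f f' : ℝ → ℂ} {N : ℕ}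
    (hf : ∀ x, 0 < x → HasDerivAt f (f' x) x) (h0 : Tendsto f (𝓝[>] 0) (𝓝 0))
    (hf' : f' =o[𝓝[>] 0] fun x ↦ x ^ N) : f =o[𝓝[>] 0] fun x ↦ x ^ (N + 1) := by
  refine isLittleO_iff.2 fun ε hε ↦ ?_
  obtain ⟨δ, hδ, hball⟩ := mem_nhdsGT_iff_exists_Ioo_subset.1 (isLittleO_iff.1 hf' hε)
  filter_upwards [Ioo_mem_nhdsGT hδ] with x hx
  have hlim : Tendsto (fun y ↦ ‖f x - f y‖) (𝓝[>] 0) (𝓝 ‖f x - 0‖) :=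
    (tendsto_const_nhds.sub h0).norm
  rw [sub_zero] at hlim
  refine le_of_tendsto hlim ?_
  filter_upwards [Ioo_mem_nhdsGT hx.1] with y hy
  have hpos : ∀ z ∈ Icc y x, 0 < z := fun z hz ↦ hy.1.trans_le hz.1
  have hmv := Convex.norm_image_sub_le_of_norm_hasDerivWithin_le (f := f) (f' := f')
    (C := ε * x ^ N) (fun z hz ↦ (hf z (hpos z hz)).hasDerivWithinAt) (fun z hz ↦ ?_)
    (convex_Icc y x) (left_mem_Icc.2 hy.2.le) (right_mem_Icc.2 hy.2.le)
  · refine hmv.trans ?_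
    have hxy : ‖x - y‖ ≤ x := by
      rw [Real.norm_of_nonneg (by linarith [hy.2])]
      linarith [hy.1]
    have hx0 : 0 < x := hx.1
    rw [Real.norm_of_nonneg (pow_nonneg hx0.le _), pow_succ, ← mul_assoc]
    gcongr
  · have hz0 := hpos z hz
    have hz1 : ‖f' z‖ ≤ ε * ‖z ^ N‖ := hball ⟨hz0, hz.2.trans_lt hx.2⟩
    refine hz1.trans ?_
    rw [Real.norm_of_nonneg (by positivity)]
    have := hz.2
    gcongr

lemma hasDerivAt_sum_zeta (a : ℝ) (b : ℂ) (N : ℕ) (x : ℝ) :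
    HasDerivAt (fun y : ℝ ↦ ∑ n ∈ Finset.range (N + 1), ((-(y : ℂ)) ^ n / (n.factorial : ℂ)) *
        riemannZeta (b - (a : ℂ) * n))
      (-∑ n ∈ Finset.range N, ((-(x : ℂ)) ^ n / (n.factorial : ℂ)) *
        riemannZeta (b - a - (a : ℂ) * n)) x := by
  simp only [Finset.sum_range_succ' _ N, pow_zero]
  rw [← Finset.sum_neg_distrib]
  have hterm : ∀ n ∈ Finset.range N, HasDerivAt
      (fun y : ℝ ↦ ((-(y : ℂ)) ^ (n + 1) / ((n + 1).factorial : ℂ)) *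
        riemannZeta (b - (a : ℂ) * (n + 1 : ℕ)))
      (-(((-(x : ℂ)) ^ n / (n.factorial : ℂ)) * riemannZeta (b - a - (a : ℂ) * n))) x := by
    intro n _
    have h1 : HasDerivAt (fun y : ℝ ↦ -(y : ℂ)) (-1) x := (Complex.ofRealCLM.hasDerivAt).neg
    refine (((h1.pow (n + 1)).div_const _).mul_const _).congr_deriv ?_
    have h2 : b - (a : ℂ) * (n + 1 : ℕ) = b - a - a * n := by
      push_cast
      ring
    have h3 : (n.factorial : ℂ) ≠ 0 := by exact_mod_cast n.factorial_ne_zero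
    have h4 : (n : ℂ) + 1 ≠ 0 := by exact_mod_cast n.succ_ne_zero
    rw [h2, Nat.factorial_succ]
    push_cast
    field_simp
  exact (HasDerivAt.fun_sum hterm).add_const _

lemma tsum_powExp_sub_isLittleO {a : ℝ} (ha : 0 < a) {b : ℂ}
    (hb : ∀ n : ℕ, b ≠ 1 + (a : ℂ) * n) (N : ℕ) :
    (fun x : ℝ ↦ ∑' n : ℕ, powExp a b 0 x (n + 1) - gammaTerm a b x -
      ∑ n ∈ Finset.range (N + 1), ((-(x : ℂ)) ^ n / (n.factorial : ℂ)) *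
        riemannZeta (b - (a : ℂ) * n)) =o[𝓝[>] 0] fun x : ℝ ↦ x ^ N := by
  induction N generalizing b with
  | zero =>
    simp only [pow_zero, isLittleO_one_iff]
    simpa using (tendsto_tsum_sub_gammaTerm ha hb).sub_const (riemannZeta b)
  | succ N ih =>
    have hb1 : b ≠ 1 := by simpa using hb 0
    have hprev := ih (b := b - a) fun n h ↦ hb (n + 1) (by
      push_cast
      linear_combination h)
    refine isLittleO_pow_succ_of_hasDerivAt (fun x hx ↦ ((hasDerivAt_tsum_powExp ha hx b).sub
      (hasDerivAt_gammaTerm ha hx hb1)).sub (hasDerivAt_sum_zeta a b (N + 1) x)) ?_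
      (hprev.neg_left.congr_left fun x ↦ by ring)
    have hsum : Tendsto (fun x : ℝ ↦ ∑ n ∈ Finset.range (N + 1 + 1),
        ((-(x : ℂ)) ^ n / (n.factorial : ℂ)) * riemannZeta (b - (a : ℂ) * n)) (𝓝[>] 0)
        (𝓝 (riemannZeta b)) := by
      have h := (hasDerivAt_sum_zeta a b (N + 1) 0).continuousAt.tendsto.mono_left
        (nhdsWithin_le_nhds (s := Ioi 0))
      simpa [Finset.sum_range_succ' _ (N + 1)] using h
    simpa using (tendsto_tsum_sub_gammaTerm ha hb).sub hsum

end PowExp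

/-- asymptotics of `∑_{n≥1} e^{-nᵃ x}/n^b` when `b ≠ 1 + a n`. -/
theorem sum_exp_pow_asymp (a : ℝ) (b : ℂ) (ha : 0 < a)
    (hb : ∀ n : ℕ, b ≠ 1 + (a : ℂ) * n) (N : ℕ) :
    (fun x : ℝ =>
      (∑' n : ℕ, Complex.exp (-((((n + 1 : ℕ) : ℝ) ^ a * x : ℝ) : ℂ)) /
        ((n + 1 : ℕ) : ℂ) ^ b) -
      ((x : ℂ) ^ ((b - 1) / (a : ℂ)) / (a : ℂ) * Complex.Gamma ((1 - b) / (a : ℂ)) +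
        ∑ n ∈ Finset.range (N + 1), ((-(x : ℂ)) ^ n / (n.factorial : ℂ)) *
          riemannZeta (b - (a : ℂ) * n))) =o[nhdsWithin 0 (Set.Ioi 0)]
    fun x : ℝ => x ^ N := by
  refine (tsum_powExp_sub_isLittleO ha hb N).congr_left fun x ↦ ?_
  rw [sub_sub, gammaTerm]
  congr 1
  refine tsum_congr fun n ↦ ?_
  simp [powExp, Complex.cpow_neg, div_eq_mul_inv, mul_comm]
end

section
/- Let $a > 0$, $\alpha \in \mathbb{C} \setminus \{0\}$, $b \in \mathbb{C}$ with $an \neq b-1$ and $an \neq b-1-\alpha$ for all nonnegative integers $n$. Then for every natural number $N$, as $x \to 0^+$: $\sum_{n=1}^{\infty} \frac{\sigma_\alpha(n)}{n^b} e^{-n^a x} = \frac{x^{(b-1)/a}}{a}\Gamma\left(\frac{1-b}{a}\right)\zeta(1-\alpha) + \frac{x^{(b-1-\alpha)/a}}{a}\Gamma\left(\frac{1-b+\alpha}{a}\right)\zeta(1+\alpha) + \sum_{n=0}^{N} \frac{(-x)^n}{n!}\zeta(b-an)\zeta(b-an-\alpha) + o(x^N)$. -/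
open Complex Real Filter Asymptotics

/-- The generalized divisor function `σ_α(n) = ∑_{d ∣ n} d^α` for complex `α`. -/
noncomputable def sigmaC (α : ℂ) (n : ℕ) : ℂ := ∑ d ∈ n.divisors, (d : ℂ) ^ α

open MeasureTheory Topology

/-- The falling factorial `w (w - 1) ⋯ (w - j + 1)`. -/
noncomputable def fallingFactorial (w : ℂ) (j : ℕ) : ℂ := ∏ i ∈ Finset.range j, (w - i)

lemma fallingFactorial_succ_left (w : ℂ) (j : ℕ) :
    fallingFactorial w (j + 1) = w * fallingFactorial (w - 1) j := by
  rw [fallingFactorial, fallingFactorial, Finset.prod_range_succ', mul_comm]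
  congr 1
  · simp
  · refine Finset.prod_congr rfl fun i _ => ?_
    push_cast
    ring

lemma fallingFactorial_succ_right (w : ℂ) (j : ℕ) :
    fallingFactorial w (j + 1) = fallingFactorial w j * (w - j) :=
  Finset.prod_range_succ _ _

/-- The remainder after `K` terms of the Taylor expansion at `n` of `t ↦ t ^ w`. -/
noncomputable def cpowTaylorRemainder (K : ℕ) (n : ℝ) (w : ℂ) (t : ℝ) : ℂ :=
  (t : ℂ) ^ w - ∑ j ∈ Finset.range K,
    fallingFactorial w j / (j.factorial : ℂ) * (n : ℂ) ^ (w - j) * ((t - n : ℝ) : ℂ) ^ j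

lemma hasDerivAt_cpowTaylorRemainder (K : ℕ) (n : ℝ) (w : ℂ) {t : ℝ} (ht : 0 < t) :
    HasDerivAt (cpowTaylorRemainder (K + 1) n w) (w * cpowTaylorRemainder K n (w - 1) t) t := by
  have h1 : HasDerivAt (fun t : ℝ => (t : ℂ) ^ w) (w * (t : ℂ) ^ (w - 1)) t := by
    have := ((hasDerivAt_id (t : ℂ)).cpow_const (c := w) (Or.inl (by simpa using ht))).comp_ofReal
    simpa using this
  have h2 : ∀ j ∈ Finset.range (K + 1), HasDerivAt (fun t : ℝ =>
      fallingFactorial w j / (j.factorial : ℂ) * (n : ℂ) ^ (w - j) * ((t - n : ℝ) : ℂ) ^ j)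
      (fallingFactorial w j / (j.factorial : ℂ) * (n : ℂ) ^ (w - j) *
        (j * ((t - n : ℝ) : ℂ) ^ (j - 1))) t := by
    intro j _
    have h3 : HasDerivAt (fun t : ℝ => ((t - n : ℝ) : ℂ)) 1 t := by
      simpa using ((hasDerivAt_id t).sub_const n).ofReal_comp
    simpa using (h3.pow j).const_mul
      (fallingFactorial w j / (j.factorial : ℂ) * (n : ℂ) ^ (w - j))
  have h3 := h1.sub (HasDerivAt.fun_sum h2)
  convert! h3 using 1
  rw [Finset.sum_range_succ', cpowTaylorRemainder, mul_sub, Finset.mul_sum]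
  simp only [Nat.cast_zero, zero_mul, mul_zero, add_zero]
  congr 1
  refine Finset.sum_congr rfl fun j _ => ?_
  have hj : (j.factorial : ℂ) ≠ 0 := by exact_mod_cast j.factorial_ne_zero
  have hj' : (j : ℂ) + 1 ≠ 0 := by exact_mod_cast j.succ_ne_zero
  rw [fallingFactorial_succ_left, Nat.factorial_succ]
  push_cast
  rw [show w - 1 - (j : ℂ) = w - (j + 1) by ring]
  field_simp

lemma cpowTaylorRemainder_self (K : ℕ) (n : ℝ) (w : ℂ) :
    cpowTaylorRemainder (K + 1) n w n = 0 := by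
  simp [cpowTaylorRemainder, Finset.sum_range_succ', fallingFactorial]

lemma norm_cpowTaylorRemainder_le (K : ℕ) {n : ℝ} (hn : 0 < n) (w : ℂ) (hw : w.re ≤ K) {t : ℝ}
    (ht : t ∈ Set.Icc n (n + 1)) :
    ‖cpowTaylorRemainder K n w t‖ ≤ ‖fallingFactorial w K‖ * n ^ (w.re - K) := by
  induction K generalizing w t with
  | zero =>
    have h0 : 0 < t := hn.trans_le ht.1
    simp only [cpowTaylorRemainder, Finset.range_zero, Finset.sum_empty, sub_zero, fallingFactorial,
      Finset.prod_empty, norm_one, one_mul, Nat.cast_zero]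
    rw [Complex.norm_cpow_eq_rpow_re_of_pos h0]
    exact Real.rpow_le_rpow_of_nonpos hn ht.1 (by simpa using hw)
  | succ K ih =>
    have key := norm_image_sub_le_of_norm_deriv_le_segment' (a := n) (b := n + 1)
      (f := cpowTaylorRemainder (K + 1) n w)
      (f' := fun t => w * cpowTaylorRemainder K n (w - 1) t)
      (C := ‖w‖ * (‖fallingFactorial (w - 1) K‖ * n ^ ((w - 1).re - K)))
      (fun x hx => (hasDerivAt_cpowTaylorRemainder K n w (hn.trans_le hx.1)).hasDerivWithinAt)
      (fun x hx => by
        rw [norm_mul]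
        gcongr
        refine ih (w - 1) ?_ ⟨hx.1, hx.2.le⟩
        push_cast at hw
        simp only [sub_re, one_re]
        linarith) t ht
    rw [cpowTaylorRemainder_self, sub_zero] at key
    refine key.trans ?_
    rw [fallingFactorial_succ_left, norm_mul,
      show w.re - (K + 1 : ℕ) = (w - 1).re - K by push_cast; simp; ring]
    simp only [mul_assoc]
    gcongr
    exact mul_le_of_le_one_right (by positivity) (by linarith [ht.2])

/-- The entire function `s ↦ (s - 1) * ζ(s)`. -/
noncomputable def zetaEntire : ℂ → ℂ := Function.update (fun s => (s - 1) * riemannZeta s) 1 1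

lemma zetaEntire_of_ne {s : ℂ} (hs : s ≠ 1) : zetaEntire s = (s - 1) * riemannZeta s :=
  Function.update_of_ne hs _ _

lemma differentiable_zetaEntire : Differentiable ℂ zetaEntire := by
  rw [← differentiableOn_univ,
    ← Complex.differentiableOn_compl_singleton_and_continuousAt_iff (c := 1) Filter.univ_mem]
  constructor
  · refine DifferentiableOn.congr (f := fun s => (s - 1) * riemannZeta s) ?_ ?_
    · intro s hs
      exact ((differentiableAt_id.sub_const 1).mul
        (differentiableAt_riemannZeta (by simpa using hs))).differentiableWithinAt
    · intro s hs
      exact zetaEntire_of_ne (by simpa using hs)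
  · exact continuousAt_update_same.mpr riemannZeta_residue_one

/-- The correction term in the recursion for `zetaEntire`. -/
noncomputable def zetaRemainder (M : ℕ) (s : ℂ) : ℂ :=
  ∑' n : ℕ, cpowTaylorRemainder (M + 1) (n + 1) (1 - s) (n + 2)

lemma norm_zetaRemainder_term_le (M n : ℕ) {s : ℂ} (hs : -(M : ℝ) ≤ s.re) :
    ‖cpowTaylorRemainder (M + 1) (n + 1) (1 - s) (n + 2)‖ ≤
      ‖fallingFactorial (1 - s) (M + 1)‖ * ((n : ℝ) + 1) ^ (-(s.re + M)) := by
  have := norm_cpowTaylorRemainder_le (M + 1) (n := n + 1) (by positivity) (1 - s)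
    (by push_cast; simp; linarith) (t := n + 2) ⟨by linarith, by linarith⟩
  convert this using 3
  push_cast; simp; ring

lemma summable_succ_rpow_neg {p : ℝ} (hp : 1 < p) :
    Summable fun n : ℕ => ((n : ℝ) + 1) ^ (-p) := by
  have := (summable_nat_add_iff 1).mpr (Real.summable_nat_rpow (p := -p).mpr (by linarith))
  simpa using this

lemma continuous_fallingFactorial (j : ℕ) : Continuous fun s : ℂ => fallingFactorial (1 - s) j := by
  unfold fallingFactorial
  fun_prop

lemma differentiable_fallingFactorial (j : ℕ) :
    Differentiable ℂ fun s : ℂ => fallingFactorial (1 - s) j := by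
  unfold fallingFactorial
  fun_prop

lemma differentiableOn_zetaRemainder (M : ℕ) :
    DifferentiableOn ℂ (zetaRemainder M) {s | 1 - (M : ℝ) < s.re} := by
  intro s₀ hs₀
  simp only [Set.mem_ofPred_eq] at hs₀
  obtain ⟨σ, hσ1, hσ2⟩ := exists_between hs₀
  obtain ⟨B, hB⟩ := (isCompact_closedBall (0 : ℂ) (‖s₀‖ + 1)).exists_bound_of_continuousOn
    (continuous_fallingFactorial (M + 1)).continuousOn
  let U : Set ℂ := {s | σ < s.re} ∩ Metric.ball 0 (‖s₀‖ + 1)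
  have hU : IsOpen U := (isOpen_lt continuous_const continuous_re).inter Metric.isOpen_ball
  have hs₀U : s₀ ∈ U := ⟨hσ2, by simp⟩
  have hd : DifferentiableOn ℂ (zetaRemainder M) U := by
    refine differentiableOn_tsum_of_summable_norm
      (u := fun n : ℕ => B * ((n : ℝ) + 1) ^ (-(σ + M)))
      ((summable_succ_rpow_neg (by linarith)).mul_left _) (fun n => ?_) hU (fun n s hs => ?_)
    · have h1 : ((n : ℂ) + 1) ≠ 0 := by exact_mod_cast n.succ_ne_zero
      have h2 : ((n : ℂ) + 2) ≠ 0 := by exact_mod_cast (n + 1).succ_ne_zero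
      have := differentiable_fallingFactorial
      refine Differentiable.differentiableOn ?_
      unfold cpowTaylorRemainder
      push_cast
      refine Differentiable.sub ?_ (Differentiable.fun_sum fun j _ => ?_)
      · intro s
        refine DifferentiableAt.const_cpow (by fun_prop) (Or.inl h2)
      · refine Differentiable.mul_const (Differentiable.mul ((this j).div_const _) ?_) _
        intro s
        refine DifferentiableAt.const_cpow (by fun_prop) (Or.inl h1)
    · refine (norm_zetaRemainder_term_le M n (by linarith [hs.1.out])).trans ?_
      gcongr
      · exact (norm_nonneg _).trans (hB s (Metric.ball_subset_closedBall hs.2))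
      · exact hB s (Metric.ball_subset_closedBall hs.2)
      · linarith
      · exact hs.1.out.le
  exact (hd.differentiableAt (hU.mem_nhds hs₀U)).differentiableWithinAt

lemma hasSum_riemannZeta {s : ℂ} (hs : 1 < s.re) :
    HasSum (fun n : ℕ => ((n : ℂ) + 1) ^ (-s)) (riemannZeta s) := by
  rw [zeta_eq_tsum_one_div_nat_add_one_cpow hs]
  have := (summable_nat_add_iff 1).mpr (Complex.summable_one_div_nat_cpow.mpr hs)
  simpa [Complex.cpow_neg] using this.hasSum

lemma hasSum_cpow_sub {s : ℂ} (hs : 1 < s.re) :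
    HasSum (fun n : ℕ => ((n : ℂ) + 2) ^ (1 - s) - ((n : ℂ) + 1) ^ (1 - s)) (-1) := by
  have hlim : Tendsto (fun n : ℕ => ((n : ℂ) + 1) ^ (1 - s)) atTop (nhds 0) := by
    rw [tendsto_zero_iff_norm_tendsto_zero]
    have h1 : ∀ n : ℕ, ‖((n : ℂ) + 1) ^ (1 - s)‖ = ((n : ℝ) + 1) ^ (-(s.re - 1)) := by
      intro n
      have := Complex.norm_cpow_eq_rpow_re_of_pos (x := (n : ℝ) + 1) (by positivity) (1 - s)
      push_cast at this
      rw [this]; simp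
    simp_rw [h1]
    exact (tendsto_rpow_neg_atTop (by linarith)).comp
      (tendsto_natCast_atTop_atTop.atTop_add tendsto_const_nhds)
  have hsum : Summable (fun n : ℕ => ((n : ℂ) + 2) ^ (1 - s) - ((n : ℂ) + 1) ^ (1 - s)) := by
    refine Summable.of_norm_bounded (g := fun n : ℕ => ‖fallingFactorial (1 - s) 1‖ *
      ((n : ℝ) + 1) ^ (-s.re)) ((summable_succ_rpow_neg hs).mul_left _) fun n => ?_
    have := norm_zetaRemainder_term_le 0 n (s := s) (by simp; linarith)
    simpa [cpowTaylorRemainder, fallingFactorial] using this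
  rw [hsum.hasSum_iff_tendsto_nat]
  have := fun N : ℕ => Finset.sum_range_sub (fun n : ℕ => ((n : ℂ) + 1) ^ (1 - s)) N
  push_cast at this
  simp_rw [add_assoc, one_add_one_eq_two] at this
  simp_rw [this]
  simpa using hlim.sub_const 1

lemma zetaRemainder_eq_of_one_lt_re (M : ℕ) {s : ℂ} (hs : 1 < s.re) :
    zetaRemainder M s = -1 + ∑ i ∈ Finset.range M,
      fallingFactorial (1 - s) i / ((i + 1).factorial : ℂ) * zetaEntire (s + i) := by
  have h1 : ∀ i ∈ Finset.range M, HasSum (fun n : ℕ =>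
      fallingFactorial (1 - s) (i + 1) / ((i + 1).factorial : ℂ) *
        ((n : ℂ) + 1) ^ (-(s + i))) (fallingFactorial (1 - s) (i + 1) / ((i + 1).factorial : ℂ) *
          riemannZeta (s + i)) := fun i _ =>
    (hasSum_riemannZeta (by simp; linarith [(Nat.cast_nonneg i : (0 : ℝ) ≤ i)])).mul_left _
  have h2 := (hasSum_cpow_sub hs).sub (hasSum_sum h1)
  have h3 : (fun n : ℕ => cpowTaylorRemainder (M + 1) (n + 1) (1 - s) (n + 2)) = fun n : ℕ =>
      ((n : ℂ) + 2) ^ (1 - s) - ((n : ℂ) + 1) ^ (1 - s) - ∑ i ∈ Finset.range M,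
      fallingFactorial (1 - s) (i + 1) / ((i + 1).factorial : ℂ) *
        ((n : ℂ) + 1) ^ (-(s + i)) := by
    ext n
    rw [cpowTaylorRemainder, Finset.sum_range_succ']
    push_cast
    have e1 : ((n : ℂ) + 2 - (n + 1)) = 1 := by ring
    simp only [e1, one_pow, mul_one, sub_zero, Nat.factorial_zero, Nat.cast_one, div_one,
      fallingFactorial, Finset.range_zero, Finset.prod_empty, one_mul]
    have e2 : ∀ i : ℕ, 1 - s - ((i : ℂ) + 1) = -(s + i) := fun i => by ring
    simp only [e2]
    ring
  rw [zetaRemainder, h3, h2.tsum_eq, sub_eq_add_neg, ← Finset.sum_neg_distrib]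
  congr 1
  refine Finset.sum_congr rfl fun i _ => ?_
  rw [zetaEntire_of_ne, fallingFactorial_succ_right]
  · ring
  · intro h
    have := congrArg Complex.re h
    simp at this
    linarith [(Nat.cast_nonneg i : (0 : ℝ) ≤ i)]

lemma zetaRemainder_eq (M : ℕ) {s : ℂ} (hs : 1 - (M : ℝ) < s.re) :
    zetaRemainder M s = -1 + ∑ i ∈ Finset.range M,
      fallingFactorial (1 - s) i / ((i + 1).factorial : ℂ) * zetaEntire (s + i) := by
  have hopen : ∀ c : ℝ, IsOpen {s : ℂ | c < s.re} := fun c =>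
    isOpen_lt continuous_const continuous_re
  have hd : Differentiable ℂ fun s => -1 + ∑ i ∈ Finset.range M,
      fallingFactorial (1 - s) i / ((i + 1).factorial : ℂ) * zetaEntire (s + i) := by
    refine (Differentiable.fun_sum fun i _ => ?_).const_add _
    exact ((differentiable_fallingFactorial i).div_const _).mul
      (differentiable_zetaEntire.comp (differentiable_id.add_const _))
  refine AnalyticOnNhd.eqOn_of_preconnected_of_eventuallyEq
    ((differentiableOn_zetaRemainder M).analyticOnNhd (hopen _))
    (hd.differentiableOn.analyticOnNhd (hopen _))
    (convex_halfSpace_re_gt _).isPreconnected (z₀ := 2) ?_ ?_ hs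
  · simp; linarith [(Nat.cast_nonneg M : (0 : ℝ) ≤ M)]
  · filter_upwards [(hopen 1).mem_nhds (by simp : (1 : ℝ) < (2 : ℂ).re)] with z hz
    exact zetaRemainder_eq_of_one_lt_re M hz

/-- `f` grows at most polynomially on the half-plane `σ ≤ re s`. -/
def PolyGrowth (σ : ℝ) (f : ℂ → ℂ) : Prop :=
  ∃ (C : ℝ) (A : ℕ), ∀ s : ℂ, σ ≤ s.re → ‖f s‖ ≤ C * (1 + ‖s‖) ^ A

namespace PolyGrowth

variable {σ : ℝ} {f g : ℂ → ℂ}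

lemma exists_nonneg (hf : PolyGrowth σ f) :
    ∃ (C : ℝ) (A : ℕ), 0 ≤ C ∧ ∀ s : ℂ, σ ≤ s.re → ‖f s‖ ≤ C * (1 + ‖s‖) ^ A := by
  obtain ⟨C, A, h⟩ := hf
  exact ⟨|C|, A, abs_nonneg C, fun s hs => (h s hs).trans (by gcongr; exact le_abs_self C)⟩

lemma of_norm_le (hf : PolyGrowth σ f) (h : ∀ s : ℂ, σ ≤ s.re → ‖g s‖ ≤ ‖f s‖) :
    PolyGrowth σ g := by
  obtain ⟨C, A, hC⟩ := hf
  exact ⟨C, A, fun s hs => (h s hs).trans (hC s hs)⟩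

lemma const (c : ℂ) : PolyGrowth σ fun _ => c := ⟨‖c‖, 0, by simp⟩

lemma id : PolyGrowth σ fun s => s := ⟨1, 1, fun s _ => by simp⟩

lemma add (hf : PolyGrowth σ f) (hg : PolyGrowth σ g) : PolyGrowth σ fun s => f s + g s := by
  obtain ⟨C, A, hC, h⟩ := hf.exists_nonneg
  obtain ⟨D, B, hD, k⟩ := hg.exists_nonneg
  refine ⟨C + D, A + B, fun s hs => (norm_add_le _ _).trans ?_⟩
  have h1 : (1 : ℝ) ≤ 1 + ‖s‖ := by linarith [norm_nonneg s]
  calc ‖f s‖ + ‖g s‖ ≤ C * (1 + ‖s‖) ^ A + D * (1 + ‖s‖) ^ B := add_le_add (h s hs) (k s hs)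
    _ ≤ C * (1 + ‖s‖) ^ (A + B) + D * (1 + ‖s‖) ^ (A + B) := by
        gcongr <;> first | exact h1 | omega
    _ = (C + D) * (1 + ‖s‖) ^ (A + B) := by ring

lemma mul (hf : PolyGrowth σ f) (hg : PolyGrowth σ g) : PolyGrowth σ fun s => f s * g s := by
  obtain ⟨C, A, hC, h⟩ := hf.exists_nonneg
  obtain ⟨D, B, hD, k⟩ := hg.exists_nonneg
  refine ⟨C * D, A + B, fun s hs => ?_⟩
  rw [norm_mul]
  calc ‖f s‖ * ‖g s‖ ≤ (C * (1 + ‖s‖) ^ A) * (D * (1 + ‖s‖) ^ B) := by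
        gcongr; exacts [h s hs, k s hs]
    _ = C * D * (1 + ‖s‖) ^ (A + B) := by ring

lemma sum {ι : Type*} {f : ι → ℂ → ℂ} (S : Finset ι) (h : ∀ i ∈ S, PolyGrowth σ (f i)) :
    PolyGrowth σ fun s => ∑ i ∈ S, f i s := by
  induction S using Finset.cons_induction with
  | empty => simpa using const 0
  | cons i S hi ih =>
    simp only [Finset.sum_cons]
    exact (h i (by simp)).add (ih fun j hj => h j (by simp [hj]))

lemma comp_affine {τ : ℝ} (hf : PolyGrowth σ f) (a b : ℂ)
    (h : ∀ s : ℂ, τ ≤ s.re → σ ≤ (a * s + b).re) : PolyGrowth τ fun s => f (a * s + b) := by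
  obtain ⟨C, A, hC, k⟩ := hf.exists_nonneg
  refine ⟨C * (1 + ‖a‖ + ‖b‖) ^ A, A, fun s hs => (k _ (h s hs)).trans ?_⟩
  rw [mul_assoc, ← mul_pow]
  gcongr
  have : ‖a * s + b‖ ≤ ‖a‖ * ‖s‖ + ‖b‖ := (norm_add_le _ _).trans (by rw [norm_mul])
  nlinarith [norm_nonneg a, norm_nonneg b, norm_nonneg s,
    mul_nonneg (norm_nonneg b) (norm_nonneg s)]

lemma fallingFactorial (j : ℕ) : PolyGrowth σ fun s => fallingFactorial (1 - s) j := by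
  induction j with
  | zero => simpa [_root_.fallingFactorial] using const 1
  | succ j ih =>
    simp only [fallingFactorial_succ_right]
    refine ih.mul (((const (1 - j)).add ((const (-1)).mul id)).of_norm_le fun s _ => le_of_eq ?_)
    congr 1
    ring

lemma zetaRemainder (M : ℕ) : PolyGrowth (2 - M) (zetaRemainder M) := by
  have hs2 := summable_succ_rpow_neg one_lt_two
  refine ((const ((∑' n : ℕ, ((n : ℝ) + 1) ^ (-2 : ℝ) : ℝ) : ℂ)).mul
    (fallingFactorial (M + 1))).of_norm_le fun s hs => ?_
  have hb : ∀ n : ℕ, ‖cpowTaylorRemainder (M + 1) (n + 1) (1 - s) (n + 2)‖ ≤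
      ‖_root_.fallingFactorial (1 - s) (M + 1)‖ * ((n : ℝ) + 1) ^ (-2 : ℝ) := fun n => by
    refine (norm_zetaRemainder_term_le M n (by linarith)).trans ?_
    gcongr
    · linarith [(Nat.cast_nonneg n : (0 : ℝ) ≤ n)]
    · linarith
  have := tsum_of_norm_bounded (hs2.hasSum.mul_left _) hb
  rw [norm_mul, mul_comm, Complex.norm_real,
    Real.norm_of_nonneg (tsum_nonneg fun n => by positivity)]
  exact this

lemma zetaEntire_two_sub (M : ℕ) : PolyGrowth (2 - M) zetaEntire := by
  induction M with
  | zero =>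
    have hs2 := summable_succ_rpow_neg one_lt_two
    refine ((const ((∑' n : ℕ, ((n : ℝ) + 1) ^ (-2 : ℝ) : ℝ) : ℂ)).mul
      (id.add (const (-1)))).of_norm_le fun s hs => ?_
    have hs' : 2 ≤ s.re := by simpa using hs
    rw [zetaEntire_of_ne (fun h => by rw [h] at hs'; norm_num at hs'), norm_mul, norm_mul, mul_comm,
      ← sub_eq_add_neg, Complex.norm_real,
      Real.norm_of_nonneg (tsum_nonneg fun n => by positivity)]
    gcongr
    rw [← (hasSum_riemannZeta (s := s) (by linarith)).tsum_eq]
    refine tsum_of_norm_bounded hs2.hasSum fun n => ?_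
    have := Complex.norm_cpow_eq_rpow_re_of_pos (x := (n : ℝ) + 1) (by positivity) (-s)
    push_cast at this
    rw [this]
    gcongr
    · linarith [(Nat.cast_nonneg n : (0 : ℝ) ≤ n)]
    · simpa using hs'
  | succ M ih =>
    have h1 : PolyGrowth (2 - (M + 1 : ℕ)) fun s => ∑ i ∈ Finset.range M,
        _root_.fallingFactorial (1 - s) (i + 1) / ((i + 1 + 1).factorial : ℂ) *
          zetaEntire (s + (i + 1 : ℕ)) := by
      refine sum _ fun i _ => PolyGrowth.mul ?_ ?_
      · simpa only [div_eq_mul_inv] using (fallingFactorial (i + 1)).mul (const _)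
      · have := ih.comp_affine (τ := 2 - (M + 1 : ℕ)) 1 (i + 1 : ℕ) fun s hs => by
          push_cast at hs ⊢
          simp
          linarith [(Nat.cast_nonneg i : (0 : ℝ) ≤ i)]
        simpa only [one_mul] using this
    refine ((const 1).add ((zetaRemainder (M + 1)).add ((const (-1)).mul h1))).of_norm_le
      fun s hs => le_of_eq ?_
    have := zetaRemainder_eq (M + 1) (s := s) (by linarith)
    rw [Finset.sum_range_succ'] at this
    rw [this]
    congr 1
    simp [_root_.fallingFactorial]
    ring

lemma zetaEntire (σ : ℝ) : PolyGrowth σ zetaEntire := by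
  obtain ⟨M, hM⟩ := exists_nat_ge (2 - σ)
  obtain ⟨C, A, h⟩ := zetaEntire_two_sub M
  exact ⟨C, A, fun s hs => h s (by linarith)⟩

end PolyGrowth

lemma norm_Gamma_le {s : ℂ} (hs : 0 < s.re) : ‖Complex.Gamma s‖ ≤ Real.Gamma s.re := by
  rw [Complex.Gamma_eq_integral hs, Real.Gamma_eq_integral hs, Complex.GammaIntegral]
  refine (MeasureTheory.norm_integral_le_integral_norm _).trans_eq ?_
  refine MeasureTheory.setIntegral_congr_fun measurableSet_Ioi fun x hx => ?_
  simp only [norm_mul, Complex.norm_real]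
  rw [Complex.norm_cpow_eq_rpow_re_of_pos hx, Real.norm_of_nonneg (Real.exp_nonneg _)]
  simp

lemma Gamma_add_nat (m : ℕ) (s : ℂ) (h : ∀ i < m, s + i ≠ 0) :
    Complex.Gamma (s + m) = (∏ i ∈ Finset.range m, (s + i)) * Complex.Gamma s := by
  induction m with
  | zero => simp
  | succ m ih =>
    rw [Nat.cast_succ, ← add_assoc, Complex.Gamma_add_one _ (h m (by omega)),
      ih fun i hi => h i (by omega), Finset.prod_range_succ]
    ring

lemma exists_norm_Gamma_mul_pow_le (c' c : ℝ) (k : ℕ) :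
    ∃ C : ℝ, 0 ≤ C ∧ ∀ s : ℂ, c' ≤ s.re → s.re ≤ c → 1 ≤ |s.im| →
      ‖Complex.Gamma s‖ * |s.im| ^ k ≤ C := by
  obtain ⟨m, hm⟩ := exists_nat_ge (max (k : ℝ) (1 - c'))
  have hkm : k ≤ m := by exact_mod_cast (le_max_left _ _).trans hm
  have hm' : 1 - c' ≤ m := (le_max_right _ _).trans hm
  obtain ⟨C, hC⟩ := (isCompact_Icc (a := c' + m) (b := c + m)).exists_bound_of_continuousOn
    (f := Real.Gamma) fun x hx => (Real.differentiableAt_Gamma fun j hj => by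
      linarith [hx.1, (Nat.cast_nonneg j : (0 : ℝ) ≤ j)]).continuousAt.continuousWithinAt
  refine ⟨|C|, abs_nonneg C, fun s h1 h2 h3 => ?_⟩
  have hne : ∀ i < m, s + i ≠ 0 := fun i _ h => by
    have := congrArg Complex.im h
    simp only [add_im, natCast_im, add_zero, zero_im] at this
    rw [this] at h3
    norm_num at h3
  have hG := norm_Gamma_le (s := s + m) (by simp; linarith)
  rw [Gamma_add_nat m s hne, norm_mul, norm_prod] at hG
  have hP : |s.im| ^ k ≤ ∏ i ∈ Finset.range m, ‖s + i‖ := by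
    calc |s.im| ^ k ≤ |s.im| ^ m := pow_le_pow_right₀ h3 hkm
      _ = ∏ i ∈ Finset.range m, |s.im| := by simp
      _ ≤ _ := Finset.prod_le_prod (fun _ _ => abs_nonneg _) fun i _ => by
          simpa using Complex.abs_im_le_norm (s + i)
  calc ‖Complex.Gamma s‖ * |s.im| ^ k ≤ ‖Complex.Gamma s‖ * ∏ i ∈ Finset.range m, ‖s + i‖ := by
        gcongr
    _ ≤ Real.Gamma (s + m).re := by rwa [mul_comm]
    _ ≤ |C| := (le_abs_self _).trans ((hC _ ⟨by simpa using h1, by simpa using h2⟩).trans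
        (le_abs_self C))

/-- `f` decays at least quadratically on the vertical strip `c' ≤ re s ≤ c`. -/
def VerticalDecay (c' c : ℝ) (f : ℂ → ℂ) : Prop :=
  ∃ C T : ℝ, ∀ s : ℂ, c' ≤ s.re → s.re ≤ c → T ≤ |s.im| → ‖f s‖ ≤ C / s.im ^ 2

namespace VerticalDecay

variable {c' c : ℝ} {f g : ℂ → ℂ}

lemma add (hf : VerticalDecay c' c f) (hg : VerticalDecay c' c g) :
    VerticalDecay c' c fun s => f s + g s := by
  obtain ⟨C, T, h⟩ := hf
  obtain ⟨D, R, k⟩ := hg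
  refine ⟨C + D, max T R, fun s h1 h2 h3 => (norm_add_le _ _).trans ?_⟩
  rw [add_div]
  exact add_le_add (h s h1 h2 ((le_max_left _ _).trans h3))
    (k s h1 h2 ((le_max_right _ _).trans h3))

lemma mul_bounded (hf : VerticalDecay c' c f) {B : ℝ}
    (hg : ∀ s : ℂ, c' ≤ s.re → s.re ≤ c → ‖g s‖ ≤ B) : VerticalDecay c' c fun s => g s * f s := by
  obtain ⟨C, T, h⟩ := hf
  refine ⟨B * C, T, fun s h1 h2 h3 => ?_⟩
  rw [norm_mul, mul_div_assoc]
  exact mul_le_mul (hg s h1 h2) (h s h1 h2 h3) (norm_nonneg _) ((norm_nonneg _).trans (hg s h1 h2))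

lemma const_mul (hf : VerticalDecay c' c f) (r : ℂ) : VerticalDecay c' c fun s => r * f s :=
  hf.mul_bounded (B := ‖r‖) fun _ _ _ => le_rfl

lemma sum {ι : Type*} {f : ι → ℂ → ℂ} (S : Finset ι) (h : ∀ i ∈ S, VerticalDecay c' c (f i)) :
    VerticalDecay c' c fun s => ∑ i ∈ S, f i s := by
  induction S using Finset.cons_induction with
  | empty => exact ⟨0, 0, by simp⟩
  | cons i S hi ih =>
    simp only [Finset.sum_cons]
    exact (h i (by simp)).add (ih fun j hj => h j (by simp [hj]))

lemma congr (hf : VerticalDecay c' c f) (S : Finset ℂ) (h : ∀ s ∉ S, g s = f s) :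
    VerticalDecay c' c g := by
  obtain ⟨C, T, k⟩ := hf
  refine ⟨C, max T (1 + ∑ p ∈ S, |p.im|), fun s h1 h2 h3 => ?_⟩
  rw [h s fun hs => ?_]
  · exact k s h1 h2 ((le_max_left _ _).trans h3)
  · have := Finset.single_le_sum (f := fun p : ℂ => |p.im|) (fun _ _ => abs_nonneg _) hs
    linarith [(le_max_right T (1 + ∑ p ∈ S, |p.im|)).trans h3]

lemma integrable (hf : VerticalDecay c' c f) {σ : ℝ} (h1 : c' ≤ σ) (h2 : σ ≤ c)
    (hc : Continuous fun y : ℝ => f (σ + y * I)) : Integrable fun y : ℝ => f (σ + y * I) := by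
  obtain ⟨C, T, h⟩ := hf
  refine hc.locallyIntegrable.integrable_of_isBigO_cocompact (g := fun y : ℝ => (1 + y ^ 2)⁻¹) ?_
    (integrable_inv_one_add_sq.integrableAtFilter _)
  refine IsBigO.of_bound (|C| * 2) ?_
  have hT : ∀ᶠ y : ℝ in cocompact ℝ, max T 1 ≤ |y| :=
    tendsto_norm_cocompact_atTop.eventually_ge_atTop _
  filter_upwards [hT] with y hy
  have hy1 : 1 ≤ |y| := (le_max_right _ _).trans hy
  have hy2 : 1 ≤ y ^ 2 := by rw [← sq_abs]; nlinarith
  have := h (σ + y * I) (by simpa using h1) (by simpa using h2)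
    (by simpa using (le_max_left _ _).trans hy)
  refine this.trans ?_
  simp only [add_im, ofReal_im, mul_im, ofReal_re, I_im, mul_one, I_re, mul_zero, add_zero,
    zero_add]
  rw [Real.norm_of_nonneg (by positivity), mul_assoc, ← div_eq_mul_inv]
  rw [div_eq_mul_inv]
  refine mul_le_mul (le_abs_self C) ?_ (by positivity) (abs_nonneg C)
  rw [inv_eq_one_div, div_le_div_iff₀ (by positivity) (by positivity)]
  linarith

/-- Shifting a vertical line of integration across a strip where the integrand is holomorphic. -/
lemma integral_eq (hf : VerticalDecay c' c f) (hcc : c' ≤ c)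
    (hd : DifferentiableOn ℂ f {s | c' ≤ s.re ∧ s.re ≤ c}) :
    ∫ y : ℝ, f (c + y * I) = ∫ y : ℝ, f (c' + y * I) := by
  have hcont : ∀ σ : ℝ, c' ≤ σ → σ ≤ c → Continuous fun y : ℝ => f (σ + y * I) := fun σ h1 h2 =>
    hd.continuousOn.comp_continuous (by fun_prop) fun y => by simpa using ⟨h1, h2⟩
  have hl := intervalIntegral_tendsto_integral (hf.integrable le_rfl hcc (hcont _ le_rfl hcc))
    tendsto_neg_atTop_atBot tendsto_id
  have hr := intervalIntegral_tendsto_integral (hf.integrable hcc le_rfl (hcont _ hcc le_rfl))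
    tendsto_neg_atTop_atBot tendsto_id
  refine tendsto_nhds_unique hr ?_
  rw [← sub_zero (∫ y : ℝ, f (c' + y * I))]
  have hrect : ∀ T : ℝ, (∫ y in (-T)..T, f (c + y * I)) = (∫ y in (-T)..T, f (c' + y * I)) -
      (-I) * ((∫ x in c'..c, f (x + (-T : ℝ) * I)) - ∫ x in c'..c, f (x + T * I)) := by
    intro T
    have := Complex.integral_boundary_rect_eq_zero_of_differentiableOn f ⟨c', -T⟩ ⟨c, T⟩
      (hd.mono fun s hs => by
        have := hs.1
        simpa [Set.uIcc_of_le hcc] using this)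
    simp only [smul_eq_mul] at this
    have h2 : (∫ y in (-T)..T, f (c + y * I)) - (∫ y in (-T)..T, f (c' + y * I)) =
      I * ((∫ x in c'..c, f (x + (-T : ℝ) * I)) - ∫ x in c'..c, f (x + T * I)) := by
      linear_combination (-I) * this + ((∫ y in (-T)..T, f (c + y * I)) -
        (∫ y in (-T)..T, f (c' + y * I))) * I_sq
    linear_combination h2
  simp only [id, hrect]
  refine hl.sub ?_
  obtain ⟨C, T, h⟩ := hf
  have hz : ∀ᶠ R : ℝ in atTop, ‖(-I) * ((∫ x in c'..c, f (x + (-R : ℝ) * I)) -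
      ∫ x in c'..c, f (x + R * I))‖ ≤ 2 * (C * (c - c')) * (R ^ 2)⁻¹ := by
    filter_upwards [eventually_ge_atTop T, eventually_ge_atTop 0] with R hR hR0
    have hb : ∀ y : ℝ, |y| = R → ‖∫ x in c'..c, f (x + y * I)‖ ≤ C / R ^ 2 * |c - c'| := by
      intro y hy
      refine intervalIntegral.norm_integral_le_of_norm_le_const fun x hx => ?_
      rw [Set.uIoc_of_le hcc] at hx
      have := h (x + y * I) (by simpa using hx.1.le) (by simpa using hx.2)
        (by simpa [hy] using hR)
      simpa [← sq_abs y, hy] using this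
    rw [norm_mul, norm_neg, norm_I, one_mul]
    refine (norm_sub_le _ _).trans ((add_le_add (hb (-R) (by rw [abs_neg, abs_of_nonneg hR0]))
      (hb R (abs_of_nonneg hR0))).trans_eq ?_)
    rw [abs_of_nonneg (by linarith)]
    ring
  refine squeeze_zero_norm' hz ?_
  have := ((tendsto_pow_atTop (α := ℝ) two_ne_zero).inv_tendsto_atTop).const_mul
    (2 * (C * (c - c')))
  simpa using this

end VerticalDecay

/-- Removal of finitely many singularities. -/
lemma exists_differentiableOn_extension {U : Set ℂ} (hU : IsOpen U) (S : Finset ℂ) {D : ℂ → ℂ}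
    (hD : DifferentiableOn ℂ D (U \ S))
    (h : ∀ p ∈ S, Tendsto (fun s => (s - p) * D s) (𝓝[≠] p) (𝓝 0)) :
    ∃ E : ℂ → ℂ, DifferentiableOn ℂ E U ∧ ∀ s ∉ S, E s = D s := by
  induction S using Finset.cons_induction generalizing D with
  | empty => exact ⟨D, by simpa using hD, fun _ _ => rfl⟩
  | cons p S hp ih =>
    let D₁ : ℂ → ℂ := Function.update D p (limUnder (𝓝[≠] p) D)
    have hne : ∀ s, s ≠ p → D₁ s = D s := fun s hs => Function.update_of_ne hs _ _
    have hsub : (U \ S) \ {p} ⊆ U \ (S.cons p hp : Finset ℂ) := fun s hs => by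
      simp only [Set.mem_sdiff, Finset.mem_coe, Set.mem_singleton_iff] at hs
      simp only [Set.mem_sdiff, Finset.mem_coe, Finset.mem_cons, not_or]
      tauto
    have hD₁ : DifferentiableOn ℂ D₁ (U \ S) := by
      by_cases hpU : p ∈ U
      · refine Complex.differentiableOn_update_limUnder_of_isLittleO
          ((hU.sdiff S.finite_toSet.isClosed).mem_nhds ⟨hpU, by simpa using hp⟩) (hD.mono hsub) ?_
        rw [isLittleO_iff_tendsto']
        · have h0 : Tendsto (fun s => (s - p) * D s - (s - p) * D p) (𝓝[≠] p) (𝓝 (0 - 0)) := by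
            refine (h p (by simp)).sub ?_
            have : Tendsto (fun s : ℂ => (s - p) * D p) (𝓝 p) (𝓝 ((p - p) * D p)) :=
              Continuous.tendsto (by fun_prop) p
            simpa using this.mono_left nhdsWithin_le_nhds
          rw [sub_zero] at h0
          refine h0.congr fun s => ?_
          rw [div_inv_eq_mul]
          ring
        · filter_upwards [self_mem_nhdsWithin] with s hs h0
          exact absurd (sub_eq_zero.mp (inv_eq_zero.mp h0)) hs
      · refine (hD.mono fun s hs => hsub ⟨hs, ?_⟩).congr fun s hs => hne s ?_ <;>
        · rintro rfl
          exact hpU hs.1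
    obtain ⟨E, hE, hES⟩ := ih hD₁ fun p' hp' => by
      refine (h p' (by simp [hp'])).congr' ?_
      have : p' ≠ p := by rintro rfl; exact hp hp'
      filter_upwards [nhdsWithin_le_nhds (isOpen_ne.mem_nhds this)] with s hs
      rw [hne s hs]
    refine ⟨E, hE, fun s hs => ?_⟩
    simp only [Finset.mem_cons, not_or] at hs
    rw [hES s hs.2, hne s hs.1]

/-- The Mellin transform of `x ↦ x ^ (-p) * (1 - x ^ q)` on `(0, 1)`. -/
noncomputable def poleKernel (p : ℂ) (q : ℝ) (s : ℂ) : ℂ := 1 / (s - p) - 1 / (s - p + q)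

lemma poleKernel_differentiableAt {p : ℂ} {q : ℝ} {s : ℂ} (h1 : s ≠ p) (h2 : 0 < (s - p + q).re) :
    DifferentiableAt ℂ (poleKernel p q) s := by
  have h3 : s - p + q ≠ 0 := fun h => by simp [h] at h2
  have h4 : s - p ≠ 0 := sub_ne_zero.mpr h1
  unfold poleKernel
  fun_prop (disch := assumption)

lemma poleKernel_verticalDecay (p : ℂ) (q c' c : ℝ) : VerticalDecay c' c (poleKernel p q) := by
  refine ⟨|q| * 4, 2 * |p.im| + 1, fun s _ _ h => ?_⟩
  have hp := abs_nonneg p.im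
  have h0 : 0 < |s.im| := by linarith
  have key : ∀ z : ℂ, z.im = s.im - p.im → |s.im| / 2 ≤ ‖z‖ := fun z hz => by
    have h1 := Complex.abs_im_le_norm z
    rw [hz] at h1
    linarith [abs_sub_abs_le_abs_sub s.im p.im]
  have h1 := key (s - p) (by simp)
  have h2 := key (s - p + q) (by simp)
  have n1 : s - p ≠ 0 := norm_pos_iff.mp (by linarith)
  have n2 : s - p + q ≠ 0 := norm_pos_iff.mp (by linarith)
  have : poleKernel p q s = q / ((s - p) * (s - p + q)) := by
    rw [poleKernel, div_sub_div _ _ n1 n2]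
    ring
  rw [this, norm_div, norm_mul, Complex.norm_real, Real.norm_eq_abs, mul_div_assoc]
  rw [div_eq_mul_inv]
  gcongr
  rw [inv_eq_one_div,
    div_le_div_iff₀ (by linarith [mul_pos (norm_pos_iff.mpr n1) (norm_pos_iff.mpr n2)])
    (by rw [← sq_abs]; positivity), ← sq_abs]
  nlinarith [mul_le_mul h1 h2 (by positivity) (norm_nonneg _)]

lemma tendsto_mul_poleKernel_self (p : ℂ) {q : ℝ} (hq : 0 < q) :
    Tendsto (fun s => (s - p) * poleKernel p q s) (𝓝[≠] p) (𝓝 1) := by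
  have hq' : (q : ℂ) ≠ 0 := by exact_mod_cast hq.ne'
  have h1 : Tendsto (fun s : ℂ => 1 - (s - p) / (s - p + q)) (𝓝[≠] p)
      (𝓝 (1 - (p - p) / (p - p + q))) := by
    refine Tendsto.mono_left (ContinuousAt.tendsto ?_) nhdsWithin_le_nhds
    exact continuousAt_const.sub (ContinuousAt.div (by fun_prop) (by fun_prop) (by simpa using hq'))
  rw [sub_self, zero_div, sub_zero] at h1
  refine h1.congr' ?_
  filter_upwards [self_mem_nhdsWithin] with s hs
  have : s - p ≠ 0 := sub_ne_zero.mpr hs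
  rw [poleKernel, mul_sub, mul_one_div_cancel this]
  ring

lemma tendsto_mul_of_continuousAt {f : ℂ → ℂ} {p : ℂ} (hf : ContinuousAt f p) :
    Tendsto (fun s => (s - p) * f s) (𝓝[≠] p) (𝓝 0) := by
  have : Tendsto (fun s => (s - p) * f s) (𝓝 p) (𝓝 ((p - p) * f p)) :=
    ContinuousAt.tendsto (f := fun s => (s - p) * f s) (by fun_prop)
  simpa using this.mono_left nhdsWithin_le_nhds

lemma mellinInv_poleKernel {p : ℂ} {q c x : ℝ} (hq : 0 < q) (hc : p.re < c) (hx0 : 0 < x)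
    (hx1 : x < 1) : mellinInv c (poleKernel p q) x = (x : ℂ) ^ (-p) - (x : ℂ) ^ (-p + q) := by
  let f : ℝ → ℂ := fun t => (Set.Ioc 0 1).indicator (fun t : ℝ => (t : ℂ) ^ (-p)) t -
    (Set.Ioc 0 1).indicator (fun t : ℝ => (t : ℂ) ^ (-p + q)) t
  have hM : ∀ s : ℂ, p.re < s.re → HasMellin f s (poleKernel p q s) := fun s hs => by
    have h1 := hasMellin_cpow_Ioc (-p) (s := s) (by simpa using hs)
    have h2 := hasMellin_cpow_Ioc (-p + q) (s := s) (by simp; linarith)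
    have := hasMellin_sub h1.1 h2.1
    rw [h1.2, h2.2] at this
    rwa [show 1 / (s + -p) - 1 / (s + (-p + q)) = poleKernel p q s by
      rw [poleKernel, ← sub_eq_add_neg, ← add_assoc, ← sub_eq_add_neg]] at this
  have heq : mellinInv c (poleKernel p q) x = mellinInv c (mellin f) x := by
    simp only [mellinInv]
    congr 2
    ext y
    rw [(hM (c + y * I) (by simpa using hc)).2]
  have hfx : f =ᶠ[𝓝 x] fun t : ℝ => (t : ℂ) ^ (-p) - (t : ℂ) ^ (-p + q) := by
    filter_upwards [Ioo_mem_nhds hx0 hx1] with t ht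
    have : t ∈ Set.Ioc (0 : ℝ) 1 := ⟨ht.1, ht.2.le⟩
    simp [f, this]
  rw [heq, mellinInv_mellin_eq c f hx0 (hM c (by simpa using hc)).1, hfx.eq_of_nhds]
  · have hcont : Continuous fun y : ℝ => poleKernel p q (c + y * I) := by
      refine continuous_iff_continuousAt.mpr fun y => ContinuousAt.comp
        (g := poleKernel p q) (f := fun y : ℝ => (c + y * I : ℂ)) ?_ (by fun_prop)
      refine (poleKernel_differentiableAt (fun h => ?_) (by simp; linarith)).continuousAt
      rw [← h] at hc
      simp at hc
    refine ((poleKernel_verticalDecay p q c c).integrable le_rfl le_rfl hcont).congr ?_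
    exact .of_forall fun y => ((hM (c + y * I) (by simpa using hc)).2).symm
  · refine ContinuousAt.congr ?_ hfx.symm
    have : (x : ℂ) ∈ slitPlane := by simpa using hx0
    fun_prop (disch := assumption)

lemma continuous_cpow_vertical {x : ℝ} (hx : 0 < x) (σ : ℝ) :
    Continuous fun y : ℝ => (x : ℂ) ^ (-(σ + y * I : ℂ)) := by
  refine Continuous.const_cpow (by fun_prop) (Or.inl (by exact_mod_cast hx.ne'))

lemma norm_cpow_vertical {x : ℝ} (hx : 0 < x) (s : ℂ) : ‖(x : ℂ) ^ (-s)‖ = x ^ (-s.re) := by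
  simp [Complex.norm_cpow_eq_rpow_re_of_pos hx]

lemma integrable_cpow_mul {f : ℂ → ℂ} {x σ : ℝ} (hx : 0 < x)
    (hf : Integrable fun y : ℝ => f (σ + y * I)) :
    Integrable fun y : ℝ => (x : ℂ) ^ (-(σ + y * I : ℂ)) * f (σ + y * I) := by
  refine hf.bdd_mul (c := x ^ (-σ)) (continuous_cpow_vertical hx σ).aestronglyMeasurable
    (.of_forall fun y => ?_)
  rw [norm_cpow_vertical hx]
  simp

lemma norm_mellinInv_le (f : ℂ → ℂ) {x : ℝ} (σ : ℝ) (hx : 0 < x) :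
    ‖mellinInv σ f x‖ ≤ (1 / (2 * π) * ∫ y : ℝ, ‖f (σ + y * I)‖) * x ^ (-σ) := by
  rw [mellinInv, norm_smul, Real.norm_of_nonneg (by positivity), mul_assoc]
  gcongr
  refine (norm_integral_le_integral_norm _).trans_eq ?_
  rw [← integral_mul_const]
  congr 1
  ext y
  rw [norm_smul, norm_cpow_vertical hx, mul_comm]
  simp

lemma mellinInv_eq_of_differentiableOn {f : ℂ → ℂ} {c' c x : ℝ} (hx : 0 < x)
    (hf : VerticalDecay c' c f) (hcc : c' ≤ c)
    (hd : DifferentiableOn ℂ f {s | c' ≤ s.re ∧ s.re ≤ c}) :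
    mellinInv c f x = mellinInv c' f x := by
  have hx' : (x : ℂ) ≠ 0 := by exact_mod_cast hx.ne'
  have h := (hf.mul_bounded (g := fun s => (x : ℂ) ^ (-s)) (B := max (x ^ (-c)) (x ^ (-c')))
    fun s h1 h2 => by
      rw [norm_cpow_vertical hx]
      rcases le_total x 1 with h | h
      · exact (Real.rpow_le_rpow_of_exponent_ge hx h (by linarith)).trans (le_max_left _ _)
      · exact (Real.rpow_le_rpow_of_exponent_le h (by linarith)).trans
          (le_max_right _ _)).integral_eq
    hcc (DifferentiableOn.mul (fun s _ => (DifferentiableAt.const_cpow (by fun_prop)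
      (Or.inl hx')).differentiableWithinAt) hd)
  simp only [mellinInv, smul_eq_mul, h]

/-- Shifting the line of integration of an inverse Mellin transform across finitely many simple
poles. -/
theorem exists_norm_mellinInv_sub_residues_le {G : ℂ → ℂ} {S : Finset ℂ} {r : ℂ → ℂ} {c₀ c' c : ℝ}
    (hc₀ : c₀ < c') (hcc : c' < c) (hG : DifferentiableOn ℂ G ({s | c₀ < s.re} \ S))
    (hS : ∀ p ∈ S, c' < p.re ∧ p.re < c)
    (hr : ∀ p ∈ S, Tendsto (fun s => (s - p) * G s) (𝓝[≠] p) (𝓝 (r p)))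
    (hdec : VerticalDecay c' c G) :
    ∃ C : ℝ, ∀ x : ℝ, 0 < x → x < 1 →
      ‖mellinInv c G x - ∑ p ∈ S, r p * (x : ℂ) ^ (-p)‖ ≤ C * x ^ (-c') := by
  set q : ℝ := c - c₀ with hq
  have hq0 : 0 < q := by linarith
  have hU : IsOpen {s : ℂ | c₀ < s.re} := isOpen_lt continuous_const continuous_re
  let D : ℂ → ℂ := fun s => G s + (-1) * ∑ p ∈ S, r p * poleKernel p q s
  have hkd : ∀ p ∈ S, ∀ s : ℂ, c₀ < s.re → s ≠ p → DifferentiableAt ℂ (poleKernel p q) s :=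
    fun p hp s hs hsp => poleKernel_differentiableAt hsp (by simp; linarith [(hS p hp).2])
  have hDd : DifferentiableOn ℂ D ({s | c₀ < s.re} \ S) := by
    refine hG.add (DifferentiableOn.const_mul (DifferentiableOn.fun_sum fun p hp => ?_) _)
    refine DifferentiableOn.const_mul (fun s hs => ?_) _
    exact (hkd p hp s hs.1 (by rintro rfl; exact hs.2 hp)).differentiableWithinAt
  have hDlim : ∀ p ∈ S, Tendsto (fun s => (s - p) * D s) (𝓝[≠] p) (𝓝 0) := by
    intro p hp
    have h1 : ∀ p' ∈ S, Tendsto (fun s => r p' * ((s - p) * poleKernel p' q s)) (𝓝[≠] p)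
        (𝓝 (r p' * if p' = p then 1 else 0)) := by
      intro p' hp'
      refine Tendsto.const_mul _ ?_
      split_ifs with h
      · subst h
        exact tendsto_mul_poleKernel_self p' hq0
      · exact tendsto_mul_of_continuousAt
          (hkd p' hp' p (hc₀.trans (hS p hp).1) (Ne.symm h)).continuousAt
    have h2 := (hr p hp).sub (tendsto_finsetSum S h1)
    simp only [mul_ite, mul_one, mul_zero, Finset.sum_ite_eq', hp, if_true, sub_self] at h2
    refine h2.congr fun s => ?_
    simp only [D, mul_add, Finset.mul_sum]
    rw [sub_eq_add_neg, ← Finset.sum_neg_distrib]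
    congr 1
    refine Finset.sum_congr rfl fun i _ => by ring
  have hDdec : VerticalDecay c' c D :=
    hdec.add ((VerticalDecay.sum S fun p _ =>
      (poleKernel_verticalDecay p q c' c).const_mul (r p)).const_mul (-1))
  obtain ⟨E, hE, hES⟩ := exists_differentiableOn_extension hU S hDd hDlim
  have hEdec : VerticalDecay c' c E := hDdec.congr S hES
  have hcS : ∀ y : ℝ, (c + y * I : ℂ) ∉ S := fun y hy => by simpa using (hS _ hy).2
  have hGint : Integrable fun y : ℝ => G (c + y * I) := by
    refine hdec.integrable hcc.le le_rfl (hG.continuousOn.comp_continuous (by fun_prop) fun y => ?_)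
    exact ⟨by simp; linarith, hcS y⟩
  have hkint : ∀ p ∈ S, Integrable fun y : ℝ => poleKernel p q (c + y * I) := fun p hp => by
    refine (poleKernel_verticalDecay p q c' c).integrable hcc.le le_rfl
      (continuous_iff_continuousAt.mpr fun y => ContinuousAt.comp
        (g := poleKernel p q) (f := fun y : ℝ => (c + y * I : ℂ)) ?_ (by fun_prop))
    refine (hkd p hp _ (by simp; linarith) ?_).continuousAt
    rintro h
    exact hcS y (by rwa [h])
  refine ⟨1 / (2 * π) * (∫ y : ℝ, ‖E (c' + y * I)‖) + ∑ p ∈ S, ‖r p‖, fun x hx0 hx1 => ?_⟩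
  have hsplit : mellinInv c G x = mellinInv c E x +
      ∑ p ∈ S, r p * mellinInv c (poleKernel p q) x := by
    have e1 : ∀ y : ℝ, (x : ℂ) ^ (-(c + y * I : ℂ)) * G (c + y * I) =
        (x : ℂ) ^ (-(c + y * I : ℂ)) * E (c + y * I) +
        ∑ p ∈ S, r p * ((x : ℂ) ^ (-(c + y * I : ℂ)) * poleKernel p q (c + y * I)) := fun y => by
      have : ∑ p ∈ S, r p * ((x : ℂ) ^ (-(c + y * I : ℂ)) * poleKernel p q (c + y * I)) =
          (x : ℂ) ^ (-(c + y * I : ℂ)) * ∑ p ∈ S, r p * poleKernel p q (c + y * I) := by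
        rw [Finset.mul_sum]
        exact Finset.sum_congr rfl fun p _ => by ring
      rw [this, hES _ (hcS y)]
      simp only [D]
      ring
    simp only [mellinInv, smul_eq_mul, e1]
    have hEint : Integrable fun y : ℝ => E (c + y * I) :=
      hEdec.integrable hcc.le le_rfl (hE.continuousOn.comp_continuous (by fun_prop)
        fun y => by simp; linarith)
    have hki := fun p hp => (integrable_cpow_mul hx0 (hkint p hp)).const_mul (r p)
    rw [integral_add (integrable_cpow_mul hx0 hEint) (integrable_finsetSum S hki),
      integral_finsetSum S hki]
    simp only [integral_const_mul, smul_add, Finset.smul_sum, mul_smul_comm]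
  have hsum : ∑ p ∈ S, r p * mellinInv c (poleKernel p q) x - ∑ p ∈ S, r p * (x : ℂ) ^ (-p) =
      ∑ p ∈ S, -(r p * (x : ℂ) ^ (-(p - q))) := by
    rw [← Finset.sum_sub_distrib]
    refine Finset.sum_congr rfl fun p hp => ?_
    rw [mellinInv_poleKernel hq0 (hS p hp).2 hx0 hx1, show -p + (q : ℂ) = -(p - q) by ring]
    ring
  rw [hsplit, add_sub_assoc, hsum, mellinInv_eq_of_differentiableOn hx0 hEdec hcc.le
    (hE.mono fun s hs => hc₀.trans_le hs.1), add_mul, Finset.sum_mul]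
  refine (norm_add_le _ _).trans (add_le_add (norm_mellinInv_le E c' hx0)
    ((norm_sum_le _ _).trans (Finset.sum_le_sum fun p hp => ?_)))
  rw [norm_neg, norm_mul, norm_cpow_vertical hx0]
  gcongr ?_ * ?_
  refine Real.rpow_le_rpow_of_exponent_ge hx0 hx1.le ?_
  simp only [sub_re, ofReal_re]
  linarith [(hS p hp).2]

lemma PolyGrowth.verticalDecay_Gamma_mul {c' : ℝ} {f : ℂ → ℂ} (hf : PolyGrowth c' f) (c : ℝ) :
    VerticalDecay c' c fun s => Complex.Gamma s * f s := by
  obtain ⟨C, A, hC, h⟩ := hf.exists_nonneg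
  obtain ⟨D, -, hD⟩ := exists_norm_Gamma_mul_pow_le c' c (A + 2)
  refine ⟨C * (2 + |c'| + |c|) ^ A * D, 1, fun s h1 h2 h3 => ?_⟩
  have hre : |s.re| ≤ |c'| + |c| := abs_le.2
    ⟨by linarith [neg_abs_le c', abs_nonneg c], by linarith [le_abs_self c, abs_nonneg c']⟩
  have hs : 1 + ‖s‖ ≤ (2 + |c'| + |c|) * |s.im| := by
    nlinarith [Complex.norm_le_abs_re_add_abs_im s, abs_nonneg c', abs_nonneg c]
  have him : 0 < s.im ^ 2 := by rw [← sq_abs]; positivity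
  rw [le_div_iff₀ him, norm_mul, ← sq_abs s.im]
  calc ‖Complex.Gamma s‖ * ‖f s‖ * |s.im| ^ 2
      ≤ ‖Complex.Gamma s‖ * (C * ((2 + |c'| + |c|) * |s.im|) ^ A) * |s.im| ^ 2 := by
        gcongr
        exact (h s h1).trans (by gcongr)
    _ = C * (2 + |c'| + |c|) ^ A * (‖Complex.Gamma s‖ * |s.im| ^ (A + 2)) := by
        rw [mul_pow]; ring
    _ ≤ _ := by gcongr; exact hD s h1 h2 h3

lemma norm_riemannZeta_le_norm_zetaEntire {s : ℂ} (hs : 1 ≤ |s.im|) :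
    ‖riemannZeta s‖ ≤ ‖zetaEntire s‖ := by
  have h1 : s ≠ 1 := fun h => by norm_num [h] at hs
  rw [zetaEntire_of_ne h1, norm_mul]
  refine le_mul_of_one_le_left (norm_nonneg _) (hs.trans ?_)
  simpa using Complex.abs_im_le_norm (s - 1)

lemma verticalDecay_Gamma_mul_zeta_mul_zeta {a : ℝ} (ha : 0 < a) (b d : ℂ) (c' c : ℝ) :
    VerticalDecay c' c fun s =>
      Complex.Gamma s * (riemannZeta (a * s + b) * riemannZeta (a * s + d)) := by
  have hz : ∀ e : ℂ, PolyGrowth c' fun s => zetaEntire (a * s + e) := fun e =>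
    (PolyGrowth.zetaEntire (a * c' + e.re)).comp_affine a e fun s hs => by
      simpa using mul_le_mul_of_nonneg_left hs ha.le
  obtain ⟨C, T, h⟩ := ((hz b).mul (hz d)).verticalDecay_Gamma_mul c
  refine ⟨C, max T ((1 + |b.im| + |d.im|) / a), fun s h1 h2 h3 => ?_⟩
  have him : ∀ e : ℂ, |e.im| ≤ |b.im| + |d.im| → 1 ≤ |(a * s + e).im| := fun e he => by
    have h4 := (div_le_iff₀ ha).1 ((le_max_right _ _).trans h3)
    have h5 := abs_sub_abs_le_abs_sub (a * s.im) (-e.im)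
    rw [abs_mul, abs_of_pos ha, abs_neg, sub_neg_eq_add] at h5
    simp only [add_im, im_ofReal_mul]
    linarith
  refine le_trans ?_ (h s h1 h2 ((le_max_left _ _).trans h3))
  simp only [norm_mul]
  gcongr
  · exact norm_riemannZeta_le_norm_zetaEntire (him b (by linarith [abs_nonneg d.im]))
  · exact norm_riemannZeta_le_norm_zetaEntire (him d (by linarith [abs_nonneg b.im]))

lemma continuous_Gamma_vertical {c : ℝ} (hc : 0 < c) :
    Continuous fun y : ℝ => Complex.Gamma (c + y * I) := by
  refine continuous_iff_continuousAt.2 fun y => ?_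
  refine ContinuousAt.comp (g := Complex.Gamma) (f := fun y : ℝ => (c + y * I : ℂ)) ?_ (by fun_prop)
  refine (Complex.differentiableAt_Gamma _ fun m h => ?_).continuousAt
  have := congrArg Complex.re h
  simp at this
  linarith [(Nat.cast_nonneg m : (0 : ℝ) ≤ m)]

lemma integrable_Gamma_vertical {c : ℝ} (hc : 0 < c) :
    Integrable fun y : ℝ => Complex.Gamma (c + y * I) := by
  have := (PolyGrowth.const (σ := c) 1).verticalDecay_Gamma_mul c
  simp only [mul_one] at this
  exact this.integrable le_rfl le_rfl (continuous_Gamma_vertical hc)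

lemma mellinInv_Gamma {c x : ℝ} (hc : 0 < c) (hx : 0 < x) :
    mellinInv c Complex.Gamma x = Complex.exp (-x : ℝ) := by
  have hm : ∀ s : ℂ, 0 < s.re → mellin (fun x : ℝ => ((Real.exp (-x) : ℝ) : ℂ)) s =
      Complex.Gamma s := fun s hs => by
    rw [Complex.Gamma_eq_integral hs, Complex.GammaIntegral_eq_mellin]
  have hre : ∀ y : ℝ, 0 < (c + y * I : ℂ).re := fun y => by simpa using hc
  have hconv : MellinConvergent (fun x : ℝ => ((Real.exp (-x) : ℝ) : ℂ)) c := by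
    have := Complex.GammaIntegral_convergent (s := (c : ℂ)) (by simpa using hc)
    refine this.congr (Filter.Eventually.of_forall fun y => ?_)
    simp [mul_comm]
  have h := mellinInv_mellin_eq c (fun x : ℝ => ((Real.exp (-x) : ℝ) : ℂ)) hx hconv
    ((integrable_Gamma_vertical hc).congr (Filter.Eventually.of_forall fun y =>
      (hm _ (hre y)).symm)) (by fun_prop)
  rw [← Complex.ofReal_exp, ← h]
  simp only [mellinInv, hm _ (hre _)]

/-- A generalized Dirichlet series weighted by `exp (-p n * x)` is an inverse Mellin transform. -/
lemma hasSum_mul_exp_neg {u : ℕ → ℂ} {p : ℕ → ℝ} {F : ℂ → ℂ} {c x : ℝ} (hc : 0 < c) (hx : 0 < x)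
    (hp : ∀ n, 0 < p n) (hF : ∀ s : ℂ, s.re = c → HasSum (fun n => u n * (p n : ℂ) ^ (-s)) (F s)) :
    HasSum (fun n => u n * Complex.exp (-(p n * x : ℝ)))
      (mellinInv c (fun s => Complex.Gamma s * F s) x) := by
  let f : ℕ → ℝ → ℂ := fun n y =>
    u n * ((((p n * x : ℝ) : ℂ)) ^ (-(c + y * I : ℂ)) * Complex.Gamma (c + y * I))
  have hfi : ∀ n, Integrable (f n) := fun n =>
    (integrable_cpow_mul (mul_pos (hp n) hx) (integrable_Gamma_vertical hc)).const_mul _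
  have hnorm : ∀ n y, ‖f n y‖ =
      ‖u n * (p n : ℂ) ^ (-(c : ℂ))‖ * (x ^ (-c) * ‖Complex.Gamma (c + y * I)‖) := fun n y => by
    simp only [f, norm_mul]
    rw [norm_cpow_vertical (mul_pos (hp n) hx), norm_cpow_vertical (hp n),
      Real.mul_rpow (hp n).le hx.le]
    simp
    ring
  have hs : Summable fun n => ∫ y, ‖f n y‖ := by
    simp only [hnorm, integral_const_mul]
    exact (hF c (by simp)).summable.norm.mul_right _
  have h := hasSum_integral_of_summable_integral_norm hfi hs
  have h2 := h.const_smul ((1 : ℝ) / (2 * π))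
  have hsum : mellinInv c (fun s => Complex.Gamma s * F s) x =
      ((1 : ℝ) / (2 * π)) • ∫ y, ∑' n, f n y := by
    rw [mellinInv]
    congr 2
    ext y
    have hy := ((hF (c + y * I) (by simp)).mul_left
      ((x : ℂ) ^ (-(c + y * I : ℂ)) * Complex.Gamma (c + y * I))).tsum_eq
    rw [smul_eq_mul, ← mul_assoc, ← hy]
    refine tsum_congr fun n => ?_
    simp only [f]
    rw [Complex.ofReal_mul, Complex.mul_cpow_ofReal_nonneg (hp n).le hx.le]
    ring
  rw [hsum]
  refine h2.congr_fun fun n => ?_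
  have hn := mellinInv_Gamma hc (mul_pos (hp n) hx)
  rw [Complex.ofReal_neg] at hn
  rw [← hn, mellinInv]
  simp only [f, integral_const_mul, smul_eq_mul, Complex.real_smul]
  ring

/-- `∑ σ_α(n) / n ^ w = ζ(w) ζ(w - α)` in the region of absolute convergence. -/
lemma hasSum_sigmaC {α w : ℂ} (h1 : 1 < w.re) (h2 : 1 < (w - α).re) :
    HasSum (fun n : ℕ => sigmaC α (n + 1) / ((n + 1 : ℕ) : ℂ) ^ w)
      (riemannZeta w * riemannZeta (w - α)) := by
  have hα : LSeriesHasSum (fun n => (n : ℂ) ^ α) w (riemannZeta (w - α)) := by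
    refine HasSum.congr_fun (LSeriesHasSum_one h2) fun n => ?_
    rcases eq_or_ne n 0 with rfl | hn
    · simp
    · rw [LSeries.term_of_ne_zero hn, LSeries.term_of_ne_zero hn,
        Complex.cpow_sub _ _ (Nat.cast_ne_zero.2 hn)]
      simp
  have h := (hasSum_nat_add_iff' 1).2 (hα.convolution (LSeriesHasSum_one h1))
  simp only [Finset.range_one, Finset.sum_singleton, LSeries.term_zero, sub_zero] at h
  rw [mul_comm]
  refine HasSum.congr_fun h fun n => ?_
  rw [LSeries.term_of_ne_zero n.succ_ne_zero, LSeries.convolution_def, sigmaC]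
  simp [Nat.sum_divisorsAntidiagonal fun d _ => (d : ℂ) ^ α]

lemma tendsto_mul_Gamma_neg_nat (n : ℕ) :
    Tendsto (fun s : ℂ => (s - -n) * Complex.Gamma s) (𝓝[≠] (-n : ℂ))
      (𝓝 ((-1) ^ n / n.factorial)) := by
  have hprod : ∏ i ∈ Finset.range n, (-n + i : ℂ) = (-1) ^ n * n.factorial := by
    rw [← Finset.prod_range_reflect, ← Finset.prod_range_add_one_eq_factorial, Nat.cast_prod,
      ← Finset.card_range n, ← Finset.prod_const, Finset.card_range, ← Finset.prod_mul_distrib]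
    refine Finset.prod_congr rfl fun i hi => ?_
    rw [Nat.sub_sub, Nat.cast_sub (by have := Finset.mem_range.1 hi; omega)]
    push_cast
    ring
  have hne : ∏ i ∈ Finset.range n, (-n + i : ℂ) ≠ 0 := by
    rw [hprod]
    exact mul_ne_zero (pow_ne_zero _ (by norm_num)) (Nat.cast_ne_zero.2 n.factorial_ne_zero)
  have hΓ : ContinuousAt (fun s : ℂ => Complex.Gamma (s + (n + 1 : ℕ))) (-n : ℂ) := by
    refine ContinuousAt.comp (g := Complex.Gamma) ?_ (by fun_prop)
    refine (Complex.differentiableAt_Gamma _ fun m h => ?_).continuousAt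
    have := congrArg Complex.re h
    simp at this
    linarith [(Nat.cast_nonneg m : (0 : ℝ) ≤ m)]
  have hlim := (hΓ.div (f := fun s : ℂ => Complex.Gamma (s + (n + 1 : ℕ)))
    (g := fun s : ℂ => ∏ i ∈ Finset.range n, (s + i)) (by fun_prop) hne).tendsto
  rw [Pi.div_apply, hprod] at hlim
  have hval : Complex.Gamma (-n + (n + 1 : ℕ)) / ((-1) ^ n * n.factorial) =
      (-1) ^ n / (n.factorial : ℂ) := by
    have h1 : ((-1 : ℂ) ^ n) * (-1) ^ n = 1 := by rw [← mul_pow]; simp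
    have h0 : (n.factorial : ℂ) ≠ 0 := Nat.cast_ne_zero.2 n.factorial_ne_zero
    have h2 : ((-1 : ℂ) ^ n) ≠ 0 := pow_ne_zero _ (by norm_num)
    push_cast
    rw [neg_add_cancel_left, Complex.Gamma_one]
    field_simp
    linear_combination -h1
  rw [hval] at hlim
  refine (hlim.mono_left nhdsWithin_le_nhds).congr' ?_
  have hev : ∀ᶠ s : ℂ in 𝓝[≠] (-n : ℂ), ∏ i ∈ Finset.range n, (s + i) ≠ 0 :=
    ((by fun_prop : Continuous fun s : ℂ =>
      ∏ i ∈ Finset.range n, (s + i)).continuousAt.eventually_ne hne).filter_mono nhdsWithin_le_nhds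
  filter_upwards [hev, self_mem_nhdsWithin] with s hs hs'
  have hfac : ∀ i < n + 1, s + i ≠ 0 := fun i hi => by
    rcases Nat.lt_succ_iff_lt_or_eq.1 hi with h | rfl
    · exact Finset.prod_ne_zero_iff.1 hs i (Finset.mem_range.2 h)
    · exact fun h => hs' (eq_neg_of_add_eq_zero_left h)
  rw [Pi.div_apply, Gamma_add_nat _ _ hfac, Finset.prod_range_succ]
  field_simp
  ring

lemma tendsto_mul_riemannZeta_affine {a : ℝ} (ha : 0 < a) {b p : ℂ} (hp : a * p + b = 1) :
    Tendsto (fun s : ℂ => (s - p) * riemannZeta (a * s + b)) (𝓝[≠] p) (𝓝 (1 / a)) := by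
  have ha' : (a : ℂ) ≠ 0 := by exact_mod_cast ha.ne'
  have hmap : Tendsto (fun s : ℂ => a * s + b) (𝓝[≠] p) (𝓝[≠] 1) := by
    refine tendsto_nhdsWithin_iff.2 ⟨?_, ?_⟩
    · exact ((by fun_prop : Continuous fun s : ℂ => a * s + b).tendsto' p 1 hp).mono_left
        nhdsWithin_le_nhds
    · filter_upwards [self_mem_nhdsWithin] with s hs h
      exact hs (mul_left_cancel₀ ha' (add_right_cancel (h.trans hp.symm)))
  refine ((riemannZeta_residue_one.comp hmap).div_const (a : ℂ)).congr fun s => ?_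
  rw [Function.comp_apply, ← hp]
  field_simp
  ring

lemma differentiableAt_riemannZeta_affine {a b p : ℂ} (hp : a * p + b ≠ 1) :
    DifferentiableAt ℂ (fun s : ℂ => riemannZeta (a * s + b)) p :=
  DifferentiableAt.comp (g := riemannZeta) p (differentiableAt_riemannZeta hp) (by fun_prop)

lemma tendsto_mul_Gamma_zeta_zeta_of_zeta_pole {a : ℝ} (ha : 0 < a) {b d p : ℂ}
    (hb : a * p + b = 1) (hd : a * p + d ≠ 1) (hp : ∀ m : ℕ, p ≠ -m) :
    Tendsto (fun s : ℂ => (s - p) *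
      (Complex.Gamma s * (riemannZeta (a * s + b) * riemannZeta (a * s + d)))) (𝓝[≠] p)
      (𝓝 (1 / a * Complex.Gamma p * riemannZeta (a * p + d))) := by
  refine (((tendsto_mul_riemannZeta_affine ha hb).mul
    ((Complex.differentiableAt_Gamma p hp).continuousAt.tendsto.mono_left
      nhdsWithin_le_nhds)).mul
      ((differentiableAt_riemannZeta_affine hd).continuousAt.tendsto.mono_left
        nhdsWithin_le_nhds)).congr fun s => ?_
  ring

lemma tendsto_mul_Gamma_zeta_zeta_neg_nat {a b d : ℂ} (n : ℕ)
    (hb : a * -n + b ≠ 1) (hd : a * -n + d ≠ 1) :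
    Tendsto (fun s : ℂ => (s - -n) *
      (Complex.Gamma s * (riemannZeta (a * s + b) * riemannZeta (a * s + d)))) (𝓝[≠] (-n : ℂ))
      (𝓝 ((-1) ^ n / n.factorial * riemannZeta (a * -n + b) * riemannZeta (a * -n + d))) := by
  refine (((tendsto_mul_Gamma_neg_nat n).mul
    ((differentiableAt_riemannZeta_affine hb).continuousAt.tendsto.mono_left
      nhdsWithin_le_nhds)).mul
    ((differentiableAt_riemannZeta_affine hd).continuousAt.tendsto.mono_left
      nhdsWithin_le_nhds)).congr fun s => ?_
  ring

lemma tsum_sigmaC_mul_exp {a : ℝ} {α b : ℂ} {c x : ℝ} (hc : 0 < c) (hx : 0 < x)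
    (h1 : 1 < a * c + b.re) (h2 : 1 < a * c + (b - α).re) :
    (∑' n : ℕ, sigmaC α (n + 1) / ((n + 1 : ℕ) : ℂ) ^ b *
        Complex.exp (-((((n + 1 : ℕ) : ℝ) ^ a * x : ℝ) : ℂ))) =
      mellinInv c (fun s => Complex.Gamma s *
        (riemannZeta (a * s + b) * riemannZeta (a * s + (b - α)))) x := by
  refine (hasSum_mul_exp_neg hc hx (p := fun n : ℕ => ((n + 1 : ℕ) : ℝ) ^ a)
    (fun n => by positivity) fun s hs => ?_).tsum_eq
  have h := hasSum_sigmaC (α := α) (w := a * s + b) (by simpa [hs] using h1)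
    (by simpa [hs, add_sub_assoc] using h2)
  rw [add_sub_assoc] at h
  refine h.congr_fun fun n => ?_
  have hn : ((n + 1 : ℕ) : ℂ) ≠ 0 := by exact_mod_cast n.succ_ne_zero
  have hpow : ((((n + 1 : ℕ) : ℝ) ^ a : ℝ) : ℂ) ^ (-s) = ((n + 1 : ℕ) : ℂ) ^ (-(a * s)) := by
    rw [← Complex.cpow_mul_ofReal_nonneg (by positivity), Complex.ofReal_natCast, mul_neg]
  rw [hpow, Complex.cpow_add _ _ hn, Complex.cpow_neg]
  field_simp

/-- asymptotics of `∑_{n≥1} σ_α(n) e^{-nᵃ x}/n^b`, all poles simple. -/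
theorem sum_sigma_exp_asymp (a : ℝ) (α b : ℂ) (ha : 0 < a) (hα : α ≠ 0)
    (hb1 : ∀ n : ℕ, (a : ℂ) * n ≠ b - 1) (hb2 : ∀ n : ℕ, (a : ℂ) * n ≠ b - 1 - α) (N : ℕ) :
    (fun x : ℝ =>
      (∑' n : ℕ, sigmaC α (n + 1) / ((n + 1 : ℕ) : ℂ) ^ b *
        Complex.exp (-((((n + 1 : ℕ) : ℝ) ^ a * x : ℝ) : ℂ))) -
      ((x : ℂ) ^ ((b - 1) / (a : ℂ)) / (a : ℂ) * Complex.Gamma ((1 - b) / (a : ℂ)) *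
          riemannZeta (1 - α) +
        (x : ℂ) ^ ((b - 1 - α) / (a : ℂ)) / (a : ℂ) *
          Complex.Gamma ((1 - b + α) / (a : ℂ)) * riemannZeta (1 + α) +
        ∑ n ∈ Finset.range (N + 1), ((-(x : ℂ)) ^ n / (n.factorial : ℂ)) *
          riemannZeta (b - (a : ℂ) * n) * riemannZeta (b - (a : ℂ) * n - α)))
      =o[nhdsWithin 0 (Set.Ioi 0)]
    fun x : ℝ => x ^ N := by
  have ha' : (a : ℂ) ≠ 0 := by exact_mod_cast ha.ne'
  let G : ℂ → ℂ := fun s =>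
    Complex.Gamma s * (riemannZeta (a * s + b) * riemannZeta (a * s + (b - α)))
  let r : ℂ → ℂ := fun p => limUnder (𝓝[≠] p) fun s => (s - p) * G s
  set p₁ : ℂ := (1 - b) / a with hp₁
  set p₂ : ℂ := (1 - b + α) / a with hp₂
  have hap₁ : a * p₁ = 1 - b := mul_div_cancel₀ _ ha'
  have hap₂ : a * p₂ = 1 - b + α := mul_div_cancel₀ _ ha'
  have hp₁n : ∀ m : ℕ, p₁ ≠ -m := fun m h => hb1 m (by rw [h] at hap₁; linear_combination -hap₁)
  have hp₂n : ∀ m : ℕ, p₂ ≠ -m := fun m h => hb2 m (by rw [h] at hap₂; linear_combination -hap₂)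
  have hp₁₂ : p₁ ≠ p₂ := fun h => hα (by rw [h] at hap₁; linear_combination hap₁ - hap₂)
  have hb : ∀ n : ℕ, a * -n + b ≠ 1 := fun n h => hb1 n (by linear_combination -h)
  have hd : ∀ n : ℕ, a * -n + (b - α) ≠ 1 := fun n h => hb2 n (by linear_combination -h)
  have ht₁ : Tendsto (fun s => (s - p₁) * G s) (𝓝[≠] p₁)
      (𝓝 (1 / a * Complex.Gamma p₁ * riemannZeta (1 - α))) := by
    have h := tendsto_mul_Gamma_zeta_zeta_of_zeta_pole ha (b := b) (d := b - α) (p := p₁)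
      (by linear_combination hap₁) (fun h => hα (by linear_combination hap₁ - h)) hp₁n
    rwa [show a * p₁ + (b - α) = 1 - α by linear_combination hap₁] at h
  have ht₂ : Tendsto (fun s => (s - p₂) * G s) (𝓝[≠] p₂)
      (𝓝 (1 / a * Complex.Gamma p₂ * riemannZeta (1 + α))) := by
    have h := tendsto_mul_Gamma_zeta_zeta_of_zeta_pole ha (b := b - α) (d := b) (p := p₂)
      (by linear_combination hap₂) (fun h => hα (by linear_combination h - hap₂)) hp₂n
    rw [show a * p₂ + b = 1 + α by linear_combination hap₂] at h
    exact h.congr fun s => by simp only [G, mul_comm]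
  have ht : ∀ n : ℕ, Tendsto (fun s => (s - -n) * G s) (𝓝[≠] (-n : ℂ))
      (𝓝 ((-1) ^ n / n.factorial * riemannZeta (b - a * n) * riemannZeta (b - a * n - α))) := by
    intro n
    have h := tendsto_mul_Gamma_zeta_zeta_neg_nat n (hb n) (hd n)
    rwa [show a * -n + b = b - a * n by ring, show a * -n + (b - α) = b - a * n - α by ring] at h
  obtain ⟨k, hk⟩ := exists_nat_ge (max (-p₁.re) (-p₂.re))
  obtain ⟨c, hc⟩ := exists_gt (max (max 0 (max p₁.re p₂.re))
    (max ((1 - b.re) / a) ((1 - (b - α).re) / a)))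
  simp only [max_lt_iff, div_lt_iff₀' ha] at hc
  obtain ⟨⟨hc0, hc1, hc2⟩, hc3, hc4⟩ := hc
  have hk1 := (le_max_left _ _).trans hk
  have hk2 := (le_max_right _ _).trans hk
  set M := N + k with hM
  let S : Finset ℂ := insert p₁ (insert p₂ ((Finset.range (M + 1)).image fun n : ℕ => (-n : ℂ)))
  have hMk : (k : ℝ) ≤ M := by exact_mod_cast Nat.le_add_left k N
  have hNM : (N : ℝ) ≤ M := by exact_mod_cast Nat.le_add_right N k
  have hSmem : ∀ p ∈ S, p = p₁ ∨ p = p₂ ∨ ∃ n : ℕ, n ≤ M ∧ p = -n := fun p hp => by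
    simp only [S, Finset.mem_insert, Finset.mem_image, Finset.mem_range] at hp
    rcases hp with h | h | ⟨n, hn, h⟩
    · exact Or.inl h
    · exact Or.inr (Or.inl h)
    · exact Or.inr (Or.inr ⟨n, by omega, h.symm⟩)
  obtain ⟨C, hC⟩ := exists_norm_mellinInv_sub_residues_le (G := G) (S := S) (r := r)
    (c₀ := -M - 3 / 4) (c' := -M - 1 / 2) (c := c) (by linarith) (by linarith)
    (fun s ⟨hs, hsS⟩ => by
      have hs1 : ∀ m : ℕ, s ≠ -m := fun m h => by
        refine hsS (h ▸ ?_)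
        simp only [S, Finset.coe_insert, Finset.coe_image, Set.mem_insert_iff]
        refine Or.inr (Or.inr ⟨m, ?_, rfl⟩)
        have hs' : -M - 3 / 4 < s.re := hs
        rw [h] at hs'
        simp only [neg_re, natCast_re] at hs'
        have : (m : ℝ) < (M + 1 : ℕ) := by push_cast; linarith
        simpa using (by exact_mod_cast this : m < M + 1)
      have hs2 : a * s + b ≠ 1 := fun h => hsS (by
        have : s = p₁ := mul_left_cancel₀ ha' (by linear_combination h - hap₁)
        simp [S, this])
      have hs3 : a * s + (b - α) ≠ 1 := fun h => hsS (by
        have : s = p₂ := mul_left_cancel₀ ha' (by linear_combination h - hap₂)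
        simp [S, this])
      exact ((Complex.differentiableAt_Gamma s hs1).mul
        ((differentiableAt_riemannZeta_affine hs2).mul
          (differentiableAt_riemannZeta_affine hs3))).differentiableWithinAt)
    (fun p hp => by
      rcases hSmem p hp with rfl | rfl | ⟨n, hn, rfl⟩
      · exact ⟨by linarith, hc1⟩
      · exact ⟨by linarith, hc2⟩
      · have : (n : ℝ) ≤ M := by exact_mod_cast hn
        have h0 : (0 : ℝ) ≤ n := n.cast_nonneg
        simp only [neg_re, natCast_re]
        exact ⟨by linarith, by linarith⟩)
    (fun p hp => by
      rcases hSmem p hp with rfl | rfl | ⟨n, hn, rfl⟩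
      exacts [tendsto_nhds_limUnder ⟨_, ht₁⟩, tendsto_nhds_limUnder ⟨_, ht₂⟩,
        tendsto_nhds_limUnder ⟨_, ht n⟩])
    (verticalDecay_Gamma_mul_zeta_mul_zeta ha b (b - α) _ c)
  let t : ℕ → ℂ := fun n =>
    (-1) ^ n / n.factorial * riemannZeta (b - a * n) * riemannZeta (b - a * n - α)
  have hsum : ∀ x : ℝ, ∑ p ∈ S, r p * (x : ℂ) ^ (-p) =
      1 / a * Complex.Gamma p₁ * riemannZeta (1 - α) * (x : ℂ) ^ (-p₁) +
      (1 / a * Complex.Gamma p₂ * riemannZeta (1 + α) * (x : ℂ) ^ (-p₂) +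
        ∑ n ∈ Finset.range (M + 1), t n * (x : ℂ) ^ n) := fun x => by
    rw [Finset.sum_insert, Finset.sum_insert, Finset.sum_image]
    · rw [show r p₁ = _ from ht₁.limUnder_eq, show r p₂ = _ from ht₂.limUnder_eq]
      congr 2
      refine Finset.sum_congr rfl fun n _ => ?_
      rw [show r (-n) = t n from (ht n).limUnder_eq, neg_neg, Complex.cpow_natCast]
    · intro m _ n _ h
      exact_mod_cast neg_injective h
    · simpa using fun n _ => (hp₂n n).symm
    · simpa [hp₁₂] using fun n _ => (hp₁n n).symm
  have hmain : (fun x : ℝ => mellinInv c G x - ∑ p ∈ S, r p * (x : ℂ) ^ (-p)) =o[𝓝[>] 0]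
      fun x : ℝ => x ^ N := by
    have hhalf : (fun x : ℝ => x ^ (1 / 2 : ℝ)) =o[𝓝[>] 0] fun _ => (1 : ℝ) := by
      rw [isLittleO_one_iff]
      have := (Real.continuousAt_rpow_const 0 (1 / 2 : ℝ) (Or.inr (by norm_num))).tendsto
      rw [Real.zero_rpow (by norm_num)] at this
      exact this.mono_left nhdsWithin_le_nhds
    have h := (isBigO_refl (fun x : ℝ => x ^ N) (𝓝[>] 0)).mul_isLittleO hhalf
    simp only [mul_one] at h
    refine IsBigO.trans_isLittleO (IsBigO.of_bound |C| ?_) h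
    filter_upwards [Ioo_mem_nhdsGT one_pos] with x hx
    refine (hC x hx.1 hx.2).trans (mul_le_mul (le_abs_self C) ?_ (by have := hx.1; positivity)
      (abs_nonneg C))
    rw [Real.norm_of_nonneg (by have := hx.1; positivity), ← Real.rpow_natCast,
      ← Real.rpow_add hx.1]
    exact Real.rpow_le_rpow_of_exponent_ge hx.1 hx.2.le (by linarith)
  have htail : (fun x : ℝ => ∑ n ∈ Finset.Ico (N + 1) (M + 1), t n * (x : ℂ) ^ n) =o[𝓝[>] 0]
      fun x : ℝ => x ^ N := by
    refine IsLittleO.fun_sum fun n hn => ?_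
    have h : (fun x : ℝ => x ^ n) =o[𝓝[>] 0] fun x : ℝ => x ^ N :=
      (isLittleO_pow_pow (Finset.mem_Ico.1 hn).1).mono nhdsWithin_le_nhds
    refine IsBigO.trans_isLittleO (IsBigO.of_bound ‖t n‖ (Eventually.of_forall fun x => ?_)) h
    simp
  refine (hmain.add htail).congr' ?_ EventuallyEq.rfl
  filter_upwards [self_mem_nhdsWithin] with x hx
  rw [tsum_sigmaC_mul_exp hc0 hx (by linarith) (by linarith), hsum,
    ← Finset.sum_range_add_sum_Ico (fun n => t n * (x : ℂ) ^ n) (by omega : N + 1 ≤ M + 1)]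
  have hx₁ : -p₁ = (b - 1) / a := by rw [hp₁]; ring
  have hx₂ : -p₂ = (b - 1 - α) / a := by rw [hp₂]; ring
  have ht' : ∑ n ∈ Finset.range (N + 1), ((-(x : ℂ)) ^ n / (n.factorial : ℂ)) *
      riemannZeta (b - a * n) * riemannZeta (b - a * n - α) =
      ∑ n ∈ Finset.range (N + 1), t n * (x : ℂ) ^ n := by
    refine Finset.sum_congr rfl fun n _ => ?_
    rw [neg_pow]
    ring
  rw [ht', ← hx₁, ← hx₂]
  ring
end
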